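/- A recurrent orientation-reversing homeomorphism of the 2-sphere that has a fixed point is an involution (f² = id). -/

import Mathlib

open Filter Topology Metric

/-- `f` is recurrent with respect to the metric `m`: some sequence of iterates
`f^[n k]` with `n k → ∞` converges uniformly to the identity. -/
def RecurrentWith {X : Type*} (m : MetricSpace X) (f : X → X) : Prop :=
  ∃ n : ℕ → ℕ, Filter.Tendsto n Filter.atTop Filter.atTop ∧
    ∀ ε > 0, ∀ᶠ k in Filter.atTop, ∀ x, @dist X m.toDist (f^[n k] x) x < ε

/-- `f` is a recurrent map of the metric space `X`. -/
def IsRecurrent {X : Type*} [m : MetricSpace X] (f : X → X) : Prop :=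
  RecurrentWith m f

/-- The standard 2-sphere. -/
abbrev Sphere2 : Set (EuclideanSpace ℝ (Fin 3)) := Metric.sphere 0 1

/-- A homeomorphism of the sphere is orientation-preserving iff it has degree `+1`,
equivalently (by Hopf's theorem) iff it is homotopic to the identity. -/
def SphereOrientationPreserving (f : Sphere2 ≃ₜ Sphere2) : Prop :=
  ContinuousMap.Homotopic ⟨f, f.continuous⟩ (ContinuousMap.id Sphere2)

open scoped UpperHalfPlane MatrixGroups

/-! ### Logarithms -/

lemma exists_clog {A : Type*} [TopologicalSpace A] [SimplyConnectedSpace A]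
    [LocallyPathConnectedSpace A] (F : A → ℂ) (hF : Continuous F) (h0 : ∀ a, F a ≠ 0) :
    ∃ l : A → ℂ, Continuous l ∧ ∀ a, Complex.exp (l a) = F a := by
  have a0 : A := Classical.arbitrary A
  obtain ⟨G, ⟨-, hG⟩, -⟩ := Complex.isCoveringMapOn_exp.existsUnique_continuousMap_lifts
    (⟨F, hF⟩ : C(A, ℂ)) (e₀ := Complex.log (F a0)) (a₀ := a0) (by simp [Complex.exp_log (h0 a0)])
    (by simpa using h0)
  exact ⟨G, G.continuous, fun a => congrFun hG a⟩

lemma exp_one_const {A : Type*} [TopologicalSpace A] {s : Set A} (hs : IsPreconnected s)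
    (l : A → ℂ) (hl : ContinuousOn l s) (h1 : ∀ a ∈ s, Complex.exp (l a) = 1) :
    ∃ n : ℤ, ∀ a ∈ s, l a = n * (2 * Real.pi * Complex.I) := by
  rcases s.eq_empty_or_nonempty with rfl | ⟨a0, ha0⟩
  · exact ⟨0, by simp⟩
  have hn : ∀ a, ∃ n : ℤ, a ∈ s → l a = n * (2 * Real.pi * Complex.I) := by
    intro a
    by_cases ha : a ∈ s
    · obtain ⟨n, hn⟩ := Complex.exp_eq_one_iff.1 (h1 a ha)
      exact ⟨n, fun _ => hn⟩
    · exact ⟨0, fun h => absurd h ha⟩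
  choose n hn using hn
  have hc : ContinuousOn n s := by
    have hR : ContinuousOn (fun a => ((n a : ℤ) : ℝ)) s := by
      have : ContinuousOn (fun a => (l a).im / (2 * Real.pi)) s :=
        (Complex.continuous_im.comp_continuousOn hl).div_const _
      refine this.congr fun a ha => ?_
      have hp := Real.pi_ne_zero
      simp only [hn a ha]
      simp
    exact Int.isClosedEmbedding_coe_real.isEmbedding.continuousOn_iff.2 hR
  refine ⟨n a0, fun a ha => ?_⟩
  rw [hn a ha, hs.constant hc ha ha0]

lemma clog_diff_const {A : Type*} [TopologicalSpace A] {s : Set A} (hs : IsPreconnected s)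
    (l l' : A → ℂ) (hl : ContinuousOn l s) (hl' : ContinuousOn l' s)
    (h1 : ∀ a ∈ s, Complex.exp (l a) = Complex.exp (l' a)) :
    ∃ n : ℤ, ∀ a ∈ s, l a = l' a + n * (2 * Real.pi * Complex.I) := by
  obtain ⟨n, hn⟩ := exp_one_const hs (fun a => l a - l' a) (hl.sub hl') (fun a ha => by
    rw [Complex.exp_sub, h1 a ha, div_self (Complex.exp_ne_zero _)])
  exact ⟨n, fun a ha => by rw [← hn a ha]; ring⟩

/-- off-diagonal -/
def OD (P : Type*) : Set (P × P) := {p | p.1 ≠ p.2}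

lemma OD_open {P : Type*} [TopologicalSpace P] [T2Space P] : IsOpen (OD P) :=
  isOpen_ne_fun continuous_fst continuous_snd

lemma isPreconnected_OD_complex : IsPreconnected (OD ℂ) := by
  have : OD ℂ = Set.range (fun p : ℂ × ℂ => (p.1 + Complex.exp p.2, p.1)) := by
    ext ⟨x, y⟩
    simp only [OD, Set.mem_ofPred_eq, Set.mem_range, Prod.mk.injEq, Prod.exists]
    constructor
    · intro h
      exact ⟨y, Complex.log (x - y), by rw [Complex.exp_log (sub_ne_zero.2 h)]; ring, rfl⟩
    · rintro ⟨a, b, rfl, rfl⟩ h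
      exact Complex.exp_ne_zero b (by simpa using h)
  rw [this]
  exact isPreconnected_range (by fun_prop)

lemma isPreconnected_OD {P : Type*} [TopologicalSpace P] (e : P ≃ₜ ℂ) : IsPreconnected (OD P) := by
  have : OD P = (Prod.map e.symm e.symm) '' OD ℂ := by
    ext ⟨x, y⟩
    simp only [OD, Set.mem_ofPred_eq, Set.mem_image, Prod.exists, Prod.map_apply, Prod.mk.injEq]
    constructor
    · intro h
      exact ⟨e x, e y, fun h' => h (e.injective h'), by simp, by simp⟩
    · rintro ⟨a, b, hab, rfl, rfl⟩ h
      exact hab (e.symm.injective h)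
  rw [this]
  exact isPreconnected_OD_complex.image _ (by fun_prop)

lemma clog_local_to_global_aux (F : ℂ × ℂ → ℂ) (hF : ContinuousOn F (OD ℂ))
    (h0 : ∀ p ∈ OD ℂ, F p ≠ 0) (B : Set ℂ) (hB : IsOpen B) (hBn : B.Nonempty)
    (l : ℂ × ℂ → ℂ) (hl : ContinuousOn l (OD ℂ ∩ B ×ˢ B))
    (hlF : ∀ p ∈ OD ℂ ∩ B ×ˢ B, Complex.exp (l p) = F p) :
    ∃ L : ℂ × ℂ → ℂ, ContinuousOn L (OD ℂ) ∧ ∀ p ∈ OD ℂ, Complex.exp (L p) = F p := by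
  set J : ℂ × ℂ → ℂ × ℂ := fun p => (p.1 + Complex.exp p.2, p.1) with hJ
  have hJc : Continuous J := by fun_prop
  have hJm : ∀ p, J p ∈ OD ℂ := fun p h => Complex.exp_ne_zero p.2 (by simpa [hJ] using h)
  obtain ⟨M, hMc, hM⟩ := exists_clog (fun p => F (J p))
    (hF.comp_continuous hJc hJm) (fun p => h0 _ (hJm p))
  obtain ⟨w, hw⟩ := clog_diff_const (s := Set.univ) isPreconnected_univ
    (fun p : ℂ × ℂ => M (p.1, p.2 + 2 * Real.pi * Complex.I)) M (by fun_prop) hMc.continuousOn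
    (fun p _ => by simp [hM, hJ, Complex.exp_periodic p.2])
  have hw0 : w = 0 := by
    obtain ⟨y, hy⟩ := hBn
    obtain ⟨r, hr, hrB⟩ := Metric.isOpen_iff.1 hB y hy
    set S : ℝ → ℂ × ℂ := fun t => (y, Real.log (r/2) + t * Complex.I) with hS
    have hSc : Continuous S := by fun_prop
    have hJS : ∀ t, J (S t) ∈ OD ℂ ∩ B ×ˢ B := by
      intro t
      refine ⟨hJm _, hrB ?_, hy⟩
      simp only [hJ, hS, mem_ball, dist_eq_norm, add_sub_cancel_left, Complex.norm_exp]
      simp [Real.exp_log (half_pos hr), hr]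
    obtain ⟨c, hc⟩ := clog_diff_const (s := Set.univ) isPreconnected_univ
      (fun t => l (J (S t))) (fun t => M (S t))
      (hl.comp_continuous (hJc.comp hSc) hJS).continuousOn (hMc.comp hSc).continuousOn
      (fun t _ => by rw [hlF _ (hJS t), hM])
    have h1 := hc (2 * Real.pi) trivial
    have h2 := hc 0 trivial
    have h3 := hw (S 0) trivial
    have e1 : S (2 * Real.pi) = ((S 0).1, (S 0).2 + 2 * Real.pi * Complex.I) := by
      simp [hS]
    have e2 : J (S (2 * Real.pi)) = J (S 0) := by
      rw [e1]; simp [hJ, Complex.exp_periodic (S 0).2]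
    rw [e2, h2, e1, h3] at h1
    have : (w : ℂ) * (2 * Real.pi * Complex.I) = 0 := by linear_combination -h1
    have h4 := Complex.two_pi_I_ne_zero
    have := (mul_eq_zero.1 this).resolve_right h4
    exact_mod_cast this
  have hper : ∀ y s s', Complex.exp s = Complex.exp s' → M (y, s) = M (y, s') := by
    have h1 : ∀ y s, M (y, s + 2 * Real.pi * Complex.I) = M (y, s) := by
      intro y s
      have := hw (y, s) trivial
      simpa [hw0] using this
    intro y s s' h
    obtain ⟨n, hn⟩ := Complex.exp_eq_exp_iff_exists_int.1 h
    have hp : Function.Periodic (fun s => M (y, s)) (2 * Real.pi * Complex.I) := fun s => h1 y s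
    have := hp.int_mul n s'
    rw [hn]; exact this
  refine ⟨fun p => M (p.2, Complex.log (p.1 - p.2)), ?_, ?_⟩
  · intro p hp
    apply ContinuousAt.continuousWithinAt
    have hp' : p.1 - p.2 ≠ 0 := sub_ne_zero.2 hp
    by_cases hs : p.1 - p.2 ∈ Complex.slitPlane
    · have : ContinuousAt (fun p : ℂ × ℂ => Complex.log (p.1 - p.2)) p :=
        ContinuousAt.clog (by fun_prop) hs
      exact hMc.continuousAt.comp (continuousAt_snd.prodMk this)
    · have hs' : p.2 - p.1 ∈ Complex.slitPlane := by
        rcases Complex.mem_slitPlane_or_neg_mem_slitPlane hp' with h | h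
        · exact absurd h hs
        · simpa using h
      have : ContinuousAt (fun p : ℂ × ℂ => Complex.log (p.2 - p.1) + Real.pi * Complex.I) p :=
        ContinuousAt.add (ContinuousAt.clog (f := fun p : ℂ × ℂ => p.2 - p.1) (by fun_prop) hs') continuousAt_const
      have h2 : ContinuousAt (fun p : ℂ × ℂ => M (p.2, Complex.log (p.2 - p.1) + Real.pi * Complex.I)) p :=
        hMc.continuousAt.comp (continuousAt_snd.prodMk this)
      refine h2.congr ?_
      filter_upwards [OD_open.mem_nhds hp] with q hq
      have hq' : q.1 - q.2 ≠ 0 := sub_ne_zero.2 hq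
      have hq'' : q.2 - q.1 ≠ 0 := sub_ne_zero.2 (Ne.symm hq)
      apply hper
      rw [Complex.exp_add, Complex.exp_log hq', Complex.exp_log hq'', Complex.exp_pi_mul_I]
      ring
  · intro p hp
    have hp' : p.1 - p.2 ≠ 0 := sub_ne_zero.2 hp
    simp [hM, hJ, Complex.exp_log hp']

lemma clog_local_to_global {P : Type*} [TopologicalSpace P] (e : P ≃ₜ ℂ)
    (F : P × P → ℂ) (hF : ContinuousOn F (OD P))
    (h0 : ∀ p ∈ OD P, F p ≠ 0) (B : Set P) (hB : IsOpen B) (hBn : B.Nonempty)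
    (l : P × P → ℂ) (hl : ContinuousOn l (OD P ∩ B ×ˢ B))
    (hlF : ∀ p ∈ OD P ∩ B ×ˢ B, Complex.exp (l p) = F p) :
    ∃ L : P × P → ℂ, ContinuousOn L (OD P) ∧ ∀ p ∈ OD P, Complex.exp (L p) = F p := by
  set j : ℂ × ℂ → P × P := Prod.map e.symm e.symm with hj
  have hjc : Continuous j := by fun_prop
  have hjm : ∀ p ∈ OD ℂ, j p ∈ OD P := fun p hp h => hp (e.symm.injective h)
  obtain ⟨L, hL, hLF⟩ := clog_local_to_global_aux (fun p => F (j p))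
    (hF.comp hjc.continuousOn hjm) (fun p hp => h0 _ (hjm p hp)) (e.symm ⁻¹' B)
    (hB.preimage e.symm.continuous) (by obtain ⟨b, hb⟩ := hBn; exact ⟨e b, by simpa⟩)
    (fun p => l (j p)) (hl.comp hjc.continuousOn (fun p hp => ⟨hjm p hp.1, hp.2.1, hp.2.2⟩))
    (fun p hp => hlF _ ⟨hjm p hp.1, hp.2.1, hp.2.2⟩)
  have hk : ∀ p ∈ OD P, (Prod.map e e p) ∈ OD ℂ := fun p hp h => hp (e.injective h)
  refine ⟨fun p => L (Prod.map e e p), hL.comp (by fun_prop) hk, fun p hp => ?_⟩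
  rw [hLF _ (hk p hp)]
  simp [hj, Prod.map]

/-! ### Orientation preserving maps -/

/-- `L` is a continuous logarithm of the difference quotients of `g` (read through `ι`). -/
def IsLog {P : Type*} [TopologicalSpace P] (ι : P → ℂ) (g : P → P) (L : P × P → ℂ) : Prop :=
  ContinuousOn L (OD P) ∧
    ∀ x y, x ≠ y → Complex.exp (L (x, y)) * (ι x - ι y) = ι (g x) - ι (g y)

def OP {P : Type*} [TopologicalSpace P] (ι : P → ℂ) (g : P → P) : Prop := ∃ L, IsLog ι g L

lemma IsLog.symm {P : Type*} [TopologicalSpace P] (e : P ≃ₜ ℂ) {ι : P → ℂ}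
    (hι : Function.Injective ι) {g : P → P} {L : P × P → ℂ} (h : IsLog ι g L) {x y : P} (hxy : x ≠ y) :
    L (x, y) = L (y, x) := by
  have hsw : ContinuousOn (fun p : P × P => L p.swap) (OD P) :=
    h.1.comp continuous_swap.continuousOn (fun p hp => Ne.symm hp)
  obtain ⟨n, hn⟩ := clog_diff_const (isPreconnected_OD e) L (fun p => L p.swap) h.1 hsw
    (fun p hp => by
      have h1 := h.2 p.1 p.2 hp
      have h2 := h.2 p.2 p.1 (Ne.symm hp)
      have h3 : ι p.1 - ι p.2 ≠ 0 := sub_ne_zero.2 (fun h => hp (hι h))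
      apply mul_right_cancel₀ h3
      simp only [Prod.swap]
      linear_combination h1 + h2)
  have h1 := hn (x, y) hxy
  have h2 := hn (y, x) hxy.symm
  simp only [Prod.swap] at h1 h2
  linear_combination (h1 - h2) / 2

lemma IsLog.comp {P : Type*} [TopologicalSpace P] {ι : P → ℂ} {g h : P → P} {L M : P × P → ℂ}
    (hg : IsLog ι g L) (hh : IsLog ι h M) (hc : Continuous h) (hi : Function.Injective h) :
    IsLog ι (g ∘ h) (fun p => L (h p.1, h p.2) + M p) := by
  have hm : ∀ p ∈ OD P, (h p.1, h p.2) ∈ OD P := fun p hp h' => hp (hi h')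
  refine ⟨(hg.1.comp (by fun_prop) hm).add hh.1, fun x y hxy => ?_⟩
  have h1 := hg.2 (h x) (h y) (fun h' => hxy (hi h'))
  have h2 := hh.2 x y hxy
  simp only [Complex.exp_add, Function.comp]
  rw [← h1, ← h2]; ring

lemma IsLog.id {P : Type*} [TopologicalSpace P] {ι : P → ℂ} : IsLog ι (fun x : P => x) (fun _ => 0) :=
  ⟨continuousOn_const, fun x y _ => by simp⟩

lemma IsLog.inv {P : Type*} [TopologicalSpace P] {ι : P → ℂ} {g : P ≃ₜ P} {L : P × P → ℂ}
    (hg : IsLog ι g L) : IsLog ι g.symm (fun p => - L (g.symm p.1, g.symm p.2)) := by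
  have hm : ∀ p ∈ OD P, (g.symm p.1, g.symm p.2) ∈ OD P := fun p hp h' => hp (g.symm.injective h')
  refine ⟨(hg.1.comp (by fun_prop) hm).neg, fun x y hxy => ?_⟩
  have h1 := hg.2 (g.symm x) (g.symm y) (fun h' => hxy (g.symm.injective h'))
  simp only [Homeomorph.apply_symm_apply] at h1
  rw [← h1, ← mul_assoc, ← Complex.exp_add]; simp

/-- cocycle sums -/
def LS {P : Type*} (g : P → P) (L : P × P → ℂ) (m : ℕ) (p : P × P) : ℂ :=
  ∑ i ∈ Finset.range m, L (g^[i] p.1, g^[i] p.2)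

lemma LS_succ {P : Type*} (g : P → P) (L : P × P → ℂ) (m : ℕ) (p : P × P) :
    LS g L (m + 1) p = LS g L m p + L (g^[m] p.1, g^[m] p.2) := Finset.sum_range_succ _ _

lemma LS_add {P : Type*} (g : P → P) (L : P × P → ℂ) (m n : ℕ) (p : P × P) :
    LS g L (m + n) p = LS g L m p + LS g L n (g^[m] p.1, g^[m] p.2) := by
  simp only [LS, Finset.sum_range_add, ← Function.iterate_add_apply]
  simp only [add_comm m]

lemma LS_mul {P : Type*} (g : P → P) (L : P × P → ℂ) (m n : ℕ) (p : P × P) :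
    LS g L (m * n) p = LS (g^[m]) (LS g L m) n p := by
  induction n with
  | zero => simp [LS]
  | succ n ih =>
    rw [mul_add, mul_one, LS_add, ih, LS_succ, Function.iterate_mul]

lemma IsLog.iterate {P : Type*} [TopologicalSpace P] {ι : P → ℂ} {g : P → P} {L : P × P → ℂ}
    (hg : IsLog ι g L) (hc : Continuous g) (hi : Function.Injective g) (m : ℕ) :
    IsLog ι (g^[m]) (LS g L m) := by
  induction m with
  | zero =>
    refine ⟨continuousOn_const.congr (fun p _ => by simp [LS]; rfl), fun x y _ => by simp [LS]⟩
  | succ m ih =>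
    have := hg.comp ih (hc.iterate m) (hi.iterate m)
    rw [← Function.iterate_succ'] at this
    convert this using 1
    ext p
    rw [LS_succ, add_comm]


/-! ### Brouwer's lemma -/

lemma push_local (c w : ℂ) (r : ℝ) (hr : 0 < r) (hw : ‖w‖ < r / 4) :
    ∃ φ : ℂ ≃ₜ ℂ, OP (fun z : ℂ => z) φ ∧ (∀ z ∉ ball c r, φ z = z) ∧ φ c = c + w := by
  set f : ℂ → ℂ := fun z => z + (max 0 (1 - ‖z - c‖ / r) : ℝ) * w with hf
  have hfc : Continuous f := by
    have : Continuous (fun z : ℂ => max 0 (1 - ‖z - c‖ / r)) := by fun_prop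
    simp only [hf]; fun_prop
  have key : ∀ x y, ‖f x - f y - (x - y)‖ ≤ (1/4) * ‖x - y‖ := by
    intro x y
    have h1 : f x - f y - (x - y) =
        ((max 0 (1 - ‖x - c‖ / r) - max 0 (1 - ‖y - c‖ / r) : ℝ) : ℂ) * w := by
      simp only [hf]; push_cast; ring
    rw [h1, norm_mul, Complex.norm_real, Real.norm_eq_abs]
    have h2 : |max 0 (1 - ‖x - c‖ / r) - max 0 (1 - ‖y - c‖ / r)| ≤ ‖x - y‖ / r := by
      have h3 : |max 0 (1 - ‖x - c‖ / r) - max 0 (1 - ‖y - c‖ / r)| ≤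
          |(1 - ‖x - c‖ / r) - (1 - ‖y - c‖ / r)| := by
        simpa using abs_max_sub_max_le_max 0 (1 - ‖x - c‖ / r) 0 (1 - ‖y - c‖ / r)
      refine h3.trans ?_
      have h4 : (1 - ‖x - c‖ / r) - (1 - ‖y - c‖ / r) = (‖y - c‖ - ‖x - c‖) / r := by ring
      rw [h4, abs_div, abs_of_pos hr]
      gcongr
      have := abs_norm_sub_norm_le (y - c) (x - c)
      rw [sub_sub_sub_cancel_right] at this
      rwa [norm_sub_rev x y]
    calc _ ≤ (‖x - y‖ / r) * (r / 4) := by gcongr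
      _ = _ := by field_simp
  have hA : ApproximatesLinearOn f ((ContinuousLinearEquiv.refl ℂ ℂ : ℂ ≃L[ℂ] ℂ) : ℂ →L[ℂ] ℂ)
      Set.univ (1/4) := fun x _ y _ => by simpa using key x y
  let φ := hA.toHomeomorph f (Or.inr (by
    have : ‖((ContinuousLinearEquiv.refl ℂ ℂ).symm : ℂ →L[ℂ] ℂ)‖₊ = 1 := by
      ext; simp
    rw [this]
    rw [← NNReal.coe_lt_coe]; norm_num))
  have hφ : ∀ z, φ z = f z := fun z => rfl
  refine ⟨φ, ?_, ?_, ?_⟩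
  · have hK : ∀ p ∈ OD ℂ, (f p.1 - f p.2) / (p.1 - p.2) ∈ Complex.slitPlane := by
      intro p hp
      have hp' : p.1 - p.2 ≠ 0 := sub_ne_zero.2 hp
      have h1 : ‖(f p.1 - f p.2) / (p.1 - p.2) - 1‖ ≤ 1/4 := by
        rw [div_sub_one hp', norm_div, div_le_iff₀ (norm_pos_iff.2 hp')]
        exact key p.1 p.2
      left
      have h2 := (Complex.abs_re_le_norm _).trans h1
      rw [Complex.sub_re, Complex.one_re, abs_le] at h2
      linarith [h2.1]
    refine ⟨fun p => Complex.log ((f p.1 - f p.2) / (p.1 - p.2)), ?_, ?_⟩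
    · refine ContinuousOn.clog (ContinuousOn.div (by fun_prop) (by fun_prop)
        fun p hp => sub_ne_zero.2 hp) hK
    · intro x y hxy
      have hp' : x - y ≠ 0 := sub_ne_zero.2 hxy
      simp only
      rw [Complex.exp_log (Complex.slitPlane_ne_zero (hK (x, y) hxy))]
      simp only [hφ]
      field_simp
  · intro z hz
    rw [hφ]
    have : max 0 (1 - ‖z - c‖ / r) = 0 := by
      apply max_eq_left
      rw [mem_ball, dist_eq_norm, not_lt] at hz
      rw [sub_nonpos, le_div_iff₀ hr]; linarith
    simp [hf, this]
  · rw [hφ]; simp [hf]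

lemma OP.comp' {P : Type*} [TopologicalSpace P] {ι : P → ℂ} {φ ψ : P ≃ₜ P}
    (h1 : OP ι φ) (h2 : OP ι ψ) : OP ι (ψ.trans φ) := by
  obtain ⟨L, hL⟩ := h1
  obtain ⟨M, hM⟩ := h2
  exact ⟨_, hL.comp hM ψ.continuous ψ.injective⟩

lemma push (V : Set ℂ) (hV : IsOpen V) (hc : IsPreconnected V) {a b : ℂ} (ha : a ∈ V) (hb : b ∈ V) :
    ∃ φ : ℂ ≃ₜ ℂ, OP (fun z : ℂ => z) φ ∧ (∀ z ∉ V, φ z = z) ∧ φ a = b := by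
  refine hc.induction₂ (fun a b => ∃ φ : ℂ ≃ₜ ℂ, OP (fun z : ℂ => z) φ ∧ (∀ z ∉ V, φ z = z) ∧ φ a = b)
    ?_ ?_ ?_ ha hb
  · intro x hx
    obtain ⟨r, hr, hrV⟩ := Metric.isOpen_iff.1 hV x hx
    apply eventually_nhdsWithin_of_eventually_nhds
    filter_upwards [ball_mem_nhds x (show 0 < r / 4 by positivity)] with y hy
    obtain ⟨φ, h1, h2, h3⟩ := push_local x (y - x) r hr (by rwa [mem_ball, dist_eq_norm] at hy)
    exact ⟨φ, h1, fun z hz => h2 z (fun h => hz (hrV h)), by rw [h3]; ring⟩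
  · rintro x y z - - - ⟨φ, h1, h2, h3⟩ ⟨ψ, k1, k2, k3⟩
    refine ⟨φ.trans ψ, k1.comp' h1, fun z hz => ?_, ?_⟩
    · simp [h2 z hz, k2 z hz]
    · simp [h3, k3]
  · rintro x y - - ⟨φ, ⟨L, hL⟩, h2, h3⟩
    refine ⟨φ.symm, ⟨_, hL.inv⟩, fun z hz => ?_, ?_⟩
    · rw [Homeomorph.symm_apply_eq, h2 z hz]
    · rw [Homeomorph.symm_apply_eq, h3]

/-- Brouwer homeomorphisms -/
def BR (G : ℂ ≃ₜ ℂ) : Prop := OP (fun z : ℂ => z) G ∧ ∀ x, G x ≠ x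

lemma BR.push {G : ℂ ≃ₜ ℂ} (hG : BR G) {V : Set ℂ} (hV : ∀ x ∈ V, G x ∉ V) {φ : ℂ ≃ₜ ℂ}
    (h1 : OP (fun z : ℂ => z) φ) (h2 : ∀ z ∉ V, φ z = z) : BR (G.trans φ) := by
  refine ⟨h1.comp' hG.1, fun x hx => ?_⟩
  simp only [Homeomorph.trans_apply] at hx
  by_cases h : G x ∈ V
  · have hx' : x ∈ V := by
      by_contra hxV
      have : G x = x := φ.injective (by rw [hx, h2 x hxV])
      exact hG.2 x this
    exact hV x hx' h
  · rw [h2 _ h] at hx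
    exact hG.2 x hx

lemma BR.two {G : ℂ ≃ₜ ℂ} (hG : BR G) (x : ℂ) : G (G x) ≠ x := by
  intro hx
  obtain ⟨⟨L, hL⟩, hf⟩ := hG
  obtain ⟨l, hl, hle⟩ := exists_clog (fun z => G z - z) (by fun_prop) (fun z => sub_ne_zero.2 (hf z))
  have hm : ∀ z : ℂ, (z, G z) ∈ OD ℂ := fun z => (hf z).symm
  obtain ⟨n, hn⟩ := clog_diff_const (s := Set.univ) isPreconnected_univ
    (fun z : ℂ => L (z, G z)) (fun z => l (G z) - l z)
    (hL.1.comp_continuous (by fun_prop) hm).continuousOn (by fun_prop) (fun z _ => by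
      have h1 := hL.2 z (G z) (hf z).symm
      rw [Complex.exp_sub, hle, hle, eq_div_iff (sub_ne_zero.2 (hf z))]
      linear_combination -h1)
  have h1 := hn x trivial
  have h2 := hn (G x) trivial
  rw [hx] at h2
  rw [hL.symm (Homeomorph.refl ℂ) (fun a b h => h) (hf x), h1] at h2
  have h3 : l (G x) = l x := by linear_combination h2 / 2
  have h4 := hle x
  have h5 := hle (G x)
  rw [h3, h4, hx] at h5
  apply hf x
  linear_combination h5 / 2

def PN (n : ℕ) : Prop := ∀ k, 1 ≤ k → k < n → ∀ G : ℂ ≃ₜ ℂ, BR G → ∀ x, G^[k] x ≠ x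

lemma closing {n : ℕ} (hP : PN n) {G : ℂ ≃ₜ ℂ} (hG : BR G) {V : Set ℂ} (hV : IsOpen V)
    (hc : IsPreconnected V) (hfree : ∀ x ∈ V, G x ∉ V) {a : ℂ} (ha : a ∈ V) :
    ∀ k, 1 ≤ k → k < n → G^[k] a ∉ V := by
  intro k
  induction k using Nat.strong_induction_on with
  | _ k ih =>
    intro h1 h2 hk
    obtain ⟨φ, hφ, hφV, hφa⟩ := push V hV hc hk ha
    have hG' := hG.push hfree hφ hφV
    have hit : ∀ i < k, (G.trans φ)^[i] a = G^[i] a := by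
      intro i
      induction i with
      | zero => intro _; rfl
      | succ i ihi =>
        intro hi
        rw [Function.iterate_succ_apply', ihi (by omega), Homeomorph.trans_apply,
          ← Function.iterate_succ_apply' G, hφV _ (ih (i+1) hi (by omega) (by omega))]
    apply hP k h1 h2 _ hG' a
    obtain ⟨j, rfl⟩ : ∃ j, k = j + 1 := ⟨k - 1, by omega⟩
    rw [Function.iterate_succ_apply', hit j (by omega), Homeomorph.trans_apply,
      ← Function.iterate_succ_apply' G, hφa]

lemma closing_compact {n : ℕ} (hP : PN n) {G : ℂ ≃ₜ ℂ} (hG : BR G) {A : Set ℂ} (hA : IsCompact A)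
    (hc : IsPreconnected A) (hfree : ∀ x ∈ A, G x ∉ A) {a : ℂ} (ha : a ∈ A) :
    ∀ k, 1 ≤ k → k < n → G^[k] a ∉ A := by
  have hd : Disjoint A (G '' A) := by
    rw [Set.disjoint_left]
    rintro _ h1 ⟨x, hx, rfl⟩
    exact hfree x hx h1
  obtain ⟨δ, hδ, hdis⟩ := hd.exists_thickenings hA (hA.image G.continuous).isClosed
  obtain ⟨δ', hδ', hsub⟩ := hA.exists_thickening_subset_open
    (t := thickening δ A ∩ G ⁻¹' (thickening δ (G '' A)))
    (isOpen_thickening.inter (isOpen_thickening.preimage G.continuous))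
    (fun x hx => ⟨self_subset_thickening hδ _ hx,
      self_subset_thickening hδ _ (Set.mem_image_of_mem _ hx)⟩)
  intro k h1 h2 hk
  refine closing hP hG (V := thickening δ' A) isOpen_thickening ?_ ?_
    (self_subset_thickening hδ' _ ha) k h1 h2 (self_subset_thickening hδ' _ hk)
  · have : thickening δ' A = (fun p : ℂ × ℂ => p.1 + p.2) '' (A ×ˢ ball 0 δ') := by
      rw [Set.image_prod]
      exact (add_ball_zero δ' A).symm
    rw [this]
    exact (hc.prod (convex_ball _ _).isPreconnected).image _ (by fun_prop)
  · intro x hx hGx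
    exact Set.disjoint_left.1 hdis (hsub hGx).1 (hsub hx).2

/-- straight segment -/
def sg (x p : ℂ) : Set ℂ := (fun t : ℝ => x + t * (p - x)) '' Set.Icc 0 1

lemma sg_compact (x p : ℂ) : IsCompact (sg x p) := isCompact_Icc.image (by fun_prop)
lemma sg_preconn (x p : ℂ) : IsPreconnected (sg x p) := isPreconnected_Icc.image _ (by fun_prop)
lemma sg_left (x p : ℂ) : x ∈ sg x p := ⟨0, by simp, by simp⟩
lemma sg_right (x p : ℂ) : p ∈ sg x p := ⟨1, by simp, by simp⟩
lemma sg_sub {x p b : ℂ} (hb : b ∈ sg x p) : sg x b ⊆ sg x p := by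
  rintro _ ⟨t, ht, rfl⟩
  obtain ⟨s, hs, rfl⟩ := hb
  refine ⟨t * s, ⟨mul_nonneg ht.1 hs.1, mul_le_one₀ ht.2 hs.1 hs.2⟩, ?_⟩
  push_cast; ring

lemma sg_ball {x p z : ℂ} {r : ℝ} (hr : 0 < r) (hp : ‖p - x‖ = r) (hz : z ∈ sg x p) (hzp : z ≠ p) :
    z ∈ ball x r := by
  obtain ⟨t, ht, rfl⟩ := hz
  have h1 : t < 1 := lt_of_le_of_ne ht.2 (fun h => hzp (by simp [h]))
  rw [mem_ball, dist_eq_norm, add_sub_cancel_left, norm_mul, hp, Complex.norm_real, Real.norm_eq_abs,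
    abs_of_nonneg ht.1]
  nlinarith

lemma sg_inter {x p q z : ℂ} {r : ℝ} (hr : 0 < r) (hp : ‖p - x‖ = r) (hq : ‖q - x‖ = r) (hpq : p ≠ q)
    (h1 : z ∈ sg x p) (h2 : z ∈ sg x q) : z = x := by
  obtain ⟨t, ht, rfl⟩ := h1
  obtain ⟨s, hs, hst⟩ := h2
  have h3 : (s : ℂ) * (q - x) = t * (p - x) := by simpa using hst
  have h4 := congrArg norm h3
  rw [norm_mul, norm_mul, hp, hq, Complex.norm_real, Complex.norm_real, Real.norm_eq_abs,
    Real.norm_eq_abs, abs_of_nonneg ht.1, abs_of_nonneg hs.1] at h4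
  have h5 : s = t := mul_right_cancel₀ hr.ne' h4
  subst h5
  by_cases h0 : s = 0
  · simp [h0]
  · exfalso
    have := mul_left_cancel₀ (Complex.ofReal_ne_zero.2 h0) h3
    exact hpq (by linear_combination -this)

lemma free_ball (G : ℂ ≃ₜ ℂ) (x : ℂ) (hx : G x ≠ x) : ∃ r q, 0 < r ∧ q ∈ closedBall x r ∧
    G q ∈ closedBall x r ∧ (∀ z ∈ ball x r, G z ∉ closedBall x r) ∧
    (∀ z ∈ closedBall x r, G z ∉ ball x r) := by
  obtain ⟨q, hq⟩ := Continuous.exists_forall_le (β := ℂ) (f := fun z => max ‖z - x‖ ‖G z - x‖)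
    (by fun_prop) (by
      refine tendsto_atTop_mono (fun z => le_max_left _ _) ?_
      exact tendsto_norm_cocompact_atTop.comp (Homeomorph.subRight x).isClosedEmbedding.tendsto_cocompact)
  set r := max ‖q - x‖ ‖G q - x‖ with hr
  have hfr : ∀ z, ‖z - x‖ < r → ‖G z - x‖ < r → False := fun z h1 h2 =>
    absurd (hq z) (not_le.2 (max_lt h1 h2))
  have hr0 : 0 < r := by
    rcases lt_or_ge 0 r with h | h
    · exact h
    · have h1 : ‖q - x‖ ≤ 0 := (le_max_left _ _).trans h
      have h2 : ‖G q - x‖ ≤ 0 := (le_max_right _ _).trans h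
      rw [norm_le_zero_iff, sub_eq_zero] at h1 h2
      rw [h1] at h2
      exact absurd h2 hx
  have hcl : closure (ball x r) = closedBall x r := closure_ball x hr0.ne'
  refine ⟨r, q, hr0, ?_, ?_, ?_, ?_⟩
  · rw [mem_closedBall, dist_eq_norm]; exact le_max_left _ _
  · rw [mem_closedBall, dist_eq_norm]; exact le_max_right _ _
  · intro z hz hGz
    rw [← hcl, _root_.mem_closure_iff] at hGz
    obtain ⟨_, ⟨w, hw, rfl⟩, h2⟩ := hGz (G '' ball x r) (G.isOpenMap _ isOpen_ball) ⟨z, hz, rfl⟩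
    rw [mem_ball, dist_eq_norm] at hw h2
    exact hfr w hw h2
  · intro z hz hGz
    rw [← hcl, _root_.mem_closure_iff] at hz
    obtain ⟨w, hw, h2⟩ := hz (G ⁻¹' ball x r) (isOpen_ball.preimage G.continuous) hGz
    rw [Set.mem_preimage, mem_ball, dist_eq_norm] at hw
    rw [mem_ball, dist_eq_norm] at h2
    exact hfr w h2 hw

lemma brouwer_step {n : ℕ} (hn : 3 ≤ n) (hP : PN n) {G : ℂ ≃ₜ ℂ} (hG : BR G) (x : ℂ) :
    G^[n] x ≠ x := by
  intro hx
  obtain ⟨r, q, hr, hq, hp, F1, F2⟩ := free_ball G x (hG.2 x)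
  set p := G q with hpdef
  have hcc : ∀ z, z ∈ closedBall x r → z ∉ ball x r → ‖z - x‖ = r := by
    intro z h1 h2
    rw [mem_closedBall, dist_eq_norm] at h1
    rw [mem_ball, dist_eq_norm, not_lt] at h2
    exact le_antisymm h1 h2
  have hqn : ‖q - x‖ = r := hcc q hq (fun h => F1 q h hp)
  have hpn : ‖p - x‖ = r := hcc p hp (fun h => F2 q hq h)
  have hpq : p ≠ q := hG.2 q
  have hxb : x ∈ ball x r := mem_ball_self hr
  have sgc : ∀ y, ‖y - x‖ = r → sg x y ⊆ closedBall x r := by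
    intro y hy z hz
    by_cases h : z = y
    · rw [h, mem_closedBall, dist_eq_norm, hy]
    · exact ball_subset_closedBall (sg_ball hr hy hz h)
  have hpx : p ≠ x := fun h => by rw [h] at hpn; simp at hpn; linarith
  have hqx : q ≠ x := fun h => by rw [h] at hqn; simp at hqn; linarith
  have hp_q : p ∉ sg x q := fun h => by
    have := sg_ball hr hqn h hpq
    rw [mem_ball, dist_eq_norm, hpn] at this
    exact lt_irrefl _ this
  have hq_p : q ∉ sg x p := fun h => by
    have := sg_ball hr hpn h hpq.symm
    rw [mem_ball, dist_eq_norm, hqn] at this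
    exact lt_irrefl _ this
  -- points of α mapped to α
  have hα : ∀ z ∈ sg x q ∪ sg x p, G z ∈ sg x q ∪ sg x p → z = q := by
    intro z hz hGz
    have hzc : z ∈ closedBall x r := by
      rcases hz with h | h
      exacts [sgc q hqn h, sgc p hpn h]
    have hGzc : G z ∈ closedBall x r := by
      rcases hGz with h | h
      exacts [sgc q hqn h, sgc p hpn h]
    have h1 : z = q ∨ z = p := by
      by_contra hcon
      push Not at hcon
      refine F1 z ?_ hGzc
      rcases hz with h | h
      exacts [sg_ball hr hqn h hcon.1, sg_ball hr hpn h hcon.2]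
    have h2 : G z = q ∨ G z = p := by
      by_contra hcon
      push Not at hcon
      refine F2 z hzc ?_
      rcases hGz with h | h
      exacts [sg_ball hr hqn h hcon.1, sg_ball hr hpn h hcon.2]
    rcases h1 with h1 | h1
    · exact h1
    · exfalso
      rw [h1] at h2
      rcases h2 with h2 | h2
      · exact hG.two q h2
      · exact hG.2 p h2
  have hA2 : ∀ v ∈ sg x q, G (G v) ∈ sg x p → False := by
    intro v hv hb
    by_cases hbp : G (G v) = p
    · have hvq : v ≠ q := fun h => by
        rw [h, ← hpdef] at hbp
        exact hG.2 _ hbp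
      have hqv : q ∉ sg x v := fun h => by
        obtain ⟨t, ht, hteq⟩ := h
        obtain ⟨s, hs, rfl⟩ := hv
        have := sg_ball hr hqn ⟨s, hs, rfl⟩ hvq
        simp only [add_sub_cancel_left] at hteq
        have h2 := congrArg norm (show (t : ℂ) * (s * (q - x)) = q - x by linear_combination hteq)
        rw [norm_mul, norm_mul, hqn, Complex.norm_real, Complex.norm_real, Real.norm_eq_abs,
          Real.norm_eq_abs, abs_of_nonneg ht.1, abs_of_nonneg hs.1] at h2
        rw [mem_ball, dist_eq_norm, add_sub_cancel_left, norm_mul, hqn, Complex.norm_real,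
          Real.norm_eq_abs, abs_of_nonneg hs.1] at this
        nlinarith [ht.2, mul_nonneg hs.1 hr.le]
      refine closing_compact hP hG (A := sg x v ∪ sg x p) ((sg_compact _ _).union (sg_compact _ _))
        ((sg_preconn x v).union x (sg_left _ _) (sg_left _ _) (sg_preconn x p)) ?_
        (Or.inl (sg_right x v)) 2 (by norm_num) (by omega) (Or.inr hb)
      intro z hz hGz
      have := hα z (Set.union_subset_union_left _ (sg_sub hv) hz)
        (Set.union_subset_union_left _ (sg_sub hv) hGz)
      rw [this] at hz
      rcases hz with h | h
      exacts [hqv h, hq_p h]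
    · have hpv : p ∉ sg x (G (G v)) := fun h => by
        obtain ⟨t, ht, hteq⟩ := h
        obtain ⟨s, hs, hseq⟩ := hb
        have := sg_ball hr hpn ⟨s, hs, hseq⟩ hbp
        rw [← hseq] at hteq this
        simp only [add_sub_cancel_left] at hteq
        have h2 := congrArg norm (show (t : ℂ) * (s * (p - x)) = p - x by linear_combination hteq)
        rw [norm_mul, norm_mul, hpn, Complex.norm_real, Complex.norm_real, Real.norm_eq_abs,
          Real.norm_eq_abs, abs_of_nonneg ht.1, abs_of_nonneg hs.1] at h2
        rw [mem_ball, dist_eq_norm, add_sub_cancel_left, norm_mul, hpn, Complex.norm_real,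
          Real.norm_eq_abs, abs_of_nonneg hs.1] at this
        nlinarith [ht.2, mul_nonneg hs.1 hr.le]
      refine closing_compact hP hG (A := sg x q ∪ sg x (G (G v))) ((sg_compact _ _).union (sg_compact _ _))
        ((sg_preconn x q).union x (sg_left _ _) (sg_left _ _) (sg_preconn x _)) ?_
        (Or.inl hv) 2 (by norm_num) (by omega) (Or.inr (sg_right _ _))
      intro z hz hGz
      have := hα z (Set.union_subset_union_right _ (sg_sub hb) hz)
        (Set.union_subset_union_right _ (sg_sub hb) hGz)
      rw [this] at hGz
      rcases hGz with h | h
      exacts [hp_q h, hpv h]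
  set δ : Set ℂ := sg x p ∪ G '' sg x q with hδ
  have hδG : ∀ u ∈ δ, G u ∈ δ → u = x := by
    intro u hu hGu
    rcases hu with hu | ⟨v, hv, rfl⟩
    · rcases hGu with h | ⟨v, hv, hvu⟩
      · have := hα u (Or.inr hu) (Or.inr h)
        rw [this] at hu
        exact absurd hu hq_p
      · have := G.injective hvu
        rw [this] at hv
        exact sg_inter hr hpn hqn hpq hu hv
    · exfalso
      rcases hGu with h | ⟨w, hw, hwu⟩
      · exact hA2 v hv h
      · have := G.injective hwu
        rw [this] at hw
        have h2 := hα v (Or.inl hv) (Or.inl hw)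
        rw [h2] at hw
        exact hp_q hw
  have hxδ : x ∉ G '' δ := by
    rintro ⟨u, hu | ⟨v, hv, rfl⟩, hux⟩
    · have := hα u (Or.inr hu) (by rw [hux]; exact Or.inl (sg_left _ _))
      rw [this] at hu
      exact hq_p hu
    · exact hA2 v hv (by rw [hux]; exact sg_left _ _)
  have hxGq : x ∉ G '' sg x q := by
    rintro ⟨v, hv, hvx⟩
    have := hα v (Or.inl hv) (by rw [hvx]; exact Or.inl (sg_left _ _))
    rw [this] at hvx
    exact hpx hvx
  have hδc : IsCompact δ := (sg_compact _ _).union ((sg_compact _ _).image G.continuous)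
  -- choice of N
  have hev : ∀ᶠ y in 𝓝 x, y ∉ G '' δ ∧ ∀ j ∈ Finset.Ico 1 n, y ≠ G^[j] x := by
    have h0 : ∀ᶠ y in 𝓝 x, y ∉ G '' δ := (hδc.image G.continuous).isClosed.isOpen_compl.mem_nhds hxδ
    refine h0.and ?_
    rw [eventually_all_finset]
    intro j hj
    rw [Finset.mem_Ico] at hj
    exact isOpen_ne.mem_nhds (hP j hj.1 hj.2 G hG x).symm
  obtain ⟨ε, hε, hN⟩ := Metric.eventually_nhds_iff_ball.1 hev
  set ε' := min ε r with hε'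
  have hε'0 : 0 < ε' := lt_min hε hr
  have hNfree : ∀ z ∈ ball x ε', G z ∉ ball x ε' := fun z hz h =>
    F1 z (ball_subset_ball (min_le_right _ _) hz)
      (ball_subset_closedBall (ball_subset_ball (min_le_right _ _) h))
  set t : ℝ := ε' / (2 * r) with ht
  have ht0 : 0 < t := by positivity
  have ht1 : t ≤ 1 / 2 := by
    rw [ht, div_le_iff₀ (by positivity)]
    have : ε' ≤ r := min_le_right _ _
    linarith
  set y : ℂ := x + t * (p - x) with hy
  have hyδ : y ∈ sg x p := ⟨t, ⟨ht0.le, by linarith⟩, rfl⟩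
  have hyN : y ∈ ball x ε' := by
    rw [mem_ball, dist_eq_norm, hy, add_sub_cancel_left, norm_mul, hpn, Complex.norm_real,
      Real.norm_eq_abs, abs_of_pos ht0, ht]
    field_simp
    norm_num
  obtain ⟨φ, hφ1, hφ2, hφx⟩ := push (ball x ε') isOpen_ball (convex_ball _ _).isPreconnected
    (mem_ball_self hε'0) hyN
  have hG' := hG.push hNfree hφ1 hφ2
  have hNε : ∀ z ∈ ball x ε', z ∈ ball x ε := fun z hz => ball_subset_ball (min_le_left _ _) hz
  have hyp : sg p y ⊆ sg x p := by
    rintro _ ⟨s, hs, rfl⟩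
    refine ⟨1 - s * (1 - t), ⟨?_, ?_⟩, ?_⟩
    · nlinarith [hs.1, hs.2]
    · nlinarith [hs.1, hs.2]
    · rw [hy]; push_cast; ring
  have hxyp : x ∉ sg p y := by
    rintro ⟨s, hs, hseq⟩
    have h1 : ((1 - s * (1 - t) : ℝ) : ℂ) * (p - x) = 0 := by
      rw [hy] at hseq
      push_cast
      linear_combination hseq
    rcases mul_eq_zero.1 h1 with h | h
    · have := Complex.ofReal_eq_zero.1 h
      nlinarith [hs.1, hs.2]
    · exact hpx (sub_eq_zero.1 h)
  set δ' : Set ℂ := sg p y ∪ G '' sg x q with hδ'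
  have hδ'δ : δ' ⊆ δ := Set.union_subset_union_left _ hyp
  have hit : ∀ i, i + 1 < n → (G.trans φ)^[i] (G x) = G^[i+1] x := by
    intro i
    induction i with
    | zero => intro _; rfl
    | succ i ih =>
      intro hi
      rw [Function.iterate_succ_apply', ih (by omega), Homeomorph.trans_apply,
        ← Function.iterate_succ_apply' G]
      apply hφ2
      intro hcon
      exact (hN _ (hNε _ hcon)).2 (i+1+1) (Finset.mem_Ico.2 ⟨by omega, hi⟩) rfl
  refine closing_compact hP hG' (A := δ') ((sg_compact _ _).union ((sg_compact _ _).image G.continuous))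
    ?_ ?_ (a := G x) (Or.inr ⟨x, sg_left _ _, rfl⟩) (n - 1) (by omega) (by omega) ?_
  · exact (sg_preconn p y).union p (sg_left _ _) ⟨q, sg_right _ _, rfl⟩
      ((sg_preconn x q).image _ G.continuous.continuousOn)
  · intro u hu hGu
    have h1 : (G.trans φ) u = G u := by
      rw [Homeomorph.trans_apply]
      apply hφ2
      intro hcon
      exact (hN _ (hNε _ hcon)).1 ⟨u, hδ'δ hu, rfl⟩
    rw [h1] at hGu
    have := hδG u (hδ'δ hu) (hδ'δ hGu)
    rw [this] at hu
    rcases hu with h | h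
    exacts [hxyp h, hxGq h]
  · obtain ⟨j, rfl⟩ : ∃ j, n = j + 2 := ⟨n - 2, by omega⟩
    have : j + 2 - 1 = j + 1 := by omega
    rw [this, Function.iterate_succ_apply', hit j (by omega), Homeomorph.trans_apply,
      ← Function.iterate_succ_apply' G, hx, hφx]
    exact Or.inl (sg_right _ _)

lemma brouwer_PN (n : ℕ) : PN n := by
  induction n with
  | zero => intro k h1 h2; omega
  | succ n ih =>
    intro k h1 h2 G hG x
    rcases Nat.lt_succ_iff_lt_or_eq.1 h2 with h | rfl
    · exact ih k h1 h G hG x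
    · rcases Nat.lt_or_ge k 3 with h3 | h3
      · interval_cases k
        · exact hG.2 x
        · exact hG.two x
      · exact brouwer_step h3 ih hG x

/-- Brouwer lemma: a fixed point free orientation preserving homeomorphism of the plane has
no recurrent points. -/
lemma brouwer {G : ℂ ≃ₜ ℂ} (hG : OP (fun z : ℂ => z) G) (hf : ∀ x, G x ≠ x) (x : ℂ) :
    ∃ V ∈ 𝓝 x, ∀ k, 1 ≤ k → G^[k] x ∉ V := by
  obtain ⟨r, q, hr, -, -, F1, -⟩ := free_ball G x (hf x)
  exact ⟨ball x r, ball_mem_nhds x hr, fun k hk => closing (brouwer_PN (k+1)) ⟨hG, hf⟩ isOpen_ball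
    (convex_ball _ _).isPreconnected (fun z hz h => F1 z hz (ball_subset_closedBall h))
    (mem_ball_self hr) k hk (by omega)⟩


/-! ### Uniformization -/

lemma differentiableAt_lift {f k F : ℂ → ℂ} {z f' : ℂ} (hf : HasStrictDerivAt f f' (k z)) (hf' : f' ≠ 0)
    (hk : ContinuousAt k z) (hF : DifferentiableAt ℂ F z) (h : ∀ᶠ w in 𝓝 z, f (k w) = F w) :
    DifferentiableAt ℂ k z := by
  have hfe := hf.hasStrictFDerivAt_equiv hf'
  have h1 : ∀ᶠ w in 𝓝 z, hf.localInverse f f' (k z) hf' (f (k w)) = k w :=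
    hk.eventually (hfe.eventually_left_inverse)
  have h2 : HasStrictDerivAt (hf.localInverse f f' (k z) hf') f'⁻¹ (f (k z)) :=
    hf.to_localInverse hf'
  have h3 : f (k z) = F z := h.self_of_nhds
  rw [h3] at h2
  have h4 : DifferentiableAt ℂ (fun w => hf.localInverse f f' (k z) hf' (F w)) z :=
    h2.hasDerivAt.differentiableAt.comp z hF
  refine h4.congr_of_eventuallyEq ?_
  filter_upwards [h, h1] with w hw hw1
  rw [← hw, hw1]

lemma hlog_ball {F : ℂ → ℂ} {c : ℂ} {r : ℝ} (hr : 0 < r) (hF : DifferentiableOn ℂ F (ball c r))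
    (h0 : ∀ z ∈ ball c r, F z ≠ 0) :
    ∃ l : ℂ → ℂ, DifferentiableOn ℂ l (ball c r) ∧ ∀ z ∈ ball c r, Complex.exp (l z) = F z := by
  have hsc : IsSimplyConnected (ball c r) := by
    have : ContractibleSpace (ball c r) := (convex_ball c r).contractibleSpace ⟨c, mem_ball_self hr⟩
    exact (inferInstance : SimplyConnectedSpace (ball c r))
  obtain ⟨l, hl, hle⟩ := Complex.exists_continuousOn_eqOn_exp_comp hsc isOpen_ball hF.continuousOn
    (by rintro ⟨z, hz, hz0⟩; exact h0 z hz hz0)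
  refine ⟨l, fun z hz => ?_, fun z hz => hle hz⟩
  have hn : ball c r ∈ 𝓝 z := isOpen_ball.mem_nhds hz
  refine (differentiableAt_lift (Complex.hasStrictDerivAt_exp (l z)) (Complex.exp_ne_zero _)
    (hl.continuousAt hn) (hF.differentiableAt hn) ?_).differentiableWithinAt
  filter_upwards [hn] with w hw using hle hw

/-- disc automorphism -/
noncomputable def tau (b z : ℂ) : ℂ := (z + b) / (1 + (starRingEnd ℂ) b * z)

lemma tau_den {b z : ℂ} (hb : ‖b‖ < 1) (hz : ‖z‖ < 1) : 1 + (starRingEnd ℂ) b * z ≠ 0 := by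
  intro h
  have h1 : (starRingEnd ℂ) b * z = -1 := by linear_combination h
  have h2 := congrArg norm h1
  rw [norm_mul, RCLike.norm_conj, norm_neg, norm_one] at h2
  nlinarith [norm_nonneg b, norm_nonneg z]

lemma tau_lt {b z : ℂ} (hb : ‖b‖ < 1) (hz : ‖z‖ < 1) : ‖tau b z‖ < 1 := by
  have hd := tau_den hb hz
  rw [tau, norm_div, div_lt_one (norm_pos_iff.2 hd)]
  have key : ‖1 + (starRingEnd ℂ) b * z‖ ^ 2 - ‖z + b‖ ^ 2 = (1 - ‖b‖ ^ 2) * (1 - ‖z‖ ^ 2) := by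
    rw [← Complex.normSq_eq_norm_sq, ← Complex.normSq_eq_norm_sq, ← Complex.normSq_eq_norm_sq,
      ← Complex.normSq_eq_norm_sq]
    simp [Complex.normSq_apply]
    ring
  have h1 : 0 < (1 - ‖b‖ ^ 2) * (1 - ‖z‖ ^ 2) := by
    apply mul_pos <;> nlinarith [norm_nonneg b, norm_nonneg z]
  nlinarith [norm_nonneg (z + b), norm_nonneg (1 + (starRingEnd ℂ) b * z)]

lemma tau_neg_tau {b z : ℂ} (hb : ‖b‖ < 1) (hz : ‖z‖ < 1) : tau (-b) (tau b z) = z := by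
  have hd := tau_den hb hz
  have hd2 := tau_den (b := -b) (z := tau b z) (by simpa) (tau_lt hb hz)
  have hbb : (1 : ℂ) - (starRingEnd ℂ) b * b ≠ 0 := by
    have := tau_den (b := b) (z := -b) hb (by simpa)
    intro h; apply this; linear_combination h
  simp only [tau, map_neg] at hd2 ⊢
  rw [div_eq_iff hd2]
  generalize (starRingEnd ℂ) b = β at *
  have e : (z + b) / (1 + β * z) * (1 + β * z) = z + b := div_mul_cancel₀ _ hd
  generalize (z + b) / (1 + β * z) = y at *
  linear_combination e

lemma tau_hasDerivAt {b z : ℂ} (hb : ‖b‖ < 1) (hz : ‖z‖ < 1) :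
    HasDerivAt (tau b) ((1 - (starRingEnd ℂ) b * b) / (1 + (starRingEnd ℂ) b * z) ^ 2) z := by
  have hd := tau_den hb hz
  have h1 : HasDerivAt (fun z => z + b) 1 z := (hasDerivAt_id z).add_const b
  have h2 : HasDerivAt (fun z => 1 + (starRingEnd ℂ) b * z) ((starRingEnd ℂ) b * 1) z :=
    ((hasDerivAt_id z).const_mul _).const_add 1
  have h3 := h1.div h2 hd
  refine h3.congr_deriv ?_
  congr 1
  ring

lemma tau_diffOn {b : ℂ} (hb : ‖b‖ < 1) : DifferentiableOn ℂ (tau b) (ball 0 1) := fun z hz =>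
  (tau_hasDerivAt hb (by simpa using hz)).differentiableAt.differentiableWithinAt

/-- the section property -/
def SecP (W : Set ℂ) (Ω : Set ℂ) (p : ℂ → ℂ) : Prop :=
  ∀ a ∈ Ω, ∀ r, 0 < r → ball (p a) r ⊆ W → ∃ s : ℂ → ℂ, DifferentiableOn ℂ s (ball (p a) r) ∧
    Set.MapsTo s (ball (p a) r) Ω ∧ s (p a) = a ∧ ∀ z ∈ ball (p a) r, p (s z) = z

structure Fam (W : Set ℂ) (x0 : ℂ) (Ω : Set ℂ) (p : ℂ → ℂ) : Prop where
  op : IsOpen Ω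
  zero : (0 : ℂ) ∈ Ω
  sub : Ω ⊆ ball 0 1
  diff : DifferentiableOn ℂ p Ω
  maps : Set.MapsTo p Ω W
  base : p 0 = x0
  sec : SecP W Ω p

lemma Fam.exists_mem {W : Set ℂ} (hW : IsOpen W) (hW1 : W ⊆ ball 0 1) {x0 : ℂ} (hx0 : x0 ∈ W) :
    ∃ Ω p, Fam W x0 Ω p := by
  refine ⟨{z | x0 + 2 * z ∈ W}, fun z => x0 + 2 * z, ?_⟩
  constructor
  · exact hW.preimage (by fun_prop)
  · simpa using hx0
  · intro z hz
    have h1 := hW1 hz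
    have h2 := hW1 hx0
    rw [mem_ball_zero_iff] at h1 h2 ⊢
    have : 2 * z = (x0 + 2 * z) - x0 := by ring
    have h4 := norm_sub_le (x0 + 2 * z) x0
    rw [← this, norm_mul] at h4
    norm_num at h4
    linarith
  · fun_prop
  · intro z hz; exact hz
  · simp
  · intro a ha r hr hsub
    refine ⟨fun w => (w - x0) / 2, by fun_prop, fun w hw => ?_, by ring, fun w hw => by ring⟩
    show x0 + 2 * ((w - x0) / 2) ∈ W
    have : x0 + 2 * ((w - x0) / 2) = w := by ring
    rw [this]; exact hsub hw

lemma Fam.deriv_ge {W : Set ℂ} {x0 : ℂ} {Ω p} (h : Fam W x0 Ω p) {r : ℝ} (hr : 0 < r)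
    (hrW : ball x0 r ⊆ W) : r ≤ ‖deriv p 0‖ := by
  obtain ⟨s, hs1, hs2, hs3, hs4⟩ := h.sec 0 h.zero r hr (by rwa [h.base])
  rw [h.base] at *
  have hn : ball x0 r ∈ 𝓝 x0 := ball_mem_nhds _ hr
  have h1 : ‖deriv s x0‖ ≤ 1 / r := Complex.norm_deriv_le_div_of_mapsTo_ball hs1 (fun z hz => by
    rw [hs3]; exact ball_subset_closedBall (h.sub (hs2 hz))) hr
  have h2 : HasDerivAt s (deriv s x0) x0 := (hs1.differentiableAt hn).hasDerivAt
  have h3 : HasDerivAt p (deriv p 0) (s x0) := by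
    rw [hs3]; exact (h.diff.differentiableAt (h.op.mem_nhds h.zero)).hasDerivAt
  have h4 := h3.comp x0 h2
  have h5 : HasDerivAt (p ∘ s) 1 x0 := (hasDerivAt_id x0).congr_of_eventuallyEq (by
    filter_upwards [hn] with z hz using hs4 z hz)
  have h6 := congrArg norm (h4.unique h5)
  rw [norm_mul, norm_one] at h6
  have h7 : ‖deriv p 0‖ * ‖deriv s x0‖ ≤ ‖deriv p 0‖ * (1 / r) := by gcongr
  rw [h6] at h7
  rw [mul_one_div, le_div_iff₀ hr] at h7
  linarith

lemma Fam.sqrt_step {W : Set ℂ} {x0 : ℂ} {Ω p} (h : Fam W x0 Ω p) {a : ℂ} (ha1 : ‖a‖ < 1)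
    (ha : a ∉ Ω) : ∃ Ω' p' t, Fam W x0 Ω' p' ∧ 0 ≤ t ∧ t ^ 2 = ‖a‖ ∧
      ‖deriv p' 0‖ = ‖deriv p 0‖ * (2 * t / (1 + t ^ 2)) := by
  obtain ⟨c, hc⟩ : ∃ c : ℂ, c ^ 2 = -a := IsAlgClosed.exists_pow_nat_eq _ (by norm_num)
  have hcn : ‖c‖ ^ 2 = ‖a‖ := by rw [← norm_pow, hc, norm_neg]
  have hc1 : ‖c‖ < 1 := by nlinarith [norm_nonneg c]
  have ha0 : a ≠ 0 := fun h0 => ha (h0 ▸ h.zero)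
  set f : ℂ → ℂ := fun z => tau a ((tau c z) ^ 2) with hf
  have hsq : ∀ z : ℂ, ‖z‖ < 1 → ‖z ^ 2‖ < 1 := fun z hz => by
    rw [norm_pow]; nlinarith [norm_nonneg z]
  have hf1 : ∀ z, ‖z‖ < 1 → ‖f z‖ < 1 := fun z hz => tau_lt ha1 (hsq _ (tau_lt hc1 hz))
  have hfd : DifferentiableOn ℂ f (ball 0 1) := by
    refine (tau_diffOn ha1).comp ((tau_diffOn hc1).pow 2) fun z hz => ?_
    rw [mem_ball_zero_iff] at hz ⊢
    exact hsq _ (tau_lt hc1 hz)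
  have hf0 : f 0 = 0 := by
    simp only [hf, tau]; simp [hc]
  set Ω' : Set ℂ := ball 0 1 ∩ f ⁻¹' Ω with hΩ'
  have hop : IsOpen Ω' := hfd.continuousOn.isOpen_inter_preimage isOpen_ball h.op
  refine ⟨Ω', fun z => p (f z), ‖c‖, ?_, norm_nonneg _, hcn, ?_⟩
  · refine ⟨hop, ⟨by simp, by simpa [hf0] using h.zero⟩, Set.inter_subset_left,
      h.diff.comp (hfd.mono Set.inter_subset_left) (fun z hz => hz.2), fun z hz => h.maps hz.2,
      by simp only [hf0]; exact h.base, ?_⟩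
    intro z0 hz0 r hr hsub
    obtain ⟨s, hs1, hs2, hs3, hs4⟩ := h.sec (f z0) hz0.2 r hr hsub
    set B := ball (p (f z0)) r with hB
    have hz01 : ‖z0‖ < 1 := by simpa using hz0.1
    have hs1' : ∀ w ∈ B, ‖s w‖ < 1 := fun w hw => by simpa using h.sub (hs2 hw)
    have hna1 : ‖-a‖ < 1 := by simpa
    have hnc1 : ‖-c‖ < 1 := by simpa
    have hFd : DifferentiableOn ℂ (fun w => tau (-a) (s w)) B :=
      (tau_diffOn hna1).comp hs1 (fun w hw => by simpa using hs1' w hw)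
    have hF0 : ∀ w ∈ B, tau (-a) (s w) ≠ 0 := by
      intro w hw h0
      have h1 := tau_den hna1 (hs1' w hw)
      rw [tau, div_eq_zero_iff] at h0
      have h2 := h0.resolve_right h1
      apply ha
      have : s w = a := by linear_combination h2
      rw [← this]; exact hs2 hw
    obtain ⟨l, hl, hle⟩ := hlog_ball hr hFd hF0
    have hcen : p (f z0) ∈ B := mem_ball_self hr
    have hv : Complex.exp (l (p (f z0)) / 2) ^ 2 = (tau c z0) ^ 2 := by
      rw [← Complex.exp_nat_mul]
      have : ((2 : ℕ) : ℂ) * (l (p (f z0)) / 2) = l (p (f z0)) := by push_cast; ring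
      rw [this, hle _ hcen, hs3]
      exact tau_neg_tau ha1 (hsq _ (tau_lt hc1 hz01))
    obtain ⟨σ, hσ, hσv⟩ : ∃ σ : ℂ, σ ^ 2 = 1 ∧ σ * Complex.exp (l (p (f z0)) / 2) = tau c z0 := by
      rcases sq_eq_sq_iff_eq_or_eq_neg.1 hv with h | h
      · exact ⟨1, by simp, by rw [one_mul, h]⟩
      · exact ⟨-1, by simp, by rw [h]; ring⟩
    set k : ℂ → ℂ := fun w => σ * Complex.exp (l w / 2) with hk
    have hkd : DifferentiableOn ℂ k B := ((hl.div_const 2).cexp).const_mul σ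
    have hk2 : ∀ w ∈ B, k w ^ 2 = tau (-a) (s w) := by
      intro w hw
      rw [hk]; simp only
      rw [mul_pow, hσ, one_mul, ← Complex.exp_nat_mul]
      have : ((2 : ℕ) : ℂ) * (l w / 2) = l w := by push_cast; ring
      rw [this, hle _ hw]
    have hk1 : ∀ w ∈ B, ‖k w‖ < 1 := by
      intro w hw
      have h1 : ‖k w‖ ^ 2 < 1 := by
        rw [← norm_pow, hk2 w hw]; exact tau_lt hna1 (hs1' w hw)
      nlinarith [norm_nonneg (k w)]
    have hfk : ∀ w ∈ B, f (tau (-c) (k w)) = s w := by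
      intro w hw
      have h1 : tau c (tau (-c) (k w)) = k w := by
        have := tau_neg_tau hnc1 (hk1 w hw)
        rwa [neg_neg] at this
      simp only [hf]
      rw [h1, hk2 w hw]
      have := tau_neg_tau hna1 (hs1' w hw)
      rwa [neg_neg] at this
    refine ⟨fun w => tau (-c) (k w), (tau_diffOn hnc1).comp hkd
      (fun w hw => by simpa using hk1 w hw), fun w hw => ⟨?_, ?_⟩, ?_, fun w hw => ?_⟩
    · simpa using tau_lt hnc1 (hk1 w hw)
    · rw [Set.mem_preimage, hfk w hw]; exact hs2 hw
    · simp only [hk]; rw [hσv]; exact tau_neg_tau hc1 hz01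
    · simp only; rw [hfk w hw]; exact hs4 w hw
  · have hd1 := tau_hasDerivAt (b := c) (z := 0) hc1 (by simp)
    have ht0 : tau c 0 = c := by simp [tau]
    have hd2 : HasDerivAt (fun z => (tau c z) ^ 2) _ 0 := hd1.pow 2
    have hd3 : HasDerivAt (tau a) _ ((tau c 0) ^ 2) := tau_hasDerivAt (b := a) ha1 (by
      rw [ht0, hc]; simpa)
    have hd4 := hd3.comp (0 : ℂ) hd2
    have hd5 : HasDerivAt p (deriv p 0) (f 0) := by
      rw [hf0]; exact (h.diff.differentiableAt (h.op.mem_nhds h.zero)).hasDerivAt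
    have hd6 := hd5.comp (0 : ℂ) hd4
    have e1 : deriv (fun z => p (f z)) 0 = _ := hd6.deriv
    rw [e1, norm_mul]
    congr 1
    rw [ht0, hc]
    have hA : (starRingEnd ℂ) a * a = ((‖a‖ ^ 2 : ℝ) : ℂ) := by
      rw [Complex.conj_mul']; push_cast; rfl
    have hC : (starRingEnd ℂ) c * c = ((‖c‖ ^ 2 : ℝ) : ℂ) := by
      rw [Complex.conj_mul']; push_cast; rfl
    have e2 : 1 + (starRingEnd ℂ) a * -a = ((1 - ‖a‖ ^ 2 : ℝ) : ℂ) := by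
      push_cast [← hA]
      rw [hA]; push_cast; rw [← Complex.ofReal_pow, ← hA]; ring
    have e3 : 1 - (starRingEnd ℂ) a * a = ((1 - ‖a‖ ^ 2 : ℝ) : ℂ) := by
      rw [hA]; push_cast; ring
    have e4 : 1 - (starRingEnd ℂ) c * c = ((1 - ‖c‖ ^ 2 : ℝ) : ℂ) := by
      rw [hC]; push_cast; ring
    rw [e2, e3, e4]
    simp only [norm_mul, norm_div, norm_pow, Complex.norm_real, Real.norm_eq_abs, mul_zero, add_zero]
    have p1 : 0 < 1 - ‖a‖ ^ 2 := by nlinarith [norm_nonneg a]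
    have p2 : 0 < 1 - ‖c‖ ^ 2 := by nlinarith [norm_nonneg c]
    rw [abs_of_pos p1, abs_of_pos p2]
    have : 1 - ‖a‖ ^ 2 = (1 - ‖c‖ ^ 2) * (1 + ‖c‖ ^ 2) := by rw [← hcn]; ring
    rw [this]
    simp
    field_simp


lemma lim_hol {U : Set ℂ} (hU : IsOpen U) {f : ℕ → ℂ → ℂ} (𝒰 : Ultrafilter ℕ)
    (h : ∀ z ∈ U, ∃ r > 0, ∀ᶠ N in (𝒰 : Filter ℕ), DifferentiableOn ℂ (f N) (ball z r) ∧
      Set.MapsTo (f N) (ball z r) (ball 0 1)) :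
    ∃ F : ℂ → ℂ, DifferentiableOn ℂ F U ∧ (∀ x ∈ U, Tendsto (fun q : ℕ × ℂ => f q.1 q.2)
      ((𝒰 : Filter ℕ) ×ˢ 𝓝 x) (𝓝 (F x))) ∧ ∀ x ∈ U, ‖F x‖ ≤ 1 := by
  have h1 : ∀ x : ℂ, ∃ y : ℂ, x ∈ U → ‖y‖ ≤ 1 ∧ Tendsto (fun N => f N x) (𝒰 : Filter ℕ) (𝓝 y) := by
    intro x
    by_cases hx : x ∈ U
    · obtain ⟨r, hr, he⟩ := h x hx
      have hc : IsCompact (closedBall (0 : ℂ) 1) := isCompact_closedBall 0 1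
      obtain ⟨y, hy, hy2⟩ := hc.ultrafilter_le_nhds (𝒰.map (fun N => f N x)) (by
        rw [Filter.le_principal_iff, Ultrafilter.coe_map, Filter.mem_map]
        filter_upwards [he] with N hN
        exact ball_subset_closedBall (hN.2 (mem_ball_self hr)))
      exact ⟨y, fun _ => ⟨by simpa using hy, hy2⟩⟩
    · exact ⟨0, fun h => absurd h hx⟩
  choose F hF using h1
  have hlip : ∀ x ∈ U, ∃ r > 0, ball x r ⊆ U ∧ ∀ᶠ N in (𝒰 : Filter ℕ), DifferentiableOn ℂ (f N) (ball x r) ∧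
      ∀ y ∈ ball x r, dist (f N y) (f N x) ≤ 2 / r * dist y x := by
    intro x hx
    obtain ⟨r0, hr0, he⟩ := h x hx
    obtain ⟨r1, hr1, hs⟩ := Metric.isOpen_iff.1 hU x hx
    refine ⟨min r0 r1, lt_min hr0 hr1, (ball_subset_ball (min_le_right _ _)).trans hs, ?_⟩
    filter_upwards [he] with N hN
    have hsub : ball x (min r0 r1) ⊆ ball x r0 := ball_subset_ball (min_le_left _ _)
    refine ⟨hN.1.mono hsub, fun y hy => ?_⟩
    refine Complex.dist_le_div_mul_dist_of_mapsTo_ball (hN.1.mono hsub) ?_ hy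
    intro z hz
    have a1 := hN.2 (hsub hz)
    have a2 := hN.2 (mem_ball_self hr0)
    rw [mem_ball_zero_iff] at a1 a2
    rw [mem_closedBall, dist_eq_norm]
    linarith [norm_sub_le (f N z) (f N x)]
  have hconv : ∀ x ∈ U, Tendsto (fun q : ℕ × ℂ => f q.1 q.2) ((𝒰 : Filter ℕ) ×ˢ 𝓝 x) (𝓝 (F x)) := by
    intro x hx
    obtain ⟨r, hr, hs, he⟩ := hlip x hx
    have e1 : Tendsto (fun q : ℕ × ℂ => f q.1 x) ((𝒰 : Filter ℕ) ×ˢ 𝓝 x) (𝓝 (F x)) :=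
      (hF x hx).2.comp tendsto_fst
    have e2 : Tendsto (fun q : ℕ × ℂ => 2 / r * dist q.2 x) ((𝒰 : Filter ℕ) ×ˢ 𝓝 x) (𝓝 0) := by
      have : Tendsto (fun y : ℂ => 2 / r * dist y x) (𝓝 x) (𝓝 (2 / r * dist x x)) :=
        Continuous.tendsto (by fun_prop) x
      rw [dist_self, mul_zero] at this
      exact this.comp tendsto_snd
    refine tendsto_of_tendsto_of_dist e1 (squeeze_zero' (Eventually.of_forall fun _ => dist_nonneg) ?_ e2)
    filter_upwards [he.prod_mk (ball_mem_nhds x hr)] with q hq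
    rw [dist_comm]
    exact hq.1.2 _ hq.2
  have hcont : ContinuousOn F U := by
    intro x hx
    obtain ⟨r, hr, hs, he⟩ := hlip x hx
    have : ∀ y ∈ ball x r, dist (F y) (F x) ≤ 2 / r * dist y x := by
      intro y hy
      have t1 := ((hF y (hs hy)).2.dist (hF x hx).2)
      exact le_of_tendsto t1 (by filter_upwards [he] with N hN using hN.2 y hy)
    have e2 : Tendsto (fun y : ℂ => 2 / r * dist y x) (𝓝 x) (𝓝 0) := by
      have : Tendsto (fun y : ℂ => 2 / r * dist y x) (𝓝 x) (𝓝 (2 / r * dist x x)) :=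
        Continuous.tendsto (by fun_prop) x
      rwa [dist_self, mul_zero] at this
    refine ContinuousAt.continuousWithinAt ?_
    refine tendsto_iff_dist_tendsto_zero.2 (squeeze_zero' (Eventually.of_forall fun _ => dist_nonneg) ?_ e2)
    filter_upwards [ball_mem_nhds x hr] with y hy using this y hy
  refine ⟨F, fun x hx => ?_, hconv, fun x hx => (hF x hx).1⟩
  obtain ⟨r, hr, hs, he⟩ := hlip x hx
  have htl : TendstoLocallyUniformlyOn f F (𝒰 : Filter ℕ) (ball x r) := by
    rw [isOpen_ball.tendstoLocallyUniformlyOn_iff_forall_tendsto]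
    intro y hy
    rw [Metric.uniformity_eq_comap_nhds_zero, tendsto_comap_iff]
    have t1 : Tendsto (fun q : ℕ × ℂ => F q.2) ((𝒰 : Filter ℕ) ×ˢ 𝓝 y) (𝓝 (F y)) :=
      (hcont.continuousAt (hU.mem_nhds (hs hy))).tendsto.comp tendsto_snd
    have t2 := t1.dist (hconv y (hs hy))
    rw [dist_self] at t2
    exact t2
  have hd := htl.differentiableOn (he.mono fun N hN => hN.1) isOpen_ball
  exact (hd.differentiableAt (ball_mem_nhds x hr)).differentiableWithinAt

lemma Fam.exists_ball {W : Set ℂ} (hW : IsOpen W) (hW1 : W ⊆ ball 0 1) {x0 : ℂ} (hx0 : x0 ∈ W)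
    {ρ : ℝ} (hρ0 : 0 < ρ) (hρ : ρ < 1) : ∃ Ω p, Fam W x0 Ω p ∧ ball 0 ρ ⊆ Ω := by
  obtain ⟨r, hr, hrW⟩ := Metric.isOpen_iff.1 hW x0 hx0
  set S : Set ℝ := {d | ∃ Ω p, Fam W x0 Ω p ∧ d = ‖deriv p 0‖} with hS
  have hSb : BddBelow S := ⟨r, by rintro d ⟨Ω, p, h, rfl⟩; exact h.deriv_ge hr hrW⟩
  have hSn : S.Nonempty := by
    obtain ⟨Ω, p, h⟩ := Fam.exists_mem hW hW1 hx0
    exact ⟨_, Ω, p, h, rfl⟩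
  have hμ : r ≤ sInf S := le_csInf hSn (by rintro d ⟨Ω, p, h, rfl⟩; exact h.deriv_ge hr hrW)
  set σ := Real.sqrt ρ with hσ
  have hσ2 : σ ^ 2 = ρ := Real.sq_sqrt hρ0.le
  have hσ0 : 0 < σ := Real.sqrt_pos.2 hρ0
  have hσ1 : σ < 1 := by nlinarith
  have hκ0 : 0 < 2 * σ / (1 + σ ^ 2) := by positivity
  have hκ1 : 2 * σ / (1 + σ ^ 2) < 1 := by
    rw [div_lt_one (by positivity)]; nlinarith [sq_nonneg (1 - σ), sq_pos_of_pos (sub_pos.2 hσ1)]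
  have hlt : sInf S < sInf S / (2 * σ / (1 + σ ^ 2)) := by
    rw [lt_div_iff₀ hκ0]; nlinarith
  obtain ⟨d, ⟨Ω, p, h, rfl⟩, hd⟩ := exists_lt_of_csInf_lt hSn hlt
  refine ⟨Ω, p, h, fun a ha => ?_⟩
  by_contra haΩ
  rw [mem_ball_zero_iff] at ha
  obtain ⟨Ω', p', t, h', ht0, ht, hder⟩ := h.sqrt_step (ha.trans hρ) haΩ
  have h1 : sInf S ≤ ‖deriv p' 0‖ := csInf_le hSb ⟨Ω', p', h', rfl⟩
  rw [lt_div_iff₀ hκ0] at hd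
  have hts : t < σ := by nlinarith
  have : 2 * t / (1 + t ^ 2) ≤ 2 * σ / (1 + σ ^ 2) := by
    rw [div_le_div_iff₀ (by positivity) (by positivity)]
    have : 0 ≤ (σ - t) * (1 - σ * t) := mul_nonneg (by linarith) (by nlinarith)
    nlinarith
  have h2 : ‖deriv p 0‖ * (2 * t / (1 + t ^ 2)) ≤ ‖deriv p 0‖ * (2 * σ / (1 + σ ^ 2)) := by gcongr
  rw [← hder] at h2
  linarith

theorem unif {W : Set ℂ} (hW : IsOpen W) (hW1 : W ⊆ ball 0 1) (hWc : IsPreconnected W) {x0 : ℂ}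
    (hx0 : x0 ∈ W) : ∃ p, Fam W x0 (ball 0 1) p ∧ Set.SurjOn p (ball 0 1) W := by
  have hρ : ∀ N : ℕ, 0 < 1 - 1 / ((N : ℝ) + 2) ∧ 1 - 1 / ((N : ℝ) + 2) < 1 := by
    intro N
    have h1 : (0 : ℝ) < 1 / ((N : ℝ) + 2) := by positivity
    have h2 : 1 / ((N : ℝ) + 2) < 1 := by
      rw [div_lt_one (by positivity)]
      have : (0 : ℝ) ≤ N := N.cast_nonneg
      linarith
    constructor <;> linarith
  choose Ω p hp hball using fun N => Fam.exists_ball hW hW1 hx0 (hρ N).1 (hρ N).2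
  set 𝒰 : Ultrafilter ℕ := hyperfilter ℕ
  have hUle : (𝒰 : Filter ℕ) ≤ atTop := by
    rw [← Nat.cofinite_eq_atTop]; exact hyperfilter_le_cofinite
  have hballs : ∀ z ∈ ball (0 : ℂ) 1, ∃ r > 0, ∀ᶠ N in atTop, ball z r ⊆ Ω N := by
    intro z hz
    rw [mem_ball_zero_iff] at hz
    refine ⟨(1 - ‖z‖) / 2, by linarith, ?_⟩
    have ht : Tendsto (fun N : ℕ => 1 - 1 / ((N : ℝ) + 2)) atTop (𝓝 (1 - 0)) := by
      refine tendsto_const_nhds.sub ?_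
      have h1 : Tendsto (fun N : ℕ => (N : ℝ) + 2) atTop atTop :=
        tendsto_atTop_add_const_right _ _ tendsto_natCast_atTop_atTop
      have h2 := h1.inv_tendsto_atTop
      refine h2.congr fun N => ?_
      simp
    have h2 := ht.eventually (lt_mem_nhds (a := (1 + ‖z‖) / 2) (by linarith))
    filter_upwards [h2] with N hN y hy
    apply hball N
    rw [mem_ball_zero_iff]
    rw [mem_ball, dist_eq_norm] at hy
    have := norm_add_le (y - z) z
    rw [sub_add_cancel] at this
    linarith
  obtain ⟨P, hPd, hPc, hP1⟩ := lim_hol (U := ball 0 1) isOpen_ball (f := p) 𝒰 (by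
    intro z hz
    obtain ⟨r, hr, he⟩ := hballs z hz
    refine ⟨r, hr, hUle ?_⟩
    filter_upwards [he] with N hN
    exact ⟨(hp N).diff.mono hN, fun y hy => hW1 ((hp N).maps (hN hy))⟩)
  have hPpt : ∀ a ∈ ball (0 : ℂ) 1, Tendsto (fun N => p N a) 𝒰 (𝓝 (P a)) := fun a ha =>
    (hPc a ha).comp (tendsto_id.prodMk tendsto_const_nhds)
  have h00 : (0 : ℂ) ∈ ball (0 : ℂ) 1 := by simp
  have hP0 : P 0 = x0 := by
    refine tendsto_nhds_unique (hPpt 0 h00) ?_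
    simp only [(hp _).base]; exact tendsto_const_nhds
  -- sections
  have hsec : SecP W (ball 0 1) P := by
    intro a ha r hr hsub
    have hpa := hPpt a ha
    obtain ⟨ra, hra, hea⟩ := hballs a ha
    have hex : ∀ N, ∃ s : ℂ → ℂ, a ∈ Ω N → dist (p N a) (P a) < r → DifferentiableOn ℂ s
        (ball (p N a) (r - dist (p N a) (P a))) ∧ Set.MapsTo s (ball (p N a) (r - dist (p N a) (P a))) (Ω N) ∧
        s (p N a) = a ∧ ∀ z ∈ ball (p N a) (r - dist (p N a) (P a)), p N (s z) = z := by
      intro N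
      by_cases h1 : a ∈ Ω N
      · by_cases h2 : dist (p N a) (P a) < r
        · obtain ⟨s, hs⟩ := (hp N).sec a h1 (r - dist (p N a) (P a)) (by linarith)
            ((ball_subset_ball' (by linarith)).trans hsub)
          exact ⟨s, fun _ _ => hs⟩
        · exact ⟨0, fun _ h => absurd h h2⟩
      · exact ⟨0, fun h => absurd h h1⟩
    choose s hs using hex
    have hev : ∀ᶠ N in (𝒰 : Filter ℕ), a ∈ Ω N := hUle (hea.mono fun N hN => hN (mem_ball_self hra))
    have hdist : Tendsto (fun N => dist (p N a) (P a)) 𝒰 (𝓝 0) := tendsto_iff_dist_tendsto_zero.1 hpa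
    have hin : ∀ z ∈ ball (P a) r, ∃ r' > 0, ∀ᶠ N in (𝒰 : Filter ℕ), a ∈ Ω N ∧ dist (p N a) (P a) < r ∧
        ball z r' ⊆ ball (p N a) (r - dist (p N a) (P a)) := by
      intro z hz
      rw [mem_ball] at hz
      refine ⟨(r - dist z (P a)) / 2, by linarith, ?_⟩
      filter_upwards [hev, hdist.eventually (gt_mem_nhds hr),
        hdist.eventually (gt_mem_nhds (show (0:ℝ) < (r - dist z (P a)) / 4 by linarith))] with N h1 h2 h3
      refine ⟨h1, h2, ball_subset_ball' ?_⟩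
      have := dist_triangle z (P a) (p N a)
      rw [dist_comm (P a)] at this
      linarith
    obtain ⟨t, htd, htc, ht1⟩ := lim_hol (U := ball (P a) r) isOpen_ball (f := s) 𝒰 (by
      intro z hz
      obtain ⟨r', hr', he⟩ := hin z hz
      refine ⟨r', hr', ?_⟩
      filter_upwards [he] with N hN
      obtain ⟨k1, k2, k3, k4⟩ := hs N hN.1 hN.2.1
      exact ⟨k1.mono hN.2.2, fun y hy => (hp N).sub (k2 (hN.2.2 hy))⟩)
    have hcen : P a ∈ ball (P a) r := mem_ball_self hr
    have hta : t (P a) = a := by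
      have l1 : Tendsto (fun N => s N (p N a)) 𝒰 (𝓝 (t (P a))) :=
        (htc _ hcen).comp (tendsto_id.prodMk hpa)
      refine tendsto_nhds_unique l1 (tendsto_const_nhds.congr' ?_)
      filter_upwards [hev, hdist.eventually (gt_mem_nhds hr)] with N h1 h2
      exact (hs N h1 h2).2.2.1.symm
    have hlt : ∀ z ∈ ball (P a) r, ‖t z‖ < 1 := by
      intro z hz
      by_contra hcon
      have hz1 : ‖t z‖ = 1 := le_antisymm (ht1 z hz) (not_lt.1 hcon)
      have := Complex.norm_eqOn_of_isPreconnected_of_isMaxOn (f := t) (U := ball (P a) r) (c := z)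
        (convex_ball _ _).isPreconnected isOpen_ball htd hz (fun y hy => by
          simp only [Set.mem_ofPred_eq, Function.comp, hz1]; exact ht1 y hy) hcen
      simp only [Function.comp, Function.const, hta, hz1] at this
      rw [mem_ball_zero_iff] at ha
      linarith
    refine ⟨t, htd, fun z hz => by simpa using hlt z hz, hta, fun z hz => ?_⟩
    obtain ⟨r', hr', he⟩ := hin z hz
    have l1 : Tendsto (fun N => s N z) 𝒰 (𝓝 (t z)) :=
      (htc _ hz).comp (tendsto_id.prodMk tendsto_const_nhds)
    have l2 : Tendsto (fun N => p N (s N z)) 𝒰 (𝓝 (P (t z))) :=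
      (hPc (t z) (by simpa using hlt z hz)).comp (tendsto_id.prodMk l1)
    refine tendsto_nhds_unique l2 (tendsto_const_nhds.congr' ?_)
    filter_upwards [he] with N hN
    exact ((hs N hN.1 hN.2.1).2.2.2 z (hN.2.2 (mem_ball_self hr'))).symm
  -- nonconstant
  obtain ⟨r0, hr0, hr0W⟩ := Metric.isOpen_iff.1 hW x0 hx0
  have hanal : AnalyticOnNhd ℂ P (ball 0 1) := hPd.analyticOnNhd isOpen_ball
  have hnc : ∀ w : ℂ, ¬ Set.EqOn P (fun _ => w) (ball 0 1) := by
    intro w hw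
    obtain ⟨s, hs1, hs2, hs3, hs4⟩ := hsec 0 h00 r0 hr0 (by rwa [hP0])
    rw [hP0] at *
    have hy : x0 + (r0 / 2 : ℝ) ∈ ball x0 r0 := by
      rw [mem_ball, dist_eq_norm, add_sub_cancel_left, Complex.norm_real, Real.norm_eq_abs,
        abs_of_pos (by linarith)]
      linarith
    have e1 := hs4 _ hy
    have e2 := hs4 _ (mem_ball_self hr0)
    rw [hw (hs2 hy)] at e1
    rw [hw (hs2 (mem_ball_self hr0))] at e2
    have : ((r0 / 2 : ℝ) : ℂ) = 0 := by linear_combination e2 - e1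
    rw [Complex.ofReal_eq_zero] at this
    linarith
  have hmaps : Set.MapsTo P (ball 0 1) W := by
    intro a ha
    by_contra haW
    have hA := (hanal a ha).sub (analyticAt_const (v := P a))
    have hne : ∀ᶠ z in 𝓝[≠] a, P z ≠ P a := by
      rcases hA.eventually_eq_zero_or_eventually_ne_zero with h | h
      · exfalso
        refine hnc (P a) (hanal.eqOn_of_preconnected_of_eventuallyEq analyticOnNhd_const
          (convex_ball _ _).isPreconnected ha ?_)
        filter_upwards [h] with z hz
        simpa [sub_eq_zero] using hz
      · filter_upwards [h] with z hz h0
        exact hz (by simp [h0])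
    rw [eventually_nhdsWithin_iff, Metric.eventually_nhds_iff] at hne
    obtain ⟨ε, hε, hne⟩ := hne
    obtain ⟨ε', hε', hb'⟩ := Metric.isOpen_iff.1 (isOpen_ball (x := (0:ℂ)) (ε := 1)) a ha
    set ρ := min ε ε' / 2 with hρd
    have hmpos := lt_min hε hε'
    have hρ0 : 0 < ρ := by positivity
    have hρε : ρ < ε := by have := min_le_left ε ε'; linarith
    have hρε' : ρ < ε' := by have := min_le_right ε ε'; linarith
    have hcl : closedBall a ρ ⊆ ball (0 : ℂ) 1 := (closedBall_subset_ball hρε').trans hb'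
    have hsph : sphere a ρ ⊆ ball (0 : ℂ) 1 := sphere_subset_closedBall.trans hcl
    have hcomp : IsCompact (sphere a ρ) := isCompact_sphere a ρ
    obtain ⟨m, hm, hmle⟩ : ∃ m > 0, ∀ z ∈ sphere a ρ, 2 * m ≤ ‖P z - P a‖ := by
      obtain ⟨z1, hz1, hmin⟩ := hcomp.exists_isMinOn (NormedSpace.sphere_nonempty.2 hρ0.le)
        ((hPd.continuousOn.mono hsph).sub (continuousOn_const (c := P a))).norm
      refine ⟨‖P z1 - P a‖ / 2, ?_, fun z hz => ?_⟩
      · have : P z1 ≠ P a := hne (by rw [mem_sphere.1 hz1]; exact hρε) (by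
          intro h; rw [Set.mem_singleton_iff] at h; subst h
          rw [mem_sphere, dist_self] at hz1; linarith)
        have := norm_pos_iff.2 (sub_ne_zero.2 this)
        linarith
      · have := hmin hz
        simp only [Set.mem_ofPred_eq, Pi.sub_apply] at this
        linarith
    have hunif : ∀ᶠ N in (𝒰 : Filter ℕ), ∀ z ∈ sphere a ρ, m ≤ ‖p N z - P a‖ := by
      have : {q : ℕ × ℂ | m < ‖p q.1 q.2 - P a‖} ∈ (𝒰 : Filter ℕ) ×ˢ 𝓝ˢ (sphere a ρ) := by
        refine hcomp.mem_prod_nhdsSet_of_forall fun z hz => ?_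
        have t := ((hPc z (hsph hz)).sub (tendsto_const_nhds (x := P a))).norm
        exact t.eventually (lt_mem_nhds (by have := hmle z hz; linarith))
      rw [mem_prod_iff] at this
      obtain ⟨t1, ht1, t2, ht2, hsub⟩ := this
      filter_upwards [ht1] with N hN z hz
      exact (hsub (Set.mk_mem_prod hN (subset_of_mem_nhdsSet ht2 hz))).le
    have hclo : ∀ᶠ N in (𝒰 : Filter ℕ), closedBall a ρ ⊆ Ω N := by
      have : {q : ℕ × ℂ | q.2 ∈ Ω q.1} ∈ (𝒰 : Filter ℕ) ×ˢ 𝓝ˢ (closedBall a ρ) := by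
        refine (isCompact_closedBall a ρ).mem_prod_nhdsSet_of_forall fun z hz => ?_
        obtain ⟨r, hr, he⟩ := hballs z (hcl hz)
        have he' : ∀ᶠ N in (𝒰 : Filter ℕ), ball z r ⊆ Ω N := hUle he
        filter_upwards [he'.prod_mk (ball_mem_nhds z hr)] with q hq
        exact hq.1 hq.2
      rw [mem_prod_iff] at this
      obtain ⟨t1, ht1, t2, ht2, hsub⟩ := this
      filter_upwards [ht1] with N hN z hz
      exact hsub (Set.mk_mem_prod hN (subset_of_mem_nhdsSet ht2 hz))
    have hsmall : ∀ᶠ N in (𝒰 : Filter ℕ), ‖p N a - P a‖ < m := by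
      have := (hPpt a ha).eventually (ball_mem_nhds _ hm)
      filter_upwards [this] with N hN
      rwa [dist_eq_norm] at hN
    obtain ⟨N, h1, h2, h3⟩ := (hunif.and (hclo.and hsmall)).exists
    have hnz : ∀ z ∈ closedBall a ρ, p N z - P a ≠ 0 := by
      intro z hz h0
      apply haW
      rw [← sub_eq_zero.1 h0]
      exact (hp N).maps (h2 hz)
    have hdc : DiffContOnCl ℂ (fun z => (p N z - P a)⁻¹) (ball a ρ) := by
      have hd : DifferentiableOn ℂ (fun z => (p N z - P a)⁻¹) (closedBall a ρ) :=
        (((hp N).diff.mono h2).sub_const _).inv hnz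
      refine ⟨hd.mono ball_subset_closedBall, ?_⟩
      rw [closure_ball a hρ0.ne']; exact hd.continuousOn
    have := Complex.norm_le_of_forall_mem_frontier_norm_le isBounded_ball hdc (C := m⁻¹) (z := a) (by
      intro z hz
      rw [frontier_ball a hρ0.ne'] at hz
      rw [norm_inv]
      exact inv_anti₀ hm (h1 z hz)) (subset_closure (mem_ball_self hρ0))
    rw [norm_inv] at this
    have h5 := (inv_le_inv₀ (norm_pos_iff.2 (hnz a (mem_closedBall_self hρ0.le))) hm).1 this
    linarith
  refine ⟨P, ⟨isOpen_ball, h00, le_rfl, hPd, hmaps, hP0, hsec⟩, ?_⟩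
  refine hWc.subset_of_closure_inter_subset (u := P '' ball 0 1) ?_ ⟨x0, hx0, 0, h00, hP0⟩ ?_
  · rw [isOpen_iff_mem_nhds]
    rintro _ ⟨a, ha, rfl⟩
    obtain ⟨r, hr, hrW⟩ := Metric.isOpen_iff.1 hW _ (hmaps ha)
    obtain ⟨s, hs1, hs2, hs3, hs4⟩ := hsec a ha r hr hrW
    filter_upwards [ball_mem_nhds _ hr] with z hz
    exact ⟨s z, hs2 hz, hs4 z hz⟩
  · rintro y ⟨hy, hyW⟩
    obtain ⟨r, hr, hrW⟩ := Metric.isOpen_iff.1 hW y hyW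
    obtain ⟨_, ⟨a, ha, rfl⟩, hd⟩ := Metric.mem_closure_iff.1 hy (r / 2) (by linarith)
    obtain ⟨s, hs1, hs2, hs3, hs4⟩ := hsec a ha (r / 2) (by linarith)
      ((ball_subset_ball' (by rw [dist_comm]; linarith)).trans hrW)
    exact ⟨s y, hs2 hd, hs4 y hd⟩


lemma covering_of_sections {E : Type*} [TopologicalSpace E] [T2Space E] {W : Set ℂ} (hW : IsOpen W)
    {q : E → ℂ} (hq : Continuous q) (hinj : IsLocallyInjective q)
    (hsec : ∀ w r, 0 < r → ball (q w) r ⊆ W → ∃ s : ℂ → E, ContinuousOn s (ball (q w) r) ∧ s (q w) = w ∧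
      ∀ z ∈ ball (q w) r, q (s z) = z) : IsCoveringMapOn q W := by
  intro x hx
  obtain ⟨r, hr, hrW⟩ := Metric.isOpen_iff.1 hW x hx
  set I := q ⁻¹' {x}
  have hinj2 := hinj
  rw [isLocallyInjective_iff_nhds] at hinj2
  have hsep : IsSeparatedMap q := T2Space.isSeparatedMap q
  have huniq : ∀ (C : Set ℂ), IsPreconnected C → ∀ s t : ℂ → E, ContinuousOn s C → ContinuousOn t C →
      (∀ z ∈ C, q (s z) = z) → (∀ z ∈ C, q (t z) = z) → ∀ a ∈ C, s a = t a → ∀ z ∈ C, s z = t z := by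
    intro C hC s t hs ht hqs hqt a ha hst z hz
    exact hsep.eqOn_of_comp_eqOn hinj hC hs ht (fun z hz => by simp [hqs z hz, hqt z hz]) ha hst hz
  have hes : ∀ e : I, ∃ s : ℂ → E, ContinuousOn s (ball x r) ∧ s x = e ∧ ∀ z ∈ ball x r, q (s z) = z := by
    rintro ⟨e, he⟩
    have he' : q e = x := he
    have := hsec e r hr (by rwa [he'])
    rwa [he'] at this
  choose s hs1 hs2 hs3 using hes
  set B := ball x (r / 2)
  have hBr : B ⊆ ball x r := ball_subset_ball (by linarith)
  have hxB : x ∈ B := mem_ball_self (by linarith)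
  have hex : ∀ w : q ⁻¹' B, ∃ e : I, s e (q w) = w := by
    rintro ⟨w, hw⟩
    have hw' : q w ∈ B := hw
    rw [mem_ball] at hw'
    obtain ⟨t, ht1, ht2, ht3⟩ := hsec w (r / 2) (by linarith)
      ((ball_subset_ball' (by linarith)).trans hrW)
    have hxt : x ∈ ball (q w) (r / 2) := by rw [mem_ball, dist_comm]; exact hw'
    refine ⟨⟨t x, ht3 x hxt⟩, ?_⟩
    have := huniq (ball (q w) (r / 2) ∩ B) ((convex_ball _ _).inter (convex_ball _ _)).isPreconnected
      (s ⟨t x, ht3 x hxt⟩) t ((hs1 _).mono (Set.inter_subset_right.trans hBr))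
      (ht1.mono Set.inter_subset_left) (fun z hz => hs3 _ z (hBr hz.2)) (fun z hz => ht3 z hz.1)
      x ⟨hxt, hxB⟩ (hs2 _) (q w) ⟨mem_ball_self (by linarith), hw⟩
    rw [this, ht2]
  have huni : ∀ (e e' : I) (z : ℂ), z ∈ ball x r → s e z = s e' z → e = e' := by
    intro e e' z hz h
    have := huniq (ball x r) (convex_ball _ _).isPreconnected (s e) (s e') (hs1 e) (hs1 e')
      (hs3 e) (hs3 e') z hz h x (mem_ball_self hr)
    rw [hs2, hs2] at this
    exact Subtype.ext this
  choose ε hε using hex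
  have hloc : ∀ w : q ⁻¹' B, ∀ᶠ w' in 𝓝 w, ε w' = ε w := by
    intro w
    obtain ⟨V, hV, hVi⟩ := hinj2 w
    have c1 : ContinuousAt (fun w' : q ⁻¹' B => s (ε w) (q w')) w := by
      have : ContinuousAt (s (ε w)) (q w) := (hs1 _).continuousAt (isOpen_ball.mem_nhds (hBr w.2))
      exact this.comp (f := fun w' : q ⁻¹' B => q w') (hq.comp continuous_subtype_val).continuousAt
    have e1 : ∀ᶠ w' : q ⁻¹' B in 𝓝 w, s (ε w) (q w') ∈ V := c1 (by show V ∈ 𝓝 (s (ε w) (q w)); rw [hε w]; exact hV)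
    have e2 : ∀ᶠ w' : q ⁻¹' B in 𝓝 w, (w' : E) ∈ V := continuous_subtype_val.continuousAt hV
    filter_upwards [e1, e2] with w' h1 h2
    have h3 : s (ε w) (q w') = w' := hVi h1 h2 (hs3 _ _ (hBr w'.2))
    exact huni _ _ (q w') (hBr w'.2) (by rw [hε, h3])
  letI : TopologicalSpace I := ⊥
  haveI : DiscreteTopology I := ⟨rfl⟩
  have key : IsEvenlyCovered q x I := by
    refine ⟨inferInstance, B, hxB, isOpen_ball, isOpen_ball.preimage hq, ?_⟩
    refine ⟨{ toFun := fun w => (⟨q w, w.2⟩, ε w)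
              invFun := fun ze => ⟨s ze.2 ze.1, by
                show q (s ze.2 ze.1) ∈ B
                rw [hs3 _ _ (hBr ze.1.2)]; exact ze.1.2⟩
              left_inv := fun w => Subtype.ext (hε w)
              right_inv := ?_
              continuous_toFun := ?_
              continuous_invFun := ?_ }, fun w => rfl⟩
    · rintro ⟨z, e⟩
      have h1 : q (s e z) = z := hs3 _ _ (hBr z.2)
      refine Prod.ext (Subtype.ext h1) ?_
      refine huni _ _ z (hBr z.2) ?_
      have := hε ⟨s e z, by show q (s e z) ∈ B; rw [h1]; exact z.2⟩
      simp only [h1] at this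
      exact this
    · refine Continuous.prodMk ((hq.comp continuous_subtype_val).subtype_mk _) ?_
      rw [continuous_iff_continuousAt]
      intro w
      refine (continuousAt_const (y := ε w)).congr ?_
      filter_upwards [hloc w] with w' h using h.symm
    · refine Continuous.subtype_mk ?_ _
      rw [continuous_prod_of_discrete_right]
      intro e
      exact (hs1 e).comp_continuous continuous_subtype_val (fun z => hBr z.2)
  exact key.to_isEvenlyCovered_preimage

structure Cov (W : Set ℂ) (q : ℂ → ℂ) : Prop where
  op : IsOpen W
  diff : DifferentiableOn ℂ q {z | 0 < z.im}
  dne : ∀ w : ℍ, deriv q w ≠ 0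
  maps : ∀ w : ℍ, q w ∈ W
  surj : ∀ x ∈ W, ∃ w : ℍ, q w = x
  cov : IsCoveringMapOn (fun w : ℍ => q w) W

lemma isOpen_im_pos : IsOpen {z : ℂ | 0 < z.im} := isOpen_lt continuous_const Complex.continuous_im

lemma locinj_of_deriv {q : ℂ → ℂ} (hd : DifferentiableOn ℂ q {z | 0 < z.im})
    (h0 : ∀ w : ℍ, deriv q w ≠ 0) : IsLocallyInjective (fun w : ℍ => q w) := by
  rw [isLocallyInjective_iff_nhds]
  intro w
  have han : AnalyticAt ℂ q w := (hd.analyticOnNhd isOpen_im_pos) w w.2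
  have hs : HasStrictDerivAt q (deriv q w) w := han.hasStrictDerivAt
  have hev := (hs.hasStrictFDerivAt_equiv (h0 w)).eventually_left_inverse
  refine ⟨{w' : ℍ | hs.localInverse q _ _ (h0 w) (q w') = w'}, ?_, ?_⟩
  · exact UpperHalfPlane.continuous_coe.continuousAt.eventually hev
  · intro a ha b hb hab
    have ha' : hs.localInverse q _ _ (h0 w) (q a) = a := ha
    have hb' : hs.localInverse q _ _ (h0 w) (q b) = b := hb
    simp only at hab
    apply UpperHalfPlane.ext
    rw [← ha', ← hb', hab]

/-- Cayley transform -/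
noncomputable def cay (w : ℂ) : ℂ := (w - Complex.I) / (w + Complex.I)
noncomputable def icay (z : ℂ) : ℂ := Complex.I * (1 + z) / (1 - z)

lemma cay_den {w : ℂ} (hw : 0 < w.im) : w + Complex.I ≠ 0 := by
  intro h
  have := congrArg Complex.im h
  simp at this
  linarith

lemma cay_lt {w : ℂ} (hw : 0 < w.im) : ‖cay w‖ < 1 := by
  have hd := cay_den hw
  rw [cay, norm_div, div_lt_one (norm_pos_iff.2 hd)]
  have h1 : ‖w - Complex.I‖ ^ 2 < ‖w + Complex.I‖ ^ 2 := by
    rw [← Complex.normSq_eq_norm_sq, ← Complex.normSq_eq_norm_sq]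
    simp [Complex.normSq_apply]
    nlinarith
  exact lt_of_pow_lt_pow_left₀ 2 (norm_nonneg _) h1

lemma icay_den {z : ℂ} (hz : ‖z‖ < 1) : 1 - z ≠ 0 := by
  intro h
  have : z = 1 := by linear_combination -h
  rw [this] at hz; simp at hz

lemma icay_im {z : ℂ} (hz : ‖z‖ < 1) : 0 < (icay z).im := by
  have hd := icay_den hz
  have : (icay z).im = (1 - ‖z‖ ^ 2) / ‖1 - z‖ ^ 2 := by
    rw [← Complex.normSq_eq_norm_sq, ← Complex.normSq_eq_norm_sq, icay, Complex.div_im]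
    have : Complex.normSq (1 - z) ≠ 0 := by simpa [Complex.normSq_eq_zero] using hd
    field_simp
    simp [Complex.normSq_apply]
    ring
  rw [this]
  have := norm_pos_iff.2 hd
  have h2 : 0 < 1 - ‖z‖ ^ 2 := by nlinarith [norm_nonneg z]
  positivity

lemma cay_icay {z : ℂ} (hz : ‖z‖ < 1) : cay (icay z) = z := by
  have hd := icay_den hz
  have hd2 := cay_den (icay_im hz)
  rw [cay, div_eq_iff hd2, icay]
  field_simp
  ring

lemma icay_cay {w : ℂ} (hw : 0 < w.im) : icay (cay w) = w := by
  have hd := cay_den hw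
  have hd2 := icay_den (cay_lt hw)
  rw [icay, div_eq_iff hd2, cay]
  field_simp
  ring

lemma cay_diffOn : DifferentiableOn ℂ cay {z | 0 < z.im} := by
  intro w hw
  have := cay_den hw
  unfold cay
  have h1 : DifferentiableAt ℂ (fun w : ℂ => w - Complex.I) w := by fun_prop
  have h2 : DifferentiableAt ℂ (fun w : ℂ => w + Complex.I) w := by fun_prop
  exact (h1.div h2 this).differentiableWithinAt

lemma icay_diffOn : DifferentiableOn ℂ icay (ball 0 1) := by
  intro w hw
  have := icay_den (by simpa using hw)
  unfold icay
  have h1 : DifferentiableAt ℂ (fun z : ℂ => Complex.I * (1 + z)) w := by fun_prop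
  have h2 : DifferentiableAt ℂ (fun z : ℂ => 1 - z) w := by fun_prop
  exact (h1.div h2 this).differentiableWithinAt

theorem exists_cov {W : Set ℂ} (hW : IsOpen W) (hW1 : W ⊆ ball 0 1) (hWc : IsPreconnected W)
    (hne : W.Nonempty) : ∃ q, Cov W q := by
  obtain ⟨x0, hx0⟩ := hne
  obtain ⟨p, hp, hsurj⟩ := unif hW hW1 hWc hx0
  set q : ℂ → ℂ := fun w => p (cay w) with hq
  have hqd : DifferentiableOn ℂ q {z | 0 < z.im} :=
    hp.diff.comp cay_diffOn (fun w hw => by simpa using cay_lt hw)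
  have hsec : ∀ (w : ℍ) (r : ℝ), 0 < r → ball (q w) r ⊆ W → ∃ s : ℂ → ℂ, DifferentiableOn ℂ s (ball (q w) r) ∧
      (∀ z ∈ ball (q w) r, 0 < (s z).im) ∧ s (q w) = w ∧ ∀ z ∈ ball (q w) r, q (s z) = z := by
    intro w r hr hsub
    obtain ⟨s, h1, h2, h3, h4⟩ := hp.sec (cay w) (by simpa using cay_lt w.2) r hr hsub
    have h2' : ∀ z ∈ ball (q w) r, ‖s z‖ < 1 := fun z hz => by simpa using h2 hz
    refine ⟨fun z => icay (s z), icay_diffOn.comp h1 h2, fun z hz => icay_im (h2' z hz), ?_, ?_⟩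
    · simp only [hq]; rw [h3]; exact icay_cay w.2
    · intro z hz
      simp only [hq]
      rw [cay_icay (h2' z hz)]; exact h4 z hz
  have hmaps : ∀ w : ℍ, q w ∈ W := fun w => hp.maps (by simpa using cay_lt w.2)
  have hdne : ∀ w : ℍ, deriv q w ≠ 0 := by
    intro w h0
    obtain ⟨r, hr, hrW⟩ := Metric.isOpen_iff.1 hW _ (hmaps w)
    obtain ⟨s, h1, h2, h3, h4⟩ := hsec w r hr hrW
    have e1 : HasDerivAt s (deriv s (q w)) (q w) :=
      (h1.differentiableAt (ball_mem_nhds _ hr)).hasDerivAt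
    have e2 : HasDerivAt q (deriv q w) (s (q w)) := by
      rw [h3]; exact (hqd.differentiableAt (isOpen_im_pos.mem_nhds w.2)).hasDerivAt
    have e3 := e2.comp (q w) e1
    have e4 : HasDerivAt (q ∘ s) 1 (q w) := (hasDerivAt_id _).congr_of_eventuallyEq (by
      filter_upwards [ball_mem_nhds _ hr] with z hz using h4 z hz)
    have := e3.unique e4
    rw [h0, zero_mul] at this
    exact zero_ne_one this
  refine ⟨q, hW, hqd, hdne, hmaps, ?_, ?_⟩
  · intro x hx
    obtain ⟨z, hz, rfl⟩ := hsurj hx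
    have hz' : ‖z‖ < 1 := by simpa using hz
    exact ⟨⟨icay z, icay_im hz'⟩, by simp only [hq]; show p (cay (icay z)) = p z; rw [cay_icay hz']⟩
  · refine covering_of_sections hW ?_ (locinj_of_deriv hqd hdne) ?_
    · exact hqd.continuousOn.comp_continuous UpperHalfPlane.continuous_coe (fun w => w.2)
    · intro w r hr hsub
      obtain ⟨s, h1, h2, h3, h4⟩ := hsec w r hr hsub
      refine ⟨fun z => UpperHalfPlane.ofComplex (s z), ?_, ?_, ?_⟩
      · intro z hz
        have hc : ContinuousAt s z := (h1.differentiableAt (isOpen_ball.mem_nhds hz)).continuousAt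
        refine ContinuousAt.continuousWithinAt ?_
        rw [UpperHalfPlane.isEmbedding_coe.continuousAt_iff]
        refine hc.congr ?_
        filter_upwards [isOpen_ball.mem_nhds hz] with y hy
        simp [UpperHalfPlane.ofComplex_apply_of_im_pos (h2 y hy)]
      · show UpperHalfPlane.ofComplex (s (q w)) = w
        rw [h3]; simp
      · intro z hz
        simp only
        rw [UpperHalfPlane.ofComplex_apply_of_im_pos (h2 z hz)]
        exact h4 z hz


def HolH (F : ℍ → ℍ) : Prop :=
  DifferentiableOn ℂ (fun z => (F (UpperHalfPlane.ofComplex z) : ℂ)) {z | 0 < z.im}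

lemma sl_coe (g : SL(2, ℝ)) (w : ℍ) :
    ((g • w : ℍ) : ℂ) = ((g 0 0 : ℂ) * w + (g 0 1 : ℂ)) / ((g 1 0 : ℂ) * w + (g 1 1 : ℂ)) := by
  rw [UpperHalfPlane.coe_specialLinearGroup_apply]; rfl

lemma sl_den (g : SL(2, ℝ)) {w : ℂ} (hw : 0 < w.im) : (g 1 0 : ℂ) * w + (g 1 1 : ℂ) ≠ 0 := by
  intro h
  have h1 := congrArg Complex.im h
  have h2 := congrArg Complex.re h
  simp at h1 h2
  have h3 : g 1 0 = 0 := by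
    rcases h1 with h1 | h1
    · exact h1
    · linarith
  have hdet := g.det_coe
  rw [Matrix.det_fin_two] at hdet
  rw [h3] at h2 hdet
  simp at h2
  rw [h2] at hdet
  simp at hdet

lemma HolH_smul (g : SL(2, ℝ)) : HolH (fun w => g • w) := by
  intro z hz
  have hd := sl_den g hz
  have h1 : DifferentiableAt ℂ (fun z : ℂ => (g 0 0 : ℂ) * z + (g 0 1 : ℂ)) z := by fun_prop
  have h2 : DifferentiableAt ℂ (fun z : ℂ => (g 1 0 : ℂ) * z + (g 1 1 : ℂ)) z := by fun_prop
  refine ((h1.div h2 hd).congr_of_eventuallyEq ?_).differentiableWithinAt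
  filter_upwards [isOpen_im_pos.mem_nhds hz] with w hw
  rw [sl_coe, UpperHalfPlane.ofComplex_apply_of_im_pos hw]
  rfl

lemma HolH.comp {F G : ℍ → ℍ} (hF : HolH F) (hG : HolH G) : HolH (F ∘ G) := by
  have := DifferentiableOn.comp hF hG (fun z hz => (G _).2)
  refine this.congr (fun z hz => ?_)
  simp

lemma rot_smul (c : ℂ) (hc : ‖c‖ = 1) : ∃ g : SL(2, ℝ), ∀ w : ℍ, cay (g • w : ℍ) = c * cay w := by
  obtain ⟨θ, hθ⟩ : ∃ θ : ℝ, Complex.exp (θ * Complex.I) ^ 2 = c := by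
    refine ⟨c.arg / 2, ?_⟩
    rw [← Complex.exp_nat_mul]
    have := Complex.norm_mul_exp_arg_mul_I c
    rw [hc] at this
    rw [Complex.ofReal_one, one_mul] at this
    refine Eq.trans ?_ this
    congr 1; push_cast; ring
  refine ⟨⟨!![Real.cos θ, Real.sin θ; -Real.sin θ, Real.cos θ], ?_⟩, fun w => ?_⟩
  · rw [Matrix.det_fin_two]; simp; nlinarith [Real.sin_sq_add_cos_sq θ]
  · set g : SL(2, ℝ) := ⟨!![Real.cos θ, Real.sin θ; -Real.sin θ, Real.cos θ], _⟩ with hg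
    have hd := sl_den g w.2
    have hd2 := cay_den (g • w).2
    have hd3 := cay_den w.2
    have hI : Complex.I ^ 2 = -1 := Complex.I_sq
    change (g • w : ℍ) + Complex.I ≠ 0 at hd2
    change (w : ℂ) + Complex.I ≠ 0 at hd3
    rw [cay, cay, div_eq_iff hd2]
    rw [sl_coe] at hd2 ⊢
    have e00 : g 0 0 = Real.cos θ := rfl
    have e01 : g 0 1 = Real.sin θ := rfl
    have e10 : g 1 0 = - Real.sin θ := rfl
    have e11 : g 1 1 = Real.cos θ := rfl
    change (g 1 0 : ℂ) * w + (g 1 1 : ℂ) ≠ 0 at hd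
    rw [e00, e01, e10, e11] at *
    have hexp : Complex.exp (θ * Complex.I) = Real.cos θ + Real.sin θ * Complex.I := by
      rw [Complex.exp_mul_I]; simp
    rw [hexp] at hθ
    have hcs : (Real.cos θ : ℂ) ^ 2 + (Real.sin θ : ℂ) ^ 2 = 1 := by
      norm_cast; nlinarith [Real.sin_sq_add_cos_sq θ]
    rw [← hθ]
    generalize (Real.cos θ : ℂ) = C at *
    push_cast at *
    generalize (Complex.sin θ : ℂ) = S at *
    generalize (w : ℂ) = z at *
    have k1 : (C * z + S) / (-S * z + C) - Complex.I = (C + S * Complex.I) * (z - Complex.I) / (-S * z + C) := by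
      rw [sub_eq_iff_eq_add, div_eq_iff hd, add_mul, div_mul_cancel₀ _ hd]
      linear_combination S * hI
    have k2 : (C * z + S) / (-S * z + C) + Complex.I = (C - S * Complex.I) * (z + Complex.I) / (-S * z + C) := by
      rw [eq_div_iff hd, add_mul, div_mul_cancel₀ _ hd]
      linear_combination S * hI
    have k3 : (C + S * Complex.I) * (C - S * Complex.I) = 1 := by linear_combination hcs - S ^ 2 * hI
    rw [k1, k2]
    have k4 : (z - Complex.I) / (z + Complex.I) * (z + Complex.I) = z - Complex.I := div_mul_cancel₀ _ hd3
    generalize (z - Complex.I) / (z + Complex.I) = Q at *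
    rw [div_eq_iff hd, mul_assoc, div_mul_cancel₀ _ hd]
    linear_combination (- (C + S * Complex.I) * (z - Complex.I)) * k3 - (C + S * Complex.I) ^ 2 * (C - S * Complex.I) * k4

theorem autH {F G : ℍ → ℍ} (hF : HolH F) (hG : HolH G) (h1 : ∀ w, G (F w) = w) (h2 : ∀ w, F (G w) = w) :
    ∃ g : SL(2, ℝ), ∀ w, F w = g • w := by
  wlog hI : F UpperHalfPlane.I = UpperHalfPlane.I generalizing F G
  · set a := (F UpperHalfPlane.I).toSL2R with ha
    obtain ⟨g, hg⟩ := this (F := fun w => a⁻¹ • F w) (G := fun w => G (a • w))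
      ((HolH_smul a⁻¹).comp hF) (hG.comp (HolH_smul a)) (fun w => by simp [h1]) (fun w => by simp [h2])
      (by rw [inv_smul_eq_iff, ha, UpperHalfPlane.toSL2R_smul_I])
    refine ⟨a * g, fun w => ?_⟩
    rw [mul_smul, ← hg, smul_inv_smul]
  have hGI : G UpperHalfPlane.I = UpperHalfPlane.I := by rw [← hI, h1, hI]
  set T : (ℍ → ℍ) → ℂ → ℂ := fun F z => cay (F (UpperHalfPlane.ofComplex (icay z))) with hT
  have hTd : ∀ F, HolH F → DifferentiableOn ℂ (T F) (ball 0 1) := fun F hF =>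
    cay_diffOn.comp (DifferentiableOn.comp (g := fun z => (F (UpperHalfPlane.ofComplex z) : ℂ)) hF icay_diffOn (fun z hz => icay_im (by simpa using hz)))
      (fun z hz => (F _).2)
  have hTm : ∀ F z, ‖T F z‖ < 1 := fun F z => cay_lt (F _).2
  have i0 : UpperHalfPlane.ofComplex (icay 0) = UpperHalfPlane.I := by
    have : icay 0 = (UpperHalfPlane.I : ℂ) := by simp [icay]
    rw [this, UpperHalfPlane.ofComplex_apply]
  have hT0 : ∀ F : ℍ → ℍ, F UpperHalfPlane.I = UpperHalfPlane.I → T F 0 = 0 := fun F hF => by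
    simp only [hT, i0, hF]; simp [cay]
  have hle : ∀ F, HolH F → F UpperHalfPlane.I = UpperHalfPlane.I → ∀ z, ‖z‖ < 1 → ‖T F z‖ ≤ ‖z‖ :=
    fun F hF h0 z hz => Complex.norm_le_norm_of_mapsTo_ball (hTd F hF)
      (fun z _ => by simpa using (hTm F z).le) (hT0 F h0) hz
  have hTF : ∀ w : ℍ, T F (cay w) = cay (F w) := fun w => by
    simp only [hT]; rw [icay_cay w.2]; simp
  have hTT : ∀ z, ‖z‖ < 1 → T G (T F z) = z := fun z hz => by
    simp only [hT]
    rw [icay_cay (F _).2]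
    simp only [UpperHalfPlane.ofComplex_apply, h1]
    rw [UpperHalfPlane.ofComplex_apply_of_im_pos (icay_im hz)]
    exact cay_icay hz
  have heq : ∀ z, ‖z‖ < 1 → ‖T F z‖ = ‖z‖ := fun z hz => by
    refine le_antisymm (hle F hF hI z hz) ?_
    have := hle G hG hGI (T F z) (hTm F z)
    rwa [hTT z hz] at this
  obtain ⟨c, hc, hc2⟩ := Complex.affine_of_mapsTo_ball_of_exists_norm_dslope_eq_div' (R₁ := 1) (R₂ := 1)
    (hTd F hF) (fun z _ => by simpa [hT0 F hI] using (hTm F z).le)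
    ⟨1 / 2, by simp; norm_num, by
      rw [dslope_of_ne _ (by norm_num), slope_def_field, hT0 F hI]
      simp
      rw [heq _ (by simp; norm_num)]; norm_num⟩
  obtain ⟨g, hg⟩ := rot_smul c (by simpa using hc)
  refine ⟨g, fun w => ?_⟩
  have e1 := hc2 (x := cay w) (by simpa using cay_lt w.2)
  simp only [hT0 F hI] at e1
  rw [hTF] at e1
  have e2 : cay (F w) = cay (g • w : ℍ) := by rw [hg, e1]; simp [mul_comm]
  apply UpperHalfPlane.ext
  have := congrArg icay e2
  rwa [icay_cay (F w).2, icay_cay (g • w : ℍ).2] at this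


section
variable {W : Set ℂ} {q : ℂ → ℂ}

lemma Cov.cont (h : Cov W q) : Continuous (fun w : ℍ => q w) :=
  h.diff.continuousOn.comp_continuous UpperHalfPlane.continuous_coe (fun w => w.2)

lemma Cov.inj (h : Cov W q) : IsLocallyInjective (fun w : ℍ => q w) := locinj_of_deriv h.diff h.dne

lemma Cov.lift (h : Cov W q) {A : Type*} [TopologicalSpace A] [SimplyConnectedSpace A]
    [LocallyPathConnectedSpace A] (f : A → ℂ) (hf : Continuous f) (hm : ∀ a, f a ∈ W) (a : A) (e : ℍ)
    (he : q e = f a) : ∃ F : A → ℍ, Continuous F ∧ F a = e ∧ ∀ x, q (F x) = f x := by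
  obtain ⟨F, ⟨h1, h2⟩, -⟩ := h.cov.existsUnique_continuousMap_lifts ⟨f, hf⟩ he hm
  exact ⟨F, F.continuous, h1, fun x => congrFun h2 x⟩

lemma Cov.deck_trans (h : Cov W q) {w w' : ℍ} (hw : q w = q w') :
    ∃ g : SL(2, ℝ), g • w = w' ∧ ∀ u : ℍ, q (g • u : ℍ) = q u := by
  obtain ⟨F, F1, F2, F3⟩ := h.lift (fun w : ℍ => q w) h.cont h.maps w w' hw.symm
  obtain ⟨G, G1, G2, G3⟩ := h.lift (fun w : ℍ => q w) h.cont h.maps w' w hw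
  have hhol : ∀ F : ℍ → ℍ, Continuous F → (∀ x, q (F x) = q x) → HolH F := by
    intro F hF hFq z hz
    have hz' : 0 < z.im := hz
    have h1 : HasStrictDerivAt q (deriv q (F (UpperHalfPlane.ofComplex z))) (F (UpperHalfPlane.ofComplex z)) :=
      ((h.diff.analyticOnNhd isOpen_im_pos) _ (F _).2).hasStrictDerivAt
    have h2 : ContinuousAt (fun z => (F (UpperHalfPlane.ofComplex z) : ℂ)) z := by
      refine (UpperHalfPlane.continuous_coe.comp hF).continuousAt.comp ?_
      rw [UpperHalfPlane.isEmbedding_coe.continuousAt_iff]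
      refine continuousAt_id.congr ?_
      filter_upwards [isOpen_im_pos.mem_nhds hz] with y hy
      simp [UpperHalfPlane.ofComplex_apply_of_im_pos hy]
    refine (differentiableAt_lift (F := q) h1 (h.dne _) h2
      (h.diff.differentiableAt (isOpen_im_pos.mem_nhds hz)) ?_).differentiableWithinAt
    filter_upwards [isOpen_im_pos.mem_nhds hz] with y hy
    rw [hFq, UpperHalfPlane.ofComplex_apply_of_im_pos hy]
  have huni : ∀ F : ℍ → ℍ, Continuous F → (∀ x, q (F x) = q x) → ∀ a, F a = a → ∀ x, F x = x := by
    intro F hF hq a ha x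
    have := (T2Space.isSeparatedMap (fun w : ℍ => q w)).eq_of_comp_eq h.inj hF continuous_id
      (funext fun x => hq x) a ha
    exact congrFun this x
  obtain ⟨g, hg⟩ := autH (hhol F F1 F3) (hhol G G1 G3)
    (huni (G ∘ F) (G1.comp F1) (fun x => by simp [G3, F3]) w (by simp [F2, G2]))
    (huni (F ∘ G) (F1.comp G1) (fun x => by simp [G3, F3]) w' (by simp [F2, G2]))
  exact ⟨g, by rw [← hg, F2], fun u => by rw [← hg, F3]⟩
end

/-- homeomorphism of the half plane with the plane -/
noncomputable def eH : ℍ ≃ₜ ℂ where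
  toFun w := ⟨w.re, Real.log w.im⟩
  invFun z := ⟨⟨z.re, Real.exp z.im⟩, Real.exp_pos _⟩
  left_inv w := by
    apply UpperHalfPlane.ext
    apply Complex.ext
    · rfl
    · exact Real.exp_log w.2
  right_inv z := by
    apply Complex.ext
    · rfl
    · exact Real.log_exp _
  continuous_toFun := by
    have : (fun w : ℍ => (⟨w.re, Real.log w.im⟩ : ℂ)) = fun w : ℍ => ((w.re : ℂ) + (Real.log w.im : ℂ) * Complex.I) := by
      ext w; apply Complex.ext <;> simp
    rw [this]
    have h1 : Continuous fun w : ℍ => Real.log w.im := UpperHalfPlane.continuous_im.log (fun w => w.2.ne')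
    have h2 : Continuous fun w : ℍ => w.re := UpperHalfPlane.continuous_re
    fun_prop
  continuous_invFun := by
    rw [UpperHalfPlane.isEmbedding_coe.continuous_iff]
    have : (UpperHalfPlane.coe ∘ fun z : ℂ => (⟨⟨z.re, Real.exp z.im⟩, Real.exp_pos _⟩ : ℍ)) =
        fun z : ℂ => ((z.re : ℂ) + (Real.exp z.im : ℂ) * Complex.I) := by
      ext w; apply Complex.ext
      · simp [-Complex.ofReal_exp]
      · simp [-Complex.ofReal_exp]
    rw [this]
    fun_prop

lemma mono_slit {a b : ℂ} (h : 0 < (a * (starRingEnd ℂ) b).re) : a / b ∈ Complex.slitPlane := by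
  left
  have hb : b ≠ 0 := by rintro rfl; simp at h
  have : a / b = (a * (starRingEnd ℂ) b) / ((Complex.normSq b : ℝ) : ℂ) := by
    rw [Complex.normSq_eq_conj_mul_self, div_eq_div_iff hb (by simp [hb])]; ring
  rw [this, Complex.div_ofReal_re]
  exact div_pos h (Complex.normSq_pos.2 hb)

/-- logarithm of the slope of a monotone map -/
lemma mono_log {P : Type*} [TopologicalSpace P] {a b : P → ℂ} (ha : Continuous a) (hb : Continuous b)
    (h : ∀ x y, x ≠ y → 0 < ((a x - a y) * (starRingEnd ℂ) (b x - b y)).re) :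
    ∃ M : P × P → ℂ, ContinuousOn M (OD P) ∧ ∀ x y, x ≠ y → Complex.exp (M (x, y)) * (b x - b y) = a x - a y := by
  have hne : ∀ x y, x ≠ y → b x - b y ≠ 0 := by
    intro x y hxy h0
    have := h x y hxy
    rw [h0] at this; simp at this
  refine ⟨fun p => Complex.log ((a p.1 - a p.2) / (b p.1 - b p.2)), ?_, ?_⟩
  · refine ContinuousOn.clog ?_ (fun p hp => mono_slit (h _ _ hp))
    refine ContinuousOn.div (by fun_prop) (by fun_prop) (fun p hp => hne _ _ hp)
  · intro x y hxy
    have h2 := Complex.slitPlane_ne_zero (mono_slit (h x y hxy))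
    simp only
    rw [Complex.exp_log h2, div_mul_cancel₀ _ (hne x y hxy)]

lemma eH_log : ∃ M : ℍ × ℍ → ℂ, ContinuousOn M (OD ℍ) ∧
    ∀ x y : ℍ, x ≠ y → Complex.exp (M (x, y)) * ((x : ℂ) - y) = eH x - eH y := by
  refine mono_log eH.continuous UpperHalfPlane.continuous_coe ?_
  intro x y hxy
  have e1 : ((eH x - eH y) * (starRingEnd ℂ) ((x : ℂ) - y)).re =
      (x.re - y.re) * (x.re - y.re) + (Real.log x.im - Real.log y.im) * (x.im - y.im) := by
    simp only [eH, Homeomorph.homeomorph_mk_coe, Equiv.coe_fn_mk, Complex.mul_re, Complex.sub_re, Complex.sub_im,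
      Complex.conj_re, Complex.conj_im, UpperHalfPlane.coe_re, UpperHalfPlane.coe_im]
    ring
  rw [e1]
  have hx := x.2
  have hy := y.2
  change 0 < x.im at hx
  change 0 < y.im at hy
  rcases lt_trichotomy x.im y.im with h | h | h
  · have := Real.log_lt_log hx h
    nlinarith [mul_self_nonneg (x.re - y.re), mul_pos (sub_pos.2 this) (sub_pos.2 h)]
  · have : x.re ≠ y.re := fun h' => hxy (UpperHalfPlane.ext (Complex.ext h' h))
    rw [h]; simp
    exact sub_ne_zero.2 this
  · have := Real.log_lt_log hy h
    nlinarith [mul_self_nonneg (x.re - y.re), mul_pos (sub_pos.2 this) (sub_pos.2 h)]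

theorem brouwerH {G : ℍ ≃ₜ ℍ} (hG : OP (fun w : ℍ => (w : ℂ)) G) (hf : ∀ x, G x ≠ x) (x : ℍ) :
    ∃ V ∈ 𝓝 x, ∀ k, 1 ≤ k → G^[k] x ∉ V := by
  obtain ⟨L, hL, hLe⟩ := hG
  obtain ⟨M, hM, hMe⟩ := eH_log
  set G' : ℂ ≃ₜ ℂ := (eH.symm.trans G).trans eH with hG'
  have hG'e : ∀ z, G' z = eH (G (eH.symm z)) := fun z => rfl
  have h1 : ∀ p ∈ OD ℂ, (eH.symm p.1, eH.symm p.2) ∈ OD ℍ := fun p hp h' => hp (eH.symm.injective h')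
  have h2 : ∀ p ∈ OD ℂ, (G (eH.symm p.1), G (eH.symm p.2)) ∈ OD ℍ := fun p hp h' => h1 p hp (G.injective h')
  have hop : OP (fun z : ℂ => z) G' := by
    refine ⟨fun p => M (G (eH.symm p.1), G (eH.symm p.2)) + L (eH.symm p.1, eH.symm p.2)
      - M (eH.symm p.1, eH.symm p.2), ?_, ?_⟩
    · exact ((hM.comp (by fun_prop) h2).add (hL.comp (by fun_prop) h1)).sub (hM.comp (by fun_prop) h1)
    · intro x y hxy
      have e1 := hMe _ _ (h2 (x, y) hxy)
      have e2 := hLe _ _ (h1 (x, y) hxy)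
      have e3 := hMe _ _ (h1 (x, y) hxy)
      simp only [Homeomorph.apply_symm_apply] at e1 e2 e3 ⊢
      rw [hG'e, hG'e, ← e1, ← e2, ← e3, Complex.exp_sub, Complex.exp_add]
      field_simp
  obtain ⟨V, hV, hV2⟩ := brouwer hop (fun z h => by
    rw [hG'e] at h
    exact hf (eH.symm z) (eH.injective (by rw [h, Homeomorph.apply_symm_apply]))) (eH x)
  refine ⟨eH ⁻¹' V, eH.continuous.continuousAt hV, fun k hk => ?_⟩
  have : ∀ k, G'^[k] (eH x) = eH (G^[k] x) := by
    intro k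
    induction k with
    | zero => rfl
    | succ n ih => rw [Function.iterate_succ_apply', ih, Function.iterate_succ_apply', hG'e, Homeomorph.symm_apply_apply]
  have h3 := hV2 k hk
  rwa [this] at h3


noncomputable def psi (z : ℂ) : ℂ := ((Homeomorph.unitBall z : ball (0:ℂ) 1) : ℂ)

lemma psi_eq (z : ℂ) : psi z = (((√(1 + ‖z‖^2))⁻¹ : ℝ) : ℂ) * z := by
  rw [← Complex.real_smul]; rfl

lemma psi_cont : Continuous psi := continuous_subtype_val.comp Homeomorph.unitBall.continuous
lemma psi_openEmb : IsOpenEmbedding psi :=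
  (isOpen_ball.isOpenEmbedding_subtypeVal).comp Homeomorph.unitBall.isOpenEmbedding
lemma psi_inj : Function.Injective psi := psi_openEmb.injective
lemma psi_mem (z : ℂ) : psi z ∈ ball (0:ℂ) 1 := (Homeomorph.unitBall z : ball (0:ℂ) 1).2

lemma psi_mono {x y : ℂ} (h : x ≠ y) : 0 < ((psi x - psi y) * (starRingEnd ℂ) (x - y)).re := by
  have hA : 0 < √(1 + ‖x‖^2) := Real.sqrt_pos.2 (by positivity)
  have hB : 0 < √(1 + ‖y‖^2) := Real.sqrt_pos.2 (by positivity)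
  have hA2 : √(1 + ‖x‖^2)^2 = 1 + ‖x‖^2 := Real.sq_sqrt (by positivity)
  have hB2 : √(1 + ‖y‖^2)^2 = 1 + ‖y‖^2 := Real.sq_sqrt (by positivity)
  have e1 : ((psi x - psi y) * (starRingEnd ℂ) (x - y)).re =
      (√(1 + ‖x‖^2))⁻¹ * (√(1 + ‖y‖^2))⁻¹ * (√(1 + ‖y‖^2) * ‖x‖^2 + √(1 + ‖x‖^2) * ‖y‖^2
        - (√(1 + ‖x‖^2) + √(1 + ‖y‖^2)) * (x * (starRingEnd ℂ) y).re) := by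
    rw [psi_eq, psi_eq]
    set A := √(1 + ‖x‖^2)
    set B := √(1 + ‖y‖^2)
    have h1 : ‖x‖^2 = x.re^2 + x.im^2 := by rw [Complex.sq_norm, Complex.normSq_apply]; ring
    have h2 : ‖y‖^2 = y.re^2 + y.im^2 := by rw [Complex.sq_norm, Complex.normSq_apply]; ring
    rw [h1, h2]
    simp only [Complex.mul_re, Complex.sub_re, Complex.sub_im, Complex.conj_re, Complex.conj_im, Complex.mul_im,
      Complex.ofReal_re, Complex.ofReal_im]
    field_simp
    ring
  rw [e1]
  have hc : (x * (starRingEnd ℂ) y).re ≤ ‖x‖ * ‖y‖ := by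
    refine (Complex.re_le_norm _).trans ?_
    rw [norm_mul, RCLike.norm_conj]
  have hd : 0 < ‖x‖^2 + ‖y‖^2 - 2 * (x * (starRingEnd ℂ) y).re := by
    have : ‖x - y‖^2 = ‖x‖^2 + ‖y‖^2 - 2 * (x * (starRingEnd ℂ) y).re := by
      simp only [Complex.sq_norm, Complex.normSq_sub]
    rw [← this]
    have := norm_pos_iff.2 (sub_ne_zero.2 h)
    positivity
  set A := √(1 + ‖x‖^2)
  set B := √(1 + ‖y‖^2)
  set c := (x * (starRingEnd ℂ) y).re
  have ha := norm_nonneg x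
  have hb := norm_nonneg y
  set a := ‖x‖
  set b := ‖y‖
  refine mul_pos (by positivity) ?_
  rcases lt_trichotomy a b with hab | hab | hab
  · have h3 : a * B < b * A := by
      apply lt_of_pow_lt_pow_left₀ 2 (by positivity)
      nlinarith
    nlinarith
  · have : A = B := by
      have : A^2 = B^2 := by rw [hA2, hB2, hab]
      exact (pow_left_inj₀ hA.le hB.le two_ne_zero).1 this
    rw [this]; nlinarith
  · have h3 : b * A < a * B := by
      apply lt_of_pow_lt_pow_left₀ 2 (by positivity)
      nlinarith
    nlinarith

lemma psi_log : ∃ M : ℂ × ℂ → ℂ, ContinuousOn M (OD ℂ) ∧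
    ∀ x y : ℂ, x ≠ y → Complex.exp (M (x, y)) * (x - y) = psi x - psi y :=
  mono_log psi_cont continuous_id (fun x y h => psi_mono h)

structure UCov (U : Set ℂ) (π : ℍ → ℂ) : Prop where
  op : IsOpen U
  cont : Continuous π
  opm : IsOpenMap π
  inj : IsLocallyInjective π
  maps : ∀ w, π w ∈ U
  surj : ∀ x ∈ U, ∃ w, π w = x
  lift : ∀ (f : ℍ → ℂ), Continuous f → (∀ u, f u ∈ U) → ∀ (a e : ℍ), π e = f a →
    ∃ F : ℍ → ℍ, Continuous F ∧ F a = e ∧ ∀ x, π (F x) = f x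
  deck : ∀ {w w' : ℍ}, π w = π w' → ∃ g : SL(2, ℝ), g • w = w' ∧ ∀ u : ℍ, π (g • u) = π u
  loclog : ∀ w0 : ℍ, ∃ B ∈ 𝓝 w0, ∃ l : ℍ × ℍ → ℂ, ContinuousOn l (OD ℍ ∩ B ×ˢ B) ∧
    ∀ x ∈ B, ∀ y ∈ B, x ≠ y → π x ≠ π y ∧ Complex.exp (l (x, y)) * ((x : ℂ) - y) = π x - π y

/-- local logarithm of the slope of a holomorphic function -/
lemma slope_log {q : ℂ → ℂ} {w0 : ℍ} (h : HasStrictDerivAt q (deriv q w0) w0) (h0 : deriv q w0 ≠ 0)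
    (hq : Continuous fun w : ℍ => q w) :
    ∃ B ∈ 𝓝 w0, ∃ l : ℍ × ℍ → ℂ, ContinuousOn l (OD ℍ ∩ B ×ˢ B) ∧
    ∀ x ∈ B, ∀ y ∈ B, x ≠ y → q x ≠ q y ∧ Complex.exp (l (x, y)) * ((x : ℂ) - y) = q x - q y := by
  set d := deriv q w0
  have h1 : ∀ᶠ p : ℂ × ℂ in 𝓝 ((w0 : ℂ), (w0 : ℂ)), ‖q p.1 - q p.2 - d * (p.1 - p.2)‖ ≤ ‖d‖ / 2 * ‖p.1 - p.2‖ := by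
    have := h.hasStrictFDerivAt.isLittleO.def (c := ‖d‖/2) (by have := norm_pos_iff.2 h0; positivity)
    refine this.mono fun p hp => ?_
    simpa [mul_comm] using hp
  have h2 : ∀ᶠ p : ℍ × ℍ in 𝓝 (w0, w0), ‖q p.1 - q p.2 - d * (p.1 - p.2)‖ ≤ ‖d‖ / 2 * ‖(p.1 : ℂ) - p.2‖ := by
    have hc : Continuous fun p : ℍ × ℍ => ((p.1 : ℂ), (p.2 : ℂ)) := by fun_prop
    exact (hc.tendsto (w0, w0)).eventually h1
  rw [nhds_prod_eq] at h2
  obtain ⟨B, hB, hBB⟩ := (eventually_prod_self_iff'.1 h2)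
  have key : ∀ x ∈ B, ∀ y ∈ B, x ≠ y → q x ≠ q y ∧ (q x - q y) / (x - y) / d ∈ Complex.slitPlane := by
    intro x hx y hy hxy
    have h3 := hBB x hx y hy
    simp only at h3
    have hne : (x : ℂ) - y ≠ 0 := sub_ne_zero.2 (fun h => hxy (UpperHalfPlane.ext h))
    have h4 : ‖(q x - q y) / (x - y) / d - 1‖ ≤ 1/2 := by
      have : (q x - q y) / (x - y) / d - 1 = (q x - q y - d * (x - y)) / ((x - y) * d) := by
        field_simp
      rw [this, norm_div, norm_mul, div_le_iff₀ (by have := norm_pos_iff.2 h0; have := norm_pos_iff.2 hne; positivity)]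
      linarith
    constructor
    · intro h
      rw [h] at h4
      simp at h4
      norm_num at h4
    · rw [← sub_add_cancel ((q x - q y) / (x - y) / d) 1, add_comm]
      exact Complex.mem_slitPlane_of_norm_lt_one (by linarith)
  refine ⟨B, hB, fun p => Complex.log ((q p.1 - q p.2) / (p.1 - p.2) / d) + Complex.log d, ?_, ?_⟩
  · refine ContinuousOn.add (ContinuousOn.clog ?_ ?_) continuousOn_const
    · refine ContinuousOn.div_const (ContinuousOn.div ?_ ?_ ?_) _
      · exact ((hq.comp continuous_fst).sub (hq.comp continuous_snd)).continuousOn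
      · exact Continuous.continuousOn (by fun_prop)
      · rintro p ⟨hp, -⟩
        exact sub_ne_zero.2 (fun h => hp (UpperHalfPlane.ext h))
    · rintro ⟨x, y⟩ ⟨hp, hx, hy⟩
      exact (key x hx y hy hp).2
  · intro x hx y hy hxy
    refine ⟨(key x hx y hy hxy).1, ?_⟩
    have hne : (x : ℂ) - y ≠ 0 := sub_ne_zero.2 (fun h => hxy (UpperHalfPlane.ext h))
    have hq0 : q x - q y ≠ 0 := sub_ne_zero.2 (key x hx y hy hxy).1
    rw [Complex.exp_add, Complex.exp_log h0, Complex.exp_log (by positivity)]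
    field_simp

theorem exists_ucov {U : Set ℂ} (hU : IsOpen U) (hc : IsPreconnected U) (hne : U.Nonempty) :
    ∃ q π, Cov (psi '' U) q ∧ UCov U π ∧ ∀ w : ℍ, psi (π w) = q w := by
  have hW : IsOpen (psi '' U) := psi_openEmb.isOpenMap _ hU
  obtain ⟨q, hq⟩ := exists_cov hW (by rintro _ ⟨z, -, rfl⟩; exact psi_mem z)
    (hc.image _ psi_cont.continuousOn) (hne.image _)
  choose π hπU hπ using fun w : ℍ => hq.maps w
  have hcont : Continuous π := by
    rw [psi_openEmb.isEmbedding.continuous_iff]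
    convert hq.cont using 1
    ext w; exact hπ w
  have hstrict : ∀ w : ℍ, HasStrictDerivAt q (deriv q w) w := fun w =>
    ((hq.diff.analyticOnNhd isOpen_im_pos) _ w.2).hasStrictDerivAt
  refine ⟨q, π, hq, ⟨hU, hcont, ?_, ?_, hπU, ?_, ?_, ?_, ?_⟩, hπ⟩
  · intro O hO
    have h1 : IsOpen ((fun w : ℍ => q w) '' O) := by
      rw [isOpen_iff_mem_nhds]
      rintro _ ⟨w, hw, rfl⟩
      have := (hstrict w).map_nhds_eq (hq.dne w)
      show _ ∈ 𝓝 (q w)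
      rw [← this, Filter.mem_map]
      have h2 : UpperHalfPlane.coe '' O ∈ 𝓝 (w : ℂ) :=
        (UpperHalfPlane.isOpenEmbedding_coe.isOpenMap _ hO).mem_nhds ⟨w, hw, rfl⟩
      filter_upwards [h2]
      rintro _ ⟨v, hv, rfl⟩
      exact ⟨v, hv, rfl⟩
    have : π '' O = psi ⁻¹' ((fun w : ℍ => q w) '' O) := by
      ext z
      constructor
      · rintro ⟨w, hw, rfl⟩; exact ⟨w, hw, (hπ w).symm⟩
      · rintro ⟨w, hw, h⟩
        exact ⟨w, hw, psi_inj (by rw [hπ]; exact h)⟩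
    rw [this]
    exact h1.preimage psi_cont
  · intro w
    obtain ⟨V, hV, hw, hVi⟩ := hq.inj w
    exact ⟨V, hV, hw, fun x hx y hy h => hVi hx hy (by show q x = q y; rw [← hπ, ← hπ]; exact congrArg psi h)⟩
  · intro x hx
    obtain ⟨w, hw⟩ := hq.surj (psi x) ⟨x, hx, rfl⟩
    exact ⟨w, psi_inj (by rw [hπ, hw])⟩
  · intro f hf hfU a e he
    haveI : ContractibleSpace ℍ := eH.contractibleSpace
    obtain ⟨F, h1, h2, h3⟩ := hq.lift (fun u => psi (f u)) (psi_cont.comp hf) (fun u => ⟨_, hfU u, rfl⟩) a e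
      (by rw [← hπ, he])
    exact ⟨F, h1, h2, fun x => psi_inj (by rw [hπ, h3])⟩
  · intro w w' h
    obtain ⟨g, h1, h2⟩ := hq.deck_trans (w := w) (w' := w') (by rw [← hπ, ← hπ, h])
    exact ⟨g, h1, fun u => psi_inj (by rw [hπ, hπ, h2])⟩
  · intro w0
    obtain ⟨B, hB, l, hl, hle⟩ := slope_log (hstrict w0) (hq.dne w0) hq.cont
    obtain ⟨M, hM, hMe⟩ := psi_log
    refine ⟨B, hB, fun p => l p - M (π p.1, π p.2), ?_, ?_⟩
    · refine hl.sub (hM.comp ((hcont.comp continuous_fst).prodMk (hcont.comp continuous_snd)).continuousOn ?_)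
      rintro ⟨x, y⟩ ⟨hp, hx, hy⟩ h
      refine (hle x hx y hy hp).1 ?_
      rw [← hπ, ← hπ]; exact congrArg psi h
    · intro x hx y hy hxy
      have h1 := hle x hx y hy hxy
      have hne : π x ≠ π y := fun h => h1.1 (by rw [← hπ, ← hπ, h])
      refine ⟨hne, ?_⟩
      have h2 := hMe _ _ hne
      rw [hπ, hπ, ← h1.2] at h2
      rw [Complex.exp_sub, div_mul_eq_mul_div, ← h2, mul_div_assoc, mul_comm, div_mul_cancel₀ _ (Complex.exp_ne_zero _)]


instance instContrH : ContractibleSpace ℍ := eH.contractibleSpace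

/-- deck transformations -/
def Dk (π : ℍ → ℂ) (γ : SL(2, ℝ)) : Prop := ∀ u : ℍ, π (γ • u) = π u

lemma Dk.mul {π : ℍ → ℂ} {a b : SL(2, ℝ)} (ha : Dk π a) (hb : Dk π b) : Dk π (a * b) := fun u => by
  rw [mul_smul, ha, hb]
lemma Dk.inv {π : ℍ → ℂ} {a : SL(2, ℝ)} (ha : Dk π a) : Dk π a⁻¹ := fun u => by
  rw [← ha (a⁻¹ • u), smul_inv_smul]
lemma Dk.one {π : ℍ → ℂ} : Dk π 1 := fun u => by rw [one_smul]
lemma Dk.pow {π : ℍ → ℂ} {a : SL(2, ℝ)} (ha : Dk π a) (n : ℕ) : Dk π (a ^ n) := by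
  induction n with
  | zero => simpa using Dk.one
  | succ n ih => rw [pow_succ]; exact ih.mul ha
lemma Dk.zpow {π : ℍ → ℂ} {a : SL(2, ℝ)} (ha : Dk π a) (n : ℤ) : Dk π (a ^ n) := by
  cases n with
  | ofNat n => simpa using ha.pow n
  | negSucc n => simpa [zpow_negSucc] using (ha.pow (n+1)).inv

/-- trivial action -/
def Triv (γ : SL(2, ℝ)) : Prop := ∀ u : ℍ, γ • u = u
/-- commuting actions -/
def Cm (a b : SL(2, ℝ)) : Prop := ∀ u : ℍ, a • b • u = b • a • u

section
variable {U : Set ℂ} {π : ℍ → ℂ}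

lemma UCov.uniq (h : UCov U π) {A : Type*} [TopologicalSpace A] [PreconnectedSpace A] {F G : A → ℍ}
    (hF : Continuous F) (hG : Continuous G) (he : ∀ a, π (F a) = π (G a)) {a0 : A} (h0 : F a0 = G a0) (a : A) :
    F a = G a :=
  congrFun ((T2Space.isSeparatedMap π).eq_of_comp_eq h.inj hF hG (funext he) a0 h0) a

lemma UCov.uniqOn (h : UCov U π) {A : Type*} [TopologicalSpace A] {s : Set A} (hs : IsPreconnected s) {F G : A → ℍ}
    (hF : ContinuousOn F s) (hG : ContinuousOn G s) (he : ∀ a ∈ s, π (F a) = π (G a)) {a0 : A} (ha0 : a0 ∈ s)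
    (h0 : F a0 = G a0) : ∀ a ∈ s, F a = G a := by
  have : PreconnectedSpace s := isPreconnected_iff_preconnectedSpace.1 hs
  intro a ha
  exact h.uniq (F := s.restrict F) (G := s.restrict G) hF.restrict hG.restrict (fun a => he a a.2)
    (a0 := ⟨a0, ha0⟩) h0 ⟨a, ha⟩

lemma UCov.free (h : UCov U π) {γ : SL(2, ℝ)} (hγ : Dk π γ) {w : ℍ} (hw : γ • w = w) : Triv γ := fun u =>
  h.uniq (F := fun u => γ • u) (G := fun u => u) (continuous_const_smul γ) continuous_id hγ hw u

lemma UCov.sec (h : UCov U π) (w1 : ℍ) : ∃ V : Set ℍ, IsOpen V ∧ w1 ∈ V ∧ ∃ σ : ℂ → ℍ, ContinuousOn σ (π '' V) ∧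
    ∀ v ∈ V, σ (π v) = v := by
  obtain ⟨V, hV, hw, hi⟩ := h.inj w1
  have hs : ∀ v ∈ V, Function.invFunOn π V (π v) = v := fun v hv => hi.leftInvOn_invFunOn hv
  refine ⟨V, hV, hw, Function.invFunOn π V, ?_, hs⟩
  rintro _ ⟨v, hv, rfl⟩
  refine ContinuousAt.continuousWithinAt ?_
  intro N hN
  rw [hs v hv] at hN
  obtain ⟨N', hN', hN'o, hvN⟩ := _root_.mem_nhds_iff.1 (inter_mem hN (hV.mem_nhds hv))
  rw [Filter.mem_map]
  refine mem_of_superset ((h.opm N' hN'o).mem_nhds ⟨v, hvN, rfl⟩) ?_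
  rintro _ ⟨u, hu, rfl⟩
  show Function.invFunOn π V (π u) ∈ N
  rw [hs u (hN' hu).2]
  exact (hN' hu).1

lemma UCov.lift_homeo (h : UCov U π) (g : ℂ ≃ₜ ℂ) (hg : ∀ z, g z ∈ U ↔ z ∈ U) {w0 w1 : ℍ} (h01 : π w1 = g (π w0)) :
    ∃ G : ℍ ≃ₜ ℍ, G w0 = w1 ∧ ∀ w, π (G w) = g (π w) := by
  obtain ⟨F, F1, F2, F3⟩ := h.lift (fun w => g (π w)) (g.continuous.comp h.cont) (fun u => (hg _).2 (h.maps u)) w0 w1 h01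
  obtain ⟨K, K1, K2, K3⟩ := h.lift (fun w => g.symm (π w)) (g.symm.continuous.comp h.cont)
    (fun u => (hg _).1 (by simpa using h.maps u)) w1 w0 (by rw [h01]; simp)
  refine ⟨⟨⟨F, K, fun x => ?_, fun x => ?_⟩, F1, K1⟩, F2, F3⟩
  · exact h.uniq (F := fun x => K (F x)) (G := fun x => x) (K1.comp F1) continuous_id (fun a => by simp [K3, F3])
      (a0 := w0) (by simp [F2, K2]) x
  · exact h.uniq (F := fun x => F (K x)) (G := fun x => x) (F1.comp K1) continuous_id (fun a => by simp [K3, F3])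
      (a0 := w1) (by simp [F2, K2]) x

lemma UCov.lift_OP (h : UCov U π) {g : ℂ → ℂ} (hg : OP (fun z : ℂ => z) g) (hgc : Continuous g)
    (hgi : Function.Injective g) {G : ℍ ≃ₜ ℍ} (hG : ∀ w, π (G w) = g (π w)) : OP (fun w : ℍ => (w : ℂ)) G := by
  obtain ⟨L, hL, hLe⟩ := hg
  obtain ⟨B1, hB1, l1, hl1, hl1e⟩ := h.loclog UpperHalfPlane.I
  obtain ⟨B2, hB2, l2, hl2, hl2e⟩ := h.loclog (G UpperHalfPlane.I)
  obtain ⟨B, hBs, hBo, hB⟩ := _root_.mem_nhds_iff.1 (inter_mem hB1 (G.continuous.continuousAt.preimage_mem_nhds hB2))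
  have hcoe : ∀ {x y : ℍ}, x ≠ y → (x : ℂ) - y ≠ 0 := fun hxy => sub_ne_zero.2 (fun h => hxy (UpperHalfPlane.ext h))
  have hGne : ∀ {x y : ℍ}, x ≠ y → G x ≠ G y := fun hxy h => hxy (G.injective h)
  obtain ⟨M, hM, hMe⟩ := clog_local_to_global eH (fun p : ℍ × ℍ => ((G p.1 : ℂ) - G p.2) / (p.1 - p.2))
    (by
      refine ContinuousOn.div ?_ ?_ (fun p hp => hcoe hp)
      · have := G.continuous
        exact Continuous.continuousOn (by fun_prop)
      · exact Continuous.continuousOn (by fun_prop))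
    (fun p hp => div_ne_zero (hcoe (hGne hp)) (hcoe hp)) B hBo ⟨_, hB⟩
    (fun p => L (π p.1, π p.2) + l1 p - l2 (G p.1, G p.2))
    (by
      refine ((hL.comp ((h.cont.comp continuous_fst).prodMk (h.cont.comp continuous_snd)).continuousOn ?_).add
        (hl1.mono ?_)).sub (hl2.comp (by have := G.continuous; exact Continuous.continuousOn (by fun_prop)) ?_)
      · rintro ⟨x, y⟩ ⟨hp, hx, hy⟩
        exact (hl1e x (hBs hx).1 y (hBs hy).1 hp).1
      · rintro ⟨x, y⟩ ⟨hp, hx, hy⟩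
        exact ⟨hp, (hBs hx).1, (hBs hy).1⟩
      · rintro ⟨x, y⟩ ⟨hp, hx, hy⟩
        exact ⟨hGne hp, (hBs hx).2, (hBs hy).2⟩)
    (by
      rintro ⟨x, y⟩ ⟨hp, hx, hy⟩
      have e1 := hl1e x (hBs hx).1 y (hBs hy).1 hp
      have e2 := hl2e (G x) (hBs hx).2 (G y) (hBs hy).2 (hGne hp)
      have e3 := hLe _ _ e1.1
      rw [hG, hG, ← e3, ← e1.2] at e2
      simp only
      rw [Complex.exp_sub, Complex.exp_add, div_eq_div_iff (Complex.exp_ne_zero _) (hcoe hp)]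
      linear_combination -e2.2)
  refine ⟨M, hM, fun x y hxy => ?_⟩
  rw [hMe _ hxy]
  exact div_mul_cancel₀ _ (hcoe hxy)

lemma UCov.exists_log (h : UCov U π) {y : ℂ} (hy : y ∉ U) : ∃ l : ℍ → ℂ, Continuous l ∧ ∀ w, Complex.exp (l w) = π w - y :=
  exists_clog (fun w => π w - y) (h.cont.sub continuous_const) (fun w hw => hy (by
    rw [← sub_eq_zero.1 hw]; exact h.maps w))

/-- `n` is the winding number of the deck transformation `γ` measured by the logarithm `l`. -/
def Chi (l : ℍ → ℂ) (γ : SL(2, ℝ)) (n : ℤ) : Prop := ∀ w : ℍ, l (γ • w) = l w + n * (2 * Real.pi * Complex.I)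

lemma Chi.mul {l : ℍ → ℂ} {a b : SL(2, ℝ)} {m n : ℤ} (ha : Chi l a m) (hb : Chi l b n) : Chi l (a * b) (m + n) :=
  fun w => by rw [mul_smul, ha, hb]; push_cast; ring
lemma Chi.inv {l : ℍ → ℂ} {a : SL(2, ℝ)} {m : ℤ} (ha : Chi l a m) : Chi l a⁻¹ (-m) :=
  fun w => by have := ha (a⁻¹ • w); rw [smul_inv_smul] at this; rw [this]; push_cast; ring
lemma Chi.pow {l : ℍ → ℂ} {a : SL(2, ℝ)} {m : ℤ} (ha : Chi l a m) (n : ℕ) : Chi l (a ^ n) (n * m) := by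
  induction n with
  | zero => intro w; simp
  | succ n ih =>
    rw [pow_succ]
    have := ih.mul ha
    convert this using 1
    push_cast; ring
lemma Chi.zpow {l : ℍ → ℂ} {a : SL(2, ℝ)} {m : ℤ} (ha : Chi l a m) (n : ℤ) : Chi l (a ^ n) (n * m) := by
  cases n with
  | ofNat n => simpa using ha.pow n
  | negSucc n =>
    rw [zpow_negSucc]
    have := (ha.pow (n+1)).inv
    convert this using 1
    rw [Int.negSucc_eq]; push_cast; ring
lemma two_pi_I_ne : (2 * Real.pi * Complex.I : ℂ) ≠ 0 := by simp [Real.pi_ne_zero]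
lemma int_two_pi_inj {m n : ℤ} (h : (m : ℂ) * (2 * Real.pi * Complex.I) = n * (2 * Real.pi * Complex.I)) : m = n := by
  exact_mod_cast mul_right_cancel₀ two_pi_I_ne h
lemma Chi.triv {l : ℍ → ℂ} {a : SL(2, ℝ)} {m : ℤ} (ha : Chi l a m) (h : Triv a) : m = 0 := by
  have := ha UpperHalfPlane.I
  rw [h] at this
  apply int_two_pi_inj
  push_cast
  linear_combination -this

lemma UCov.exists_chi {y : ℂ} {l : ℍ → ℂ} (hl : Continuous l)
    (hle : ∀ w, Complex.exp (l w) = π w - y) {γ : SL(2, ℝ)} (hγ : Dk π γ) : ∃ n, Chi l γ n := by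
  obtain ⟨n, hn⟩ := clog_diff_const (isPreconnected_univ (α := ℍ)) (fun w => l (γ • w)) l
    (hl.comp (continuous_const_smul γ)).continuousOn hl.continuousOn (fun w _ => by rw [hle, hle, hγ])
  exact ⟨n, fun w => hn w (Set.mem_univ _)⟩

/-- continuous convergence to the identity -/
def CC {X : Type*} [TopologicalSpace X] (h : ℕ → X → X) : Prop :=
  ∀ x, Tendsto (fun q : ℕ × X => h q.1 q.2) (atTop ×ˢ 𝓝 x) (𝓝 x)

lemma CC.at {X : Type*} [TopologicalSpace X] {h : ℕ → X → X} (hh : CC h) {s : ℕ → X} {x : X}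
    (hs : Tendsto s atTop (𝓝 x)) : Tendsto (fun k => h k (s k)) atTop (𝓝 x) :=
  (hh x).comp (tendsto_id.prodMk hs)

lemma CC.iter {X : Type*} [TopologicalSpace X] {h : ℕ → X → X} (hh : CC h) (n : ℕ) (x : X) :
    Tendsto (fun k => (h k)^[n] x) atTop (𝓝 x) := by
  induction n with
  | zero => simpa using tendsto_const_nhds
  | succ n ih => simp only [Function.iterate_succ_apply']; exact hh.at ih

lemma UCov.NL_loc (h : UCov U π) {g : ℕ → ℂ → ℂ} (hg : CC g) {H : ℕ → ℍ → ℍ}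
    (hHc : ∀ k, Continuous (H k)) (hH : ∀ᶠ k in atTop, ∀ w, π (H k w) = g k (π w)) (w1 : ℍ) :
    ∃ B ∈ 𝓝 w1, ∀ b ∈ B, Tendsto (fun k => H k b) atTop (𝓝 b) → ∀ w ∈ B,
      Tendsto (fun q : ℕ × ℍ => H q.1 q.2) (atTop ×ˢ 𝓝 w) (𝓝 w) := by
  obtain ⟨V, hV, hw1, σ, hσ, hσV⟩ := h.sec w1
  have hVo : IsOpen (π '' V) := h.opm V hV
  have h1 : ∀ᶠ q : ℕ × ℂ in atTop ×ˢ 𝓝 (π w1), g q.1 q.2 ∈ π '' V := hg (π w1) (hVo.mem_nhds ⟨w1, hw1, rfl⟩)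
  obtain ⟨p1, hp1, p2, hp2, hp⟩ := Filter.eventually_prod_iff.1 h1
  have h2 : V ∩ π ⁻¹' {z | p2 z} ∈ 𝓝 w1 := inter_mem (hV.mem_nhds hw1) (h.cont.continuousAt.preimage_mem_nhds hp2)
  obtain ⟨B, hBs, hBo, hwB, hBc⟩ := locallyConnectedSpace_iff_subsets_isOpen_isConnected.1 inferInstance w1 _ h2
  refine ⟨B, hBo.mem_nhds hwB, fun b hb hbt w hw => ?_⟩
  have h3 : ∀ᶠ k in atTop, ∀ x ∈ B, H k x = σ (g k (π x)) := by
    filter_upwards [hH, hp1, hbt (hV.mem_nhds (hBs hb).1)] with k hk1 hk2 hk3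
    have hm : ∀ x ∈ B, g k (π x) ∈ π '' V := fun x hx => hp hk2 (hBs hx).2
    refine h.uniqOn hBc.isPreconnected (hHc k).continuousOn ?_ ?_ hb ?_
    · refine hσ.comp ?_ hm
      refine ((h.cont.comp (hHc k)).congr (fun w => hk1 w)).continuousOn
    · intro x hx
      rw [hk1]
      obtain ⟨v, hv, hve⟩ := hm x hx
      rw [← hve, hσV v hv]
    · rw [← hk1, hσV _ hk3]
  have h4 : Tendsto (fun q : ℕ × ℍ => σ (g q.1 (π q.2))) (atTop ×ˢ 𝓝 w) (𝓝 w) := by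
    have h5 : Tendsto (fun q : ℕ × ℍ => g q.1 (π q.2)) (atTop ×ˢ 𝓝 w) (𝓝 (π w)) :=
      (hg (π w)).comp (Filter.tendsto_id.prodMap (h.cont.tendsto w))
    have h6 : ContinuousAt σ (π w) := hσ.continuousAt (hVo.mem_nhds ⟨w, (hBs hw).1, rfl⟩)
    have h7 := h6.tendsto.comp h5
    rwa [hσV _ (hBs hw).1] at h7
  refine h4.congr' ?_
  filter_upwards [(h3.prod_mk (hBo.mem_nhds hw : ∀ᶠ x in 𝓝 w, x ∈ B))] with q hq
  exact (hq.1 _ hq.2).symm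

lemma UCov.NL (h : UCov U π) {g : ℕ → ℂ → ℂ} (hg : CC g) {H : ℕ → ℍ → ℍ}
    (hHc : ∀ k, Continuous (H k)) (hH : ∀ᶠ k in atTop, ∀ w, π (H k w) = g k (π w)) {w0 : ℍ}
    (h0 : Tendsto (fun k => H k w0) atTop (𝓝 w0)) : CC H := by
  have hpt : ∀ w, (Tendsto (fun q : ℕ × ℍ => H q.1 q.2) (atTop ×ˢ 𝓝 w) (𝓝 w)) → Tendsto (fun k => H k w) atTop (𝓝 w) :=
    fun w hw => hw.comp (tendsto_id.prodMk tendsto_const_nhds)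
  have hZ : {w | Tendsto (fun k => H k w) atTop (𝓝 w)} = Set.univ := by
    refine IsClopen.eq_univ ⟨?_, ?_⟩ ⟨w0, h0⟩
    · refine isClosed_of_closure_subset fun w hw => ?_
      obtain ⟨B, hB, hBw⟩ := h.NL_loc hg hHc hH w
      obtain ⟨b, hb, hbz⟩ := mem_closure_iff_nhds.1 hw B hB
      exact hpt _ (hBw b hb hbz w (mem_of_mem_nhds hB))
    · rw [isOpen_iff_mem_nhds]
      intro w hw
      obtain ⟨B, hB, hBw⟩ := h.NL_loc hg hHc hH w
      exact mem_of_superset hB fun b hb => hpt _ (hBw w (mem_of_mem_nhds hB) hw b hb)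
  intro w
  obtain ⟨B, hB, hBw⟩ := h.NL_loc hg hHc hH w
  have : w ∈ {w | Tendsto (fun k => H k w) atTop (𝓝 w)} := hZ ▸ Set.mem_univ w
  exact hBw w (mem_of_mem_nhds hB) this w (mem_of_mem_nhds hB)

lemma UCov.near (h : UCov U π) {g : ℕ → ℂ ≃ₜ ℂ} (hg : CC (fun k => g k)) (hU : ∀ᶠ k in atTop, ∀ z, g k z ∈ U ↔ z ∈ U) :
    ∃ H : ℕ → (ℍ ≃ₜ ℍ), (∀ᶠ k in atTop, ∀ w, π (H k w) = g k (π w)) ∧ CC (fun k => H k) := by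
  set w0 := UpperHalfPlane.I
  obtain ⟨V, hV, hw1, σ, hσ, hσV⟩ := h.sec w0
  have hVo : IsOpen (π '' V) := h.opm V hV
  have ht : Tendsto (fun k => g k (π w0)) atTop (𝓝 (π w0)) := hg.at tendsto_const_nhds
  have h1 : ∀ k, ∃ H : ℍ ≃ₜ ℍ, ((∀ z, g k z ∈ U ↔ z ∈ U) ∧ g k (π w0) ∈ π '' V) →
      (∀ w, π (H w) = g k (π w)) ∧ H w0 = σ (g k (π w0)) := by
    intro k
    by_cases hk : (∀ z, g k z ∈ U ↔ z ∈ U) ∧ g k (π w0) ∈ π '' V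
    · obtain ⟨G, h1, h2⟩ := h.lift_homeo (g k) hk.1 (w0 := w0) (w1 := σ (g k (π w0))) (by
        obtain ⟨v, hv, hve⟩ := hk.2
        rw [← hve, hσV v hv])
      exact ⟨G, fun _ => ⟨h2, h1⟩⟩
    · exact ⟨Homeomorph.refl _, fun h => absurd h hk⟩
  choose H hH using h1
  have h2 : ∀ᶠ k in atTop, (∀ w, π (H k w) = g k (π w)) ∧ H k w0 = σ (g k (π w0)) := by
    filter_upwards [hU, ht (hVo.mem_nhds ⟨w0, hw1, rfl⟩)] with k hk1 hk2
    exact hH k ⟨hk1, hk2⟩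
  refine ⟨H, h2.mono fun k hk => hk.1, ?_⟩
  refine h.NL hg (fun k => (H k).continuous) (h2.mono fun k hk => hk.1) (w0 := w0) ?_
  have h6 : ContinuousAt σ (π w0) := hσ.continuousAt (hVo.mem_nhds ⟨w0, hw1, rfl⟩)
  have h7 := h6.tendsto.comp ht
  rw [hσV _ hw1] at h7
  exact h7.congr' (h2.mono fun k hk => hk.2.symm)

lemma UCov.near_comm (h : UCov U π) {g : ℕ → ℂ → ℂ} {H : ℕ → (ℍ ≃ₜ ℍ)}
    (hH : ∀ᶠ k in atTop, ∀ w, π (H k w) = g k (π w)) (hcc : CC (fun k => H k)) {γ : SL(2, ℝ)} (hγ : Dk π γ) :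
    ∀ᶠ k in atTop, ∀ w, H k (γ • w) = γ • H k w := by
  set w0 := UpperHalfPlane.I
  obtain ⟨V, hV, hw1, hi⟩ := h.inj (γ • w0)
  have t1 : Tendsto (fun k => H k (γ • w0)) atTop (𝓝 (γ • w0)) := hcc.at tendsto_const_nhds
  have t2 : Tendsto (fun k => γ • H k w0) atTop (𝓝 (γ • w0)) := (hcc.at (tendsto_const_nhds (x := w0))).const_smul γ
  filter_upwards [hH, t1 (hV.mem_nhds hw1), t2 (hV.mem_nhds hw1)] with k hk h1 h2
  have e : ∀ a, π (H k (γ • a)) = π (γ • H k a) := fun a => by rw [hk, hγ, hγ, hk]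
  exact h.uniq (F := fun w => H k (γ • w)) (G := fun w => γ • H k w)
    ((H k).continuous.comp (continuous_const_smul γ)) ((H k).continuous.const_smul γ) e (a0 := w0) (hi h1 h2 (e w0))

/-- lifts and logarithms: constancy of the discrepancy -/
lemma UCov.log_lift (h : UCov U π) {y y' : ℂ} (hy : y ∉ U) {l l' : ℍ → ℂ} (hl : Continuous l)
    (hle : ∀ w, Complex.exp (l w) = π w - y) (hl' : Continuous l')
    (hle' : ∀ w, Complex.exp (l' w) = π w - y') {g : ℂ → ℂ} {M : ℂ × ℂ → ℂ}
    (hM : IsLog (fun z : ℂ => z) g M) (hgy : g y = y') {H : ℍ → ℍ} (hHc : Continuous H) (hH : ∀ w, π (H w) = g (π w)) :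
    ∃ n : ℤ, ∀ w, l' (H w) = l w + M (π w, y) + n * (2 * Real.pi * Complex.I) := by
  have hne : ∀ w, π w ≠ y := fun w hw => hy (hw ▸ h.maps w)
  obtain ⟨n, hn⟩ := clog_diff_const (isPreconnected_univ (α := ℍ)) (fun w => l' (H w)) (fun w => l w + M (π w, y))
    (hl'.comp hHc).continuousOn (hl.continuousOn.add (hM.1.comp (h.cont.prodMk continuous_const).continuousOn
      (fun w _ => hne w))) (fun w _ => by
        rw [hle', hH, Complex.exp_add, hle, mul_comm, hM.2 _ _ (hne w), hgy])
  exact ⟨n, fun w => hn w (Set.mem_univ _)⟩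

lemma small_int {n : ℤ} (h : ‖(n : ℂ) * (2 * Real.pi * Complex.I)‖ < 6) : n = 0 := by
  by_contra hn
  have h1 : (1 : ℝ) ≤ |(n : ℝ)| := by exact_mod_cast Int.one_le_abs hn
  have h2 : ‖(n : ℂ) * (2 * Real.pi * Complex.I)‖ = |(n:ℝ)| * (2 * Real.pi) := by
    simp [abs_of_pos Real.pi_pos]
  rw [h2] at h
  nlinarith [Real.pi_gt_three]

lemma UCov.near_log (h : UCov U π) {y : ℂ} (hy : y ∉ U) {l : ℍ → ℂ} (hl : Continuous l)
    (hle : ∀ w, Complex.exp (l w) = π w - y) {g : ℕ → ℂ → ℂ} {M : ℕ → ℂ × ℂ → ℂ}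
    (hM : ∀ k, IsLog (fun z : ℂ => z) (g k) (M k)) (hgy : ∀ᶠ k in atTop, g k y = y) {H : ℕ → (ℍ ≃ₜ ℍ)}
    (hH : ∀ᶠ k in atTop, ∀ w, π (H k w) = g k (π w)) (hcc : CC (fun k => H k))
    (hMt : ∀ x, x ≠ y → Tendsto (fun k => M k (x, y)) atTop (𝓝 0)) :
    ∀ᶠ k in atTop, ∀ w, l (H k w) = l w + M k (π w, y) := by
  set w0 := UpperHalfPlane.I
  have hne : ∀ w, π w ≠ y := fun w hw => hy (hw ▸ h.maps w)
  have t1 : Tendsto (fun k => l (H k w0) - l w0 - M k (π w0, y)) atTop (𝓝 0) := by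
    have := (((hl.tendsto w0).comp (hcc.at (tendsto_const_nhds (x := w0)))).sub_const (l w0)).sub (hMt _ (hne w0))
    simpa using this
  have t2 : ∀ᶠ k in atTop, ‖l (H k w0) - l w0 - M k (π w0, y)‖ < 6 := by
    have := t1.norm
    rw [norm_zero] at this
    exact this.eventually (gt_mem_nhds (by norm_num))
  filter_upwards [hgy, hH, t2] with k h1 h2 h3
  obtain ⟨n, hn⟩ := h.log_lift hy hl hle hl hle (hM k) h1 (H k).continuous h2
  have : n = 0 := by
    apply small_int
    rw [hn w0] at h3
    convert h3 using 2
    ring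
  intro w
  rw [hn w, this]; simp
end


/-- normal forms -/
def Nf (N : SL(2, ℝ)) : Prop :=
  (∃ b : ℝ, b ≠ 0 ∧ ∀ w : ℍ, ((N • w : ℍ) : ℂ) = w + b) ∨ (∃ c : ℝ, 1 < c ∧ ∀ w : ℍ, ((N • w : ℍ) : ℂ) = c * w)

def Aff (N : SL(2, ℝ)) : Prop := ∃ α β : ℝ, 0 < α ∧ ∀ w : ℍ, ((N • w : ℍ) : ℂ) = α * w + β

lemma sl_det (g : SL(2, ℝ)) : g 0 0 * g 1 1 - g 0 1 * g 1 0 = 1 := by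
  have := g.det_coe
  rwa [Matrix.det_fin_two] at this

lemma aff_of_zero {g : SL(2, ℝ)} (h : g 1 0 = 0) : Aff g := by
  have hd := sl_det g
  rw [h] at hd
  have h1 : g 1 1 ≠ 0 := by rintro h'; rw [h'] at hd; simp at hd
  have h1' : (g 1 1 : ℂ) ≠ 0 := by exact_mod_cast h1
  refine ⟨g 0 0 / g 1 1, g 0 1 / g 1 1, ?_, fun w => ?_⟩
  · have : g 0 0 = 1 / g 1 1 := by field_simp; linarith
    rw [this]
    have := mul_self_pos.2 h1
    rw [div_div]
    positivity
  · rw [sl_coe, h]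
    push_cast
    rw [zero_mul, zero_add, add_div, mul_div_right_comm]

def mkSL (a b c d : ℝ) (h : a * d - b * c = 1) : SL(2, ℝ) := ⟨!![a, b; c, d], by rw [Matrix.det_fin_two_of, h]⟩

lemma mkSL_coe (a b c d : ℝ) (h : a * d - b * c = 1) (w : ℍ) :
    ((mkSL a b c d h • w : ℍ) : ℂ) = (a * w + b) / (c * w + d) := by
  rw [sl_coe]; simp [mkSL]

lemma sl_mul (A B : SL(2, ℝ)) (i j : Fin 2) : (A * B) i j = A i 0 * B 0 j + A i 1 * B 1 j := by
  rw [Matrix.SpecialLinearGroup.coe_mul, Matrix.mul_apply, Fin.sum_univ_two]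

lemma sl_inv (A : SL(2, ℝ)) : A⁻¹ 0 0 = A 1 1 ∧ A⁻¹ 0 1 = - A 0 1 ∧ A⁻¹ 1 0 = - A 1 0 ∧ A⁻¹ 1 1 = A 0 0 := by
  simp [Matrix.SpecialLinearGroup.coe_inv, Matrix.adjugate_fin_two]

lemma mkSL_e (a b c d : ℝ) (h : a * d - b * c = 1) :
    mkSL a b c d h 0 0 = a ∧ mkSL a b c d h 0 1 = b ∧ mkSL a b c d h 1 0 = c ∧ mkSL a b c d h 1 1 = d := by
  simp [mkSL]

lemma exists_aff {S : SL(2, ℝ)} (hS : ∀ w : ℍ, S • w ≠ w) : ∃ A : SL(2, ℝ), Aff (A * S * A⁻¹) := by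
  by_cases hr : S 1 0 = 0
  · exact ⟨1, by simpa using aff_of_zero hr⟩
  have hd := sl_det S
  set p := S 0 0
  set q := S 0 1
  set r := S 1 0
  set s := S 1 1
  have hD : 0 ≤ (s - p)^2 + 4 * q * r := by
    by_contra hneg
    push Not at hneg
    set D := -((s - p)^2 + 4 * q * r) with hDd
    have hD0 : 0 < √D := Real.sqrt_pos.2 (by linarith)
    have hD2 : √D ^ 2 = D := Real.sq_sqrt (by linarith)
    let w : ℍ := ⟨⟨(p - s) / (2 * r), √D / (2 * |r|)⟩, by show 0 < √D / (2 * |r|); positivity⟩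
    apply hS w
    apply UpperHalfPlane.ext
    rw [sl_coe, div_eq_iff (sl_den S w.2)]
    have hr2 : |r| * |r| = r * r := abs_mul_abs_self r
    have hr0 : |r| ≠ 0 := abs_ne_zero.2 hr
    have e1 : (√D / (2 * |r|))^2 = D / (4 * r^2) := by
      rw [div_pow, hD2, mul_pow, sq_abs]; ring_nf
    apply Complex.ext
    · show (((p:ℂ) * w + q)).re = ((w:ℂ) * ((r:ℂ) * w + s)).re
      have a1 : (w : ℂ).re = (p - s) / (2 * r) := rfl
      have a2 : (w : ℂ).im = √D / (2 * |r|) := rfl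
      simp only [Complex.mul_re, Complex.add_re, Complex.add_im, Complex.mul_im, Complex.ofReal_re, Complex.ofReal_im, a1, a2]
      have : p * ((p - s) / (2 * r)) + q = (p - s) / (2 * r) * (r * ((p - s) / (2 * r)) + s) - r * (√D / (2 * |r|))^2 := by
        rw [e1, hDd]; field_simp; ring
      linarith
    · show (((p:ℂ) * w + q)).im = ((w:ℂ) * ((r:ℂ) * w + s)).im
      have a1 : (w : ℂ).re = (p - s) / (2 * r) := rfl
      have a2 : (w : ℂ).im = √D / (2 * |r|) := rfl
      simp only [Complex.mul_re, Complex.add_re, Complex.add_im, Complex.mul_im, Complex.ofReal_re, Complex.ofReal_im, a1, a2]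
      field_simp; ring
  set x := ((p - s) + √((s - p)^2 + 4 * q * r)) / (2 * r) with hx
  have hsq : √((s - p)^2 + 4 * q * r) ^ 2 = (s - p)^2 + 4 * q * r := Real.sq_sqrt hD
  have hroot : r * x^2 + (s - p) * x - q = 0 := by
    set R := √((s - p)^2 + 4 * q * r)
    have : x * (2 * r) = (p - s) + R := by rw [hx]; field_simp
    have h4 : 4 * r * (r * x^2 + (s - p) * x - q) = (x * (2 * r))^2 + 2 * (s - p) * (x * (2 * r)) - 4 * q * r := by ring
    rw [this] at h4
    have h5 : 4 * r * (r * x^2 + (s - p) * x - q) = 0 := by rw [h4]; nlinarith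
    rcases mul_eq_zero.1 h5 with h6 | h6
    · exact absurd (by linarith : r = 0) hr
    · exact h6
  refine ⟨mkSL 0 (-1) 1 (-x) (by ring), aff_of_zero ?_⟩
  have e : (mkSL 0 (-1) 1 (-x) (by ring) * S * (mkSL 0 (-1) 1 (-x) (by ring))⁻¹ : SL(2, ℝ)) 1 0 =
      (p - x * r) * (-x) + (q - x * s) * (-1) := by
    obtain ⟨m1, m2, m3, m4⟩ := mkSL_e 0 (-1) 1 (-x) (by ring)
    obtain ⟨n1, n2, n3, n4⟩ := sl_inv (mkSL 0 (-1) 1 (-x) (by ring))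
    rw [sl_mul, sl_mul, sl_mul, n1, n3, m3, m4]
    ring
  rw [e]
  linarith

lemma Aff.nf {S : SL(2, ℝ)} (h : Aff S) (hS : ∀ w : ℍ, S • w ≠ w) : ∃ A : SL(2, ℝ), Nf (A * S * A⁻¹) := by
  obtain ⟨α, β, hα, h⟩ := h
  by_cases h1 : α = 1
  · refine ⟨1, Or.inl ⟨β, ?_, fun w => by simp [h, h1]⟩⟩
    rintro rfl
    exact hS UpperHalfPlane.I (UpperHalfPlane.ext (by rw [h, h1]; simp))
  set x := β / (1 - α) with hx
  have h1' : 1 - α ≠ 0 := fun h => h1 (by linarith)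
  have hx' : α * x + β = x := by rw [hx]; field_simp; ring
  have hxC : (α * x + β : ℂ) = x := by exact_mod_cast hx'
  rcases lt_or_gt_of_ne h1 with h2 | h2
  · refine ⟨mkSL 0 (-1) 1 (-x) (by ring), Or.inr ⟨α⁻¹, (one_lt_inv₀ hα).2 h2, fun w => ?_⟩⟩
    have hw0 : (w : ℂ) ≠ 0 := w.ne_zero
    have hinv : (mkSL 0 (-1) 1 (-x) (by ring))⁻¹ = mkSL (-x) 1 (-1) 0 (by ring) := by
      apply inv_eq_of_mul_eq_one_right
      obtain ⟨m1, m2, m3, m4⟩ := mkSL_e 0 (-1) 1 (-x) (by ring)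
      obtain ⟨n1, n2, n3, n4⟩ := mkSL_e (-x) 1 (-1) 0 (by ring)
      ext i j
      fin_cases i <;> fin_cases j <;> simp [sl_mul, m1, m2, m3, m4, n1, n2, n3, n4]
    rw [mul_smul, mul_smul, mkSL_coe, h, hinv, mkSL_coe]
    have hα0 : (α : ℂ) ≠ 0 := by exact_mod_cast hα.ne'
    have e : (α * ((((-x : ℝ)) * (w : ℂ) + (1:ℝ)) / ((-1 : ℝ) * w + (0:ℝ))) + β : ℂ) = x - α / w := by
      push_cast
      rw [add_zero, neg_one_mul, div_neg, add_div, mul_div_assoc, div_self hw0]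
      linear_combination hxC
    rw [e]
    push_cast
    have e3 : (1 * (↑x - ↑α / (w:ℂ)) + -(x:ℂ)) = - (α / w) := by ring
    rw [e3, zero_mul, zero_add, div_neg, neg_div, neg_neg, one_div, inv_div, div_eq_inv_mul]
  · refine ⟨mkSL 1 (-x) 0 1 (by ring), Or.inr ⟨α, h2, fun w => ?_⟩⟩
    have hinv : (mkSL 1 (-x) 0 1 (by ring))⁻¹ = mkSL 1 x 0 1 (by ring) := by
      apply inv_eq_of_mul_eq_one_right
      obtain ⟨m1, m2, m3, m4⟩ := mkSL_e 1 (-x) 0 1 (by ring)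
      obtain ⟨n1, n2, n3, n4⟩ := mkSL_e 1 x 0 1 (by ring)
      ext i j
      fin_cases i <;> fin_cases j <;> simp [sl_mul, m1, m2, m3, m4, n1, n2, n3, n4]
    rw [mul_smul, mul_smul, mkSL_coe, h, hinv, mkSL_coe]
    push_cast
    simp only [zero_mul, zero_add, div_one, one_mul]
    linear_combination hxC

lemma exists_nf {S : SL(2, ℝ)} (hS : ∀ w : ℍ, S • w ≠ w) : ∃ A : SL(2, ℝ), Nf (A * S * A⁻¹) := by
  obtain ⟨A, hA⟩ := exists_aff hS
  obtain ⟨B, hB⟩ := hA.nf (fun w hw => hS (A⁻¹ • w) (by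
    rw [mul_smul, mul_smul] at hw
    rw [eq_inv_smul_iff]; exact hw))
  refine ⟨B * A, ?_⟩
  convert hB using 1
  group

lemma comm_trans {N T : SL(2, ℝ)} {b : ℝ} (hb : b ≠ 0) (hN : ∀ w : ℍ, ((N • w : ℍ) : ℂ) = w + b) (hc : Cm T N) :
    ∃ t : ℝ, ∀ w : ℍ, ((T • w : ℍ) : ℂ) = w + t := by
  have hd := sl_det T
  have hdC : (T 0 0 : ℂ) * T 1 1 - T 0 1 * T 1 0 = 1 := by exact_mod_cast hd
  have hbC : (b : ℂ) ≠ 0 := by exact_mod_cast hb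
  have key : ∀ w : ℍ, ((T 1 0 : ℂ) * w + T 1 1) * ((T 1 0 : ℂ) * (w + b) + T 1 1) = 1 := by
    intro w
    have h1 := congrArg (UpperHalfPlane.coe) (hc w)
    rw [hN (T • w), sl_coe T (N • w), hN w, sl_coe T w] at h1
    have d1 := sl_den T w.2
    have d2 := sl_den T (N • w).2
    rw [show ((N • w : ℍ).1 : ℂ) = w + b from hN w] at d2
    change (T 1 0 : ℂ) * (w : ℂ) + T 1 1 ≠ 0 at d1
    rw [div_add' _ _ _ d1, div_eq_div_iff d2 d1] at h1
    apply mul_left_cancel₀ hbC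
    linear_combination (-h1 + b * hdC)
  have k1 := congrArg Complex.re (key UpperHalfPlane.I)
  have k2 := congrArg Complex.re (key (UpperHalfPlane.mk (2 * Complex.I) (by simp)))
  simp at k1 k2
  have hr : T 1 0 = 0 := by
    have : T 1 0 * T 1 0 = 0 := by nlinarith
    exact mul_self_eq_zero.1 this
  rw [hr] at k1 hd
  have hs : T 1 1 ≠ 0 := by rintro h; rw [h] at hd; simp at hd
  have hsC : (T 1 1 : ℂ) ≠ 0 := by exact_mod_cast hs
  have hps : T 0 0 = T 1 1 := by
    apply mul_right_cancel₀ hs; linarith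
  refine ⟨T 0 1 / T 1 1, fun w => ?_⟩
  rw [sl_coe, hr, hps]
  push_cast
  rw [zero_mul, zero_add, add_div, mul_div_right_comm, div_self hsC, one_mul]

lemma comm_hyp {N T : SL(2, ℝ)} {c : ℝ} (hb : 1 < c) (hN : ∀ w : ℍ, ((N • w : ℍ) : ℂ) = c * w) (hc : Cm T N) :
    ∃ t : ℝ, 0 < t ∧ ∀ w : ℍ, ((T • w : ℍ) : ℂ) = t * w := by
  have hd := sl_det T
  have key : ∀ w : ℍ, ((T 0 0 * T 1 0 * c * (1 - c) : ℝ) : ℂ) * w^2 + ((T 0 1 * T 1 0 * (1 - c^2) : ℝ) : ℂ) * w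
      + ((T 0 1 * T 1 1 * (1 - c) : ℝ) : ℂ) = 0 := by
    intro w
    have h1 := congrArg (UpperHalfPlane.coe) (hc w)
    rw [hN (T • w), sl_coe T (N • w), hN w, sl_coe T w] at h1
    have d1 := sl_den T w.2
    have d2 := sl_den T (N • w).2
    rw [show ((N • w : ℍ).1 : ℂ) = c * w from hN w] at d2
    change (T 1 0 : ℂ) * (w : ℂ) + T 1 1 ≠ 0 at d1
    rw [mul_div_assoc', div_eq_div_iff d2 d1] at h1
    push_cast
    linear_combination h1
  have k1 := congrArg Complex.re (key UpperHalfPlane.I)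
  have k2 := congrArg Complex.re (key (UpperHalfPlane.mk (2 * Complex.I) (by simp)))
  have k3 := congrArg Complex.im (key UpperHalfPlane.I)
  simp only [UpperHalfPlane.coe_I, UpperHalfPlane.coe_mk, Complex.I_sq, mul_pow, Complex.add_re, Complex.add_im, Complex.mul_re, Complex.mul_im,
    Complex.ofReal_re, Complex.ofReal_im, Complex.I_re, Complex.I_im, Complex.zero_re, Complex.zero_im, Complex.neg_re, Complex.neg_im,
    Complex.one_re, Complex.one_im] at k1 k2 k3
  norm_num [pow_two] at k1 k2 k3
  have hc1 : 1 - c ≠ 0 := by intro h; linarith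
  have hc2 : 1 - c * c ≠ 0 := by intro h; nlinarith
  have hc3 : c ≠ 0 := by intro h; linarith
  set p := T 0 0
  set q := T 0 1
  set r := T 1 0
  set s := T 1 1
  have z1 : p * r = 0 := by
    have : p * r * c * (1 - c) = 0 := by linarith
    simpa [hc1, hc3] using this
  have z2 : q * s = 0 := by
    have : q * s * (1 - c) = 0 := by linarith
    simpa [hc1] using this
  have z3 : q * r = 0 := by
    simpa [hc2] using k3
  have hps : p * s = 1 := by linarith
  have hs0 : s ≠ 0 := by rintro h; rw [h] at hps; simp at hps
  have hp0 : p ≠ 0 := by rintro h; rw [h] at hps; simp at hps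
  have hq : q = 0 := by simpa [hs0] using z2
  have hr : r = 0 := by simpa [hp0] using z1
  have hsC : (s : ℂ) ≠ 0 := by exact_mod_cast hs0
  refine ⟨p / s, ?_, fun w => ?_⟩
  · rw [show p / s = (p * s) / (s * s) by field_simp, hps]
    have := mul_self_pos.2 hs0
    positivity
  · rw [sl_coe]
    change ((p : ℂ) * w + q) / ((r : ℂ) * w + s) = _
    rw [hq, hr]
    push_cast
    rw [zero_mul, zero_add, add_zero, mul_div_right_comm]


structure Chart (e : ℍ → ℂ) : Prop where
  cont : Continuous e
  inj : Function.Injective e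
  der : ∃ e' : ℂ → ℂ, (∀ v : ℍ, e' v = e v) ∧ ∀ w : ℍ, ∃ d : ℂ, d ≠ 0 ∧ HasStrictDerivAt e' d w

lemma Chart.image_nhds {e : ℍ → ℂ} (he : Chart e) {w : ℍ} {V : Set ℍ} (hV : V ∈ 𝓝 w) : e '' V ∈ 𝓝 (e w) := by
  obtain ⟨e', h1, h2⟩ := he.der
  obtain ⟨d, hd, h3⟩ := h2 w
  have h4 := h3.map_nhds_eq hd
  have h5 : UpperHalfPlane.coe '' V ∈ 𝓝 (w : ℂ) := UpperHalfPlane.isOpenEmbedding_coe.image_mem_nhds.2 hV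
  have h6 := image_mem_map (m := e') h5
  rw [h4, h1, Set.image_image] at h6
  simpa only [h1] using h6

lemma mob_der (A : SL(2, ℝ)) (w : ℍ) : HasStrictDerivAt (fun z : ℂ => ((A 0 0 : ℂ) * z + A 0 1) / ((A 1 0 : ℂ) * z + A 1 1))
    (1 / ((A 1 0 : ℂ) * w + A 1 1) ^ 2) (w : ℂ) := by
  have hd : (A 0 0 : ℂ) * A 1 1 - A 0 1 * A 1 0 = 1 := by exact_mod_cast sl_det A
  have h1 : HasStrictDerivAt (fun z : ℂ => (A 0 0 : ℂ) * z + A 0 1) (A 0 0 : ℂ) (w : ℂ) := by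
    simpa using ((hasStrictDerivAt_id (w : ℂ)).const_mul (A 0 0 : ℂ)).add_const (A 0 1 : ℂ)
  have h2 : HasStrictDerivAt (fun z : ℂ => (A 1 0 : ℂ) * z + A 1 1) (A 1 0 : ℂ) (w : ℂ) := by
    simpa using ((hasStrictDerivAt_id (w : ℂ)).const_mul (A 1 0 : ℂ)).add_const (A 1 1 : ℂ)
  have h3 := h1.fun_div h2 (sl_den A w.2)
  rw [show (1 : ℂ) = (A 0 0 : ℂ) * ((A 1 0 : ℂ) * w + A 1 1) - ((A 0 0 : ℂ) * w + A 0 1) * A 1 0 by linear_combination -hd]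
  exact h3

lemma Cm.conj {S T : SL(2, ℝ)} (h : Cm T S) (A : SL(2, ℝ)) : Cm (A * T * A⁻¹) (A * S * A⁻¹) := by
  intro u
  have := h (A⁻¹ • u)
  simp only [mul_smul, inv_smul_smul]
  rw [this]

lemma exists_chart {S : SL(2, ℝ)} (hS : ∀ w : ℍ, S • w ≠ w) : ∃ e, Chart e ∧ (∀ w, e (S • w) = e w + 1) ∧
    ∀ T : SL(2, ℝ), Cm T S → ∃ t : ℝ, ∀ w, e (T • w) = e w + t := by
  obtain ⟨A, hA⟩ := exists_nf hS
  set M : ℂ → ℂ := (fun z : ℂ => ((A 0 0 : ℂ) * z + A 0 1) / ((A 1 0 : ℂ) * z + A 1 1)) with hM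
  have hMc : ∀ w : ℍ, M w = ((A • w : ℍ) : ℂ) := fun w => (sl_coe A w).symm
  have hMd : ∀ w : ℍ, ∃ d : ℂ, d ≠ 0 ∧ HasStrictDerivAt M d w := fun w =>
    ⟨_, by have := sl_den A w.2; exact one_div_ne_zero (pow_ne_zero 2 this), mob_der A w⟩
  have hconj : ∀ (T : SL(2, ℝ)) (w : ℍ), A • T • w = (A * T * A⁻¹) • A • w := fun T w => by
    simp [mul_smul]
  rcases hA with ⟨b, hb, h⟩ | ⟨c, hc, h⟩
  · have hbC : (b : ℂ) ≠ 0 := by exact_mod_cast hb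
    refine ⟨fun w => M w / b, ⟨?_, ?_, fun z => M z / b, fun v => rfl, fun w => ?_⟩, fun w => ?_, fun T hT => ?_⟩
    · simp only [hMc]
      exact (UpperHalfPlane.continuous_coe.comp (continuous_const_smul A)).div_const _
    · intro w w' hw
      simp only [hMc] at hw
      rw [div_left_inj' hbC] at hw
      exact smul_left_cancel A (UpperHalfPlane.ext hw)
    · obtain ⟨d, hd, h1⟩ := hMd w
      exact ⟨d / b, div_ne_zero hd hbC, h1.div_const _⟩
    · simp only [hMc]
      rw [hconj, h]
      field_simp
    · obtain ⟨t, ht⟩ := comm_trans hb h (hT.conj A)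
      refine ⟨t / b, fun w => ?_⟩
      simp only [hMc]
      rw [hconj, ht]
      push_cast
      field_simp
  · have hl : (Real.log c : ℂ) ≠ 0 := by exact_mod_cast (Real.log_pos hc).ne'
    have hsl : ∀ w : ℍ, (w : ℂ) ∈ Complex.slitPlane := fun w => Or.inr w.2.ne'
    refine ⟨fun w => Complex.log (M w) / Real.log c, ⟨?_, ?_, fun z => Complex.log (M z) / Real.log c, fun v => rfl, fun w => ?_⟩,
      fun w => ?_, fun T hT => ?_⟩
    · simp only [hMc]
      exact ((UpperHalfPlane.continuous_coe.comp (continuous_const_smul A)).clog (fun w => hsl _)).div_const _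
    · intro w w' hw
      simp only [hMc] at hw
      rw [div_left_inj' hl] at hw
      have := congrArg Complex.exp hw
      rw [Complex.exp_log (UpperHalfPlane.ne_zero _), Complex.exp_log (UpperHalfPlane.ne_zero _)] at this
      exact smul_left_cancel A (UpperHalfPlane.ext this)
    · obtain ⟨d, hd, h1⟩ := hMd w
      have h2 : M w ∈ Complex.slitPlane := by rw [hMc]; exact hsl _
      exact ⟨d / M w / Real.log c, div_ne_zero (div_ne_zero hd (Complex.slitPlane_ne_zero h2)) hl, (h1.clog h2).div_const _⟩
    · simp only [hMc]
      rw [hconj, h, Complex.log_ofReal_mul (by linarith) (UpperHalfPlane.ne_zero _), add_div, div_self hl, add_comm]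
    · obtain ⟨t, ht0, ht⟩ := comm_hyp hc h (hT.conj A)
      refine ⟨Real.log t / Real.log c, fun w => ?_⟩
      simp only [hMc]
      rw [hconj, ht, Complex.log_ofReal_mul ht0 (UpperHalfPlane.ne_zero _), add_div, add_comm]
      push_cast
      rfl

def Disc (Γ : Subgroup SL(2, ℝ)) : Prop := ∀ w : ℍ, ∃ V ∈ 𝓝 w, ∀ γ ∈ Γ, γ • w ∈ V → Triv γ

def DkG {X : Type*} (π : ℍ → X) : Subgroup SL(2, ℝ) where
  carrier := {γ | ∀ u, π (γ • u) = π u}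
  mul_mem' := by
    intro a b ha hb u
    rw [mul_smul, ha, hb]
  one_mem' := by intro u; simp
  inv_mem' := by
    intro a ha u
    have := ha (a⁻¹ • u)
    rw [smul_inv_smul] at this
    exact this.symm

lemma Triv.cm {γ : SL(2, ℝ)} (h : Triv γ) (T : SL(2, ℝ)) : Cm T γ := fun u => by rw [h, h]

lemma Disc.free {Γ : Subgroup SL(2, ℝ)} (hΓ : Disc Γ) {γ : SL(2, ℝ)} (hγ : γ ∈ Γ) {w : ℍ} (h : γ • w = w) : Triv γ := by
  obtain ⟨V, hV, h1⟩ := hΓ w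
  exact h1 γ hγ (by rw [h]; exact mem_of_mem_nhds hV)

lemma Disc.nofix {Γ : Subgroup SL(2, ℝ)} (hΓ : Disc Γ) {γ : SL(2, ℝ)} (hγ : γ ∈ Γ) (ht : ¬ Triv γ) (w : ℍ) : γ • w ≠ w :=
  fun h => ht (hΓ.free hγ h)

lemma Disc.iso {Γ : Subgroup SL(2, ℝ)} (hΓ : Disc Γ) {e : ℍ → ℂ} (he : Chart e) :
    ∃ ε > 0, ∀ γ ∈ Γ, ∀ t : ℝ, (∀ w, e (γ • w) = e w + t) → |t| < ε → Triv γ := by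
  obtain ⟨V, hV, h1⟩ := hΓ UpperHalfPlane.I
  obtain ⟨ε, hε, h2⟩ := Metric.mem_nhds_iff.1 (he.image_nhds hV)
  refine ⟨ε, hε, fun γ hγ t ht hlt => h1 γ hγ ?_⟩
  have : e (γ • UpperHalfPlane.I) ∈ e '' V := h2 (by rw [ht, mem_ball, dist_eq_norm]; simpa using hlt)
  obtain ⟨v, hv, hve⟩ := this
  rwa [← he.inj hve]

lemma shift_pow {e : ℍ → ℂ} {T : SL(2, ℝ)} {t : ℝ} (h : ∀ w, e (T • w) = e w + t) (n : ℕ) (w : ℍ) :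
    e (T ^ n • w) = e w + (n * t : ℝ) := by
  induction n generalizing w with
  | zero => simp
  | succ n ih => rw [pow_succ, mul_smul, ih, h]; push_cast; ring

lemma shift_zpow {e : ℍ → ℂ} {T : SL(2, ℝ)} {t : ℝ} (h : ∀ w, e (T • w) = e w + t) (n : ℤ) (w : ℍ) :
    e (T ^ n • w) = e w + (n * t : ℝ) := by
  obtain ⟨m, rfl | rfl⟩ := n.eq_nat_or_neg
  · rw [zpow_natCast, shift_pow h]; simp
  · have := shift_pow h m ((T ^ m)⁻¹ • w)
    rw [smul_inv_smul] at this
    rw [zpow_neg, zpow_natCast, this]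
    push_cast; ring

lemma lemC {Γ : Subgroup SL(2, ℝ)} (hΓ : Disc Γ) {S T : SL(2, ℝ)} (hS : S ∈ Γ) (hT : T ∈ Γ) (hSt : ¬ Triv S) (hc : Cm T S) :
    ∃ k j : ℤ, 0 < k ∧ Triv (T ^ k * S ^ (-j)) ∧ (j = 0 → Triv T) := by
  obtain ⟨e, he, h1, h2⟩ := exists_chart (hΓ.nofix hS hSt)
  obtain ⟨t, ht⟩ := h2 T hc
  obtain ⟨ε, hε, hi⟩ := hΓ.iso he
  obtain ⟨n, hn⟩ := exists_nat_gt (1 / ε)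
  have hn0 : 0 < n := by
    have : (0:ℝ) < n := lt_trans (by positivity) hn
    exact_mod_cast this
  obtain ⟨j, k, hk, -, hjk⟩ := Real.exists_int_int_abs_mul_sub_le t hn0
  have h1' : ∀ w, e (S • w) = e w + (1 : ℝ) := by simpa using h1
  have hsh : ∀ w, e ((T ^ k * S ^ (-j)) • w) = e w + (k * t - j : ℝ) := fun w => by
    rw [mul_smul, shift_zpow ht, shift_zpow h1']; push_cast; ring
  have htr : Triv (T ^ k * S ^ (-j)) := by
    apply hi _ (Γ.mul_mem (Γ.zpow_mem hT _) (Γ.zpow_mem hS _)) _ hsh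
    refine lt_of_le_of_lt hjk ?_
    rw [div_lt_iff₀ (by positivity)]
    rw [div_lt_iff₀ hε] at hn
    nlinarith
  refine ⟨k, j, hk, htr, ?_⟩
  rintro rfl
  have h3 := hsh UpperHalfPlane.I
  rw [htr] at h3
  have h4 : ((k * t - (0:ℤ) : ℝ) : ℂ) = 0 := by linear_combination -h3
  have h5 : k * t = 0 := by
    have : (k * t - (0:ℤ) : ℝ) = 0 := by exact_mod_cast h4
    simpa using this
  have hk' : (k : ℝ) ≠ 0 := by exact_mod_cast hk.ne'
  have h6 : t = 0 := by simpa [hk'] using h5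
  intro u
  apply he.inj
  rw [ht, h6]; simp

lemma lemC_chi {Γ : Subgroup SL(2, ℝ)} (hΓ : Disc Γ) {S T : SL(2, ℝ)} (hS : S ∈ Γ) (hT : T ∈ Γ) (hSt : ¬ Triv S) (hc : Cm T S) :
    ∃ k j : ℤ, 0 < k ∧ (∀ (l : ℍ → ℂ) (n m : ℤ), Chi l T n → Chi l S m → k * n = j * m) ∧ (j = 0 → Triv T) := by
  obtain ⟨k, j, h1, h2, h3⟩ := lemC hΓ hS hT hSt hc
  refine ⟨k, j, h1, fun l n m hn hm => ?_, h3⟩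
  have := (hn.zpow k).mul (hm.zpow (-j))
  have := this.triv h2
  linarith

lemma cm_trans {S T1 T2 : SL(2, ℝ)} (hS : ∀ w : ℍ, S • w ≠ w) (h1 : Cm T1 S) (h2 : Cm T2 S) : Cm T1 T2 := by
  obtain ⟨e, he, h3, h4⟩ := exists_chart hS
  obtain ⟨t1, ht1⟩ := h4 T1 h1
  obtain ⟨t2, ht2⟩ := h4 T2 h2
  intro u
  apply he.inj
  rw [ht1, ht2, ht2, ht1]; ring

/-- a discrete commutative group: rescaled chart -/
lemma exists_gen {Γ : Subgroup SL(2, ℝ)} (hΓ : Disc Γ) {S : SL(2, ℝ)} (hS : S ∈ Γ) (hSt : ¬ Triv S) (hc : ∀ T ∈ Γ, Cm T S) :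
    ∃ e : ℍ → ℂ, ∃ T ∈ Γ, Chart e ∧ (∀ w, e (T • w) = e w + 1) ∧ ∀ γ ∈ Γ, ∃ n : ℤ, ∀ w, e (γ • w) = e w + n := by
  obtain ⟨e, he, h3, h4⟩ := exists_chart (hΓ.nofix hS hSt)
  obtain ⟨ε, hε, hi⟩ := hΓ.iso he
  let Q : AddSubgroup ℝ :=
    { carrier := {t | ∃ γ ∈ Γ, ∀ w, e (γ • w) = e w + t}
      add_mem' := by
        rintro a b ⟨γ, hγ, h⟩ ⟨δ, hδ, h'⟩
        exact ⟨γ * δ, Γ.mul_mem hγ hδ, fun w => by rw [mul_smul, h, h']; push_cast; ring⟩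
      zero_mem' := ⟨1, Γ.one_mem, fun w => by simp⟩
      neg_mem' := by
        rintro a ⟨γ, hγ, h⟩
        refine ⟨γ⁻¹, Γ.inv_mem hγ, fun w => ?_⟩
        have := h (γ⁻¹ • w)
        rw [smul_inv_smul] at this
        rw [this]; push_cast; ring }
  have hQ : Disjoint (Q : Set ℝ) (Set.Ioo 0 ε) := by
    rw [Set.disjoint_left]
    rintro t ⟨γ, hγ, h⟩ ⟨ht0, ht1⟩
    have := hi γ hγ t h (by rwa [abs_of_pos ht0])
    have h5 := h UpperHalfPlane.I
    rw [this] at h5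
    have h6 : (t : ℂ) = 0 := by linear_combination -h5
    have : t = 0 := by exact_mod_cast h6
    linarith
  obtain ⟨a, ha⟩ := AddSubgroup.cyclic_of_isolated_zero hε hQ
  have h1Q : (1 : ℝ) ∈ Q := ⟨S, hS, by simpa using h3⟩
  have haQ : a ∈ Q := by rw [ha]; exact AddSubgroup.mem_closure_singleton_self a
  have ha0 : a ≠ 0 := by
    rintro rfl
    rw [ha, AddSubgroup.mem_closure_singleton] at h1Q
    obtain ⟨n, hn⟩ := h1Q
    simp at hn
  have haC : (a : ℂ) ≠ 0 := by exact_mod_cast ha0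
  obtain ⟨T, hT, hTa⟩ := haQ
  refine ⟨fun w => e w / a, T, hT, ⟨he.cont.div_const _, ?_, ?_⟩, fun w => ?_, fun γ hγ => ?_⟩
  · intro w w' h
    exact he.inj ((div_left_inj' haC).1 h)
  · obtain ⟨e', h5, h6⟩ := he.der
    refine ⟨fun z => e' z / a, fun v => by simp only [h5], fun w => ?_⟩
    obtain ⟨d, hd, h7⟩ := h6 w
    exact ⟨d / a, div_ne_zero hd haC, h7.div_const _⟩
  · show e (T • w) / a = e w / a + 1
    rw [hTa, add_div, div_self haC]
  · obtain ⟨t, ht⟩ := h4 γ (hc γ hγ)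
    have : t ∈ Q := ⟨γ, hγ, ht⟩
    rw [ha, AddSubgroup.mem_closure_singleton] at this
    obtain ⟨n, hn⟩ := this
    refine ⟨n, fun w => ?_⟩
    show e (γ • w) / a = e w / a + n
    rw [ht, ← hn]
    simp only [zsmul_eq_mul]
    push_cast
    field_simp

lemma Disc.small {Γ : Subgroup SL(2, ℝ)} (hΓ : Disc Γ) {γ : ℕ → SL(2, ℝ)} (hγ : ∀ n, γ n ∈ Γ) {δ : ℕ → ℝ} (hδ : Tendsto δ atTop (𝓝 0))
    (h : ∀ n (w : ℍ), ((γ n • w : ℍ) : ℂ) = w + δ n) : ∃ n, δ n = 0 := by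
  obtain ⟨V, hV, h1⟩ := hΓ UpperHalfPlane.I
  have h5 : UpperHalfPlane.coe '' V ∈ 𝓝 (UpperHalfPlane.I : ℂ) := UpperHalfPlane.isOpenEmbedding_coe.image_mem_nhds.2 hV
  have h6 : Tendsto (fun n => ((γ n • UpperHalfPlane.I : ℍ) : ℂ)) atTop (𝓝 (UpperHalfPlane.I : ℂ)) := by
    simp only [h]
    have : Tendsto (fun n => ((δ n : ℝ) : ℂ)) atTop (𝓝 ((0 : ℝ) : ℂ)) := (Complex.continuous_ofReal.tendsto 0).comp hδ
    simpa using tendsto_const_nhds.add this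
  obtain ⟨n, v, hv, hv'⟩ := (h6.eventually h5).exists
  have h7 := h1 (γ n) (hγ n) (by rwa [← UpperHalfPlane.ext hv'])
  refine ⟨n, ?_⟩
  have h8 := h n UpperHalfPlane.I
  rw [h7] at h8
  have : (δ n : ℂ) = 0 := by linear_combination -h8
  exact_mod_cast this

lemma share_par {Γ : Subgroup SL(2, ℝ)} (hΓ : Disc Γ) {N R : SL(2, ℝ)} (hN : N ∈ Γ) (hR : R ∈ Γ) {b α β : ℝ} (hb : b ≠ 0) (hα : 0 < α)
    (h : ∀ w : ℍ, ((N • w : ℍ) : ℂ) = w + b) (h' : ∀ w : ℍ, ((R • w : ℍ) : ℂ) = α * w + β) : 1 ≤ α := by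
  by_contra hlt
  push Not at hlt
  have key : ∀ n : ℕ, ∀ w : ℍ, (((R ^ n * N * (R ^ n)⁻¹) • w : ℍ) : ℂ) = w + (α ^ n * b : ℝ) := by
    intro n
    induction n with
    | zero => intro w; simp [h]
    | succ n ih =>
      intro w
      have e1 : R ^ (n+1) * N * (R ^ (n+1))⁻¹ = R * ((R ^ n * N * (R ^ n)⁻¹) * R⁻¹) := by
        rw [pow_succ']; group
      have e2 := h' (R⁻¹ • w)
      rw [smul_inv_smul] at e2
      rw [e1, mul_smul, h', mul_smul, ih, e2]
      push_cast; ring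
  obtain ⟨n, hn⟩ := hΓ.small (γ := fun n => R ^ n * N * (R ^ n)⁻¹)
    (fun n => Γ.mul_mem (Γ.mul_mem (Γ.pow_mem hR n) hN) (Γ.inv_mem (Γ.pow_mem hR n)))
    (by simpa using (tendsto_pow_atTop_nhds_zero_of_lt_one hα.le hlt).mul_const b) key
  have := pow_pos hα n
  exact (mul_ne_zero this.ne' hb) hn

lemma share {Γ : Subgroup SL(2, ℝ)} (hΓ : Disc Γ) {N R : SL(2, ℝ)} (hN : N ∈ Γ) (hR : R ∈ Γ) (h : Nf N) (hA : Aff R) : Cm R N := by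
  obtain ⟨α, β, hα, h'⟩ := hA
  rcases h with ⟨b, hb, h⟩ | ⟨c, hc, h⟩
  · have h1 := share_par hΓ hN hR hb hα h h'
    have hαC : (α : ℂ) ≠ 0 := by exact_mod_cast hα.ne'
    have h2 := share_par hΓ hN (Γ.inv_mem hR) (α := α⁻¹) (β := -(α⁻¹ * β)) hb (inv_pos.2 hα) h (fun w => by
      have e2 := h' (R⁻¹ • w)
      rw [smul_inv_smul] at e2
      rw [e2]; push_cast; field_simp; ring)
    have h3 : α = 1 := by
      refine le_antisymm ?_ h1
      exact (one_le_inv₀ hα).1 h2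
    intro u
    apply UpperHalfPlane.ext
    rw [h', h, h, h', h3]; push_cast; ring
  · have hc0 : 0 < c := by linarith
    have hcC : (c : ℂ) ≠ 0 := by exact_mod_cast hc0.ne'
    have key : ∀ n : ℕ, ∀ w : ℍ, (((N ^ n)⁻¹ * R * N ^ n) • w : ℍ) = (α : ℂ) * w + (β * (c⁻¹) ^ n : ℝ) := by
      intro n
      induction n with
      | zero => intro w; simp [h']
      | succ n ih =>
        intro w
        have e1 : (N ^ (n+1))⁻¹ * R * N ^ (n+1) = N⁻¹ * (((N ^ n)⁻¹ * R * N ^ n) * N) := by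
          rw [pow_succ]; group
        have e2 := h ((N⁻¹ * (((N ^ n)⁻¹ * R * N ^ n) * N)) • w)
        rw [mul_smul, smul_inv_smul, mul_smul, ih, h] at e2
        rw [e1, mul_smul, mul_smul]
        apply mul_left_cancel₀ hcC
        rw [← e2]; push_cast; rw [pow_succ]; field_simp
    have key2 : ∀ n : ℕ, ∀ w : ℍ, ((((N ^ (n+1))⁻¹ * R * N ^ (n+1)) * ((N ^ n)⁻¹ * R * N ^ n)⁻¹) • w : ℍ) =
        (w : ℂ) + (β * (c⁻¹) ^ (n + 1) - β * (c⁻¹) ^ n : ℝ) := by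
      intro n w
      have e2 := key n (((N ^ n)⁻¹ * R * N ^ n)⁻¹ • w)
      rw [smul_inv_smul] at e2
      rw [mul_smul, key, e2]
      push_cast; ring
    have ht : Tendsto (fun n : ℕ => β * (c⁻¹) ^ n) atTop (𝓝 0) := by
      simpa using (tendsto_pow_atTop_nhds_zero_of_lt_one (inv_pos.2 hc0).le (inv_lt_one_of_one_lt₀ hc)).const_mul β
    have hm : ∀ n : ℕ, ((N ^ n)⁻¹ * R * N ^ n) ∈ Γ := fun n =>
      Γ.mul_mem (Γ.mul_mem (Γ.inv_mem (Γ.pow_mem hN n)) hR) (Γ.pow_mem hN n)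
    obtain ⟨n, hn⟩ := hΓ.small (γ := fun n => ((N ^ (n+1))⁻¹ * R * N ^ (n+1)) * ((N ^ n)⁻¹ * R * N ^ n)⁻¹)
      (fun n => Γ.mul_mem (hm _) (Γ.inv_mem (hm n)))
      (by simpa using ((tendsto_add_atTop_iff_nat 1).2 ht).sub ht) key2
    have h4 : β * ((c⁻¹) ^ n * (c⁻¹ - 1)) = 0 := by rw [← hn]; ring
    have h5 : c⁻¹ - 1 ≠ 0 := by
      have := inv_lt_one_of_one_lt₀ hc
      intro h; linarith
    have h6 : β = 0 := by
      rcases mul_eq_zero.1 h4 with h | h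
      · exact h
      · exact absurd h (mul_ne_zero (pow_ne_zero _ (inv_ne_zero hc0.ne')) h5)
    intro u
    apply UpperHalfPlane.ext
    rw [h', h, h, h', h6]; push_cast; ring

lemma Disc.conj {Γ : Subgroup SL(2, ℝ)} (hΓ : Disc Γ) (A : SL(2, ℝ)) : Disc (Γ.map (MulAut.conj A).toMonoidHom) := by
  intro w
  obtain ⟨V, hV, h1⟩ := hΓ (A⁻¹ • w)
  refine ⟨(fun u => A⁻¹ • u) ⁻¹' V, (continuous_const_smul A⁻¹).continuousAt.preimage_mem_nhds hV, ?_⟩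
  rintro _ ⟨γ, hγ, rfl⟩ h
  have e : ∀ u : ℍ, ((MulAut.conj A).toMonoidHom γ) • u = A • γ • A⁻¹ • u := fun u => by
    simp [MulAut.conj_apply, mul_smul]
  have := h1 γ hγ (by
    have h' : A⁻¹ • (((MulAut.conj A).toMonoidHom γ) • w) ∈ V := h
    rwa [e, inv_smul_smul] at h')
  intro u
  rw [e, this, smul_inv_smul]

lemma share_conj {Γ : Subgroup SL(2, ℝ)} (hΓ : Disc Γ) {N R A : SL(2, ℝ)} (hN : N ∈ Γ) (hR : R ∈ Γ) (h : Nf (A * N * A⁻¹))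
    (hA : Aff (A * R * A⁻¹)) : Cm R N := by
  have := share (hΓ.conj A) (N := A * N * A⁻¹) (R := A * R * A⁻¹) ⟨N, hN, rfl⟩ ⟨R, hR, rfl⟩ h hA
  have := this.conj A⁻¹
  convert this using 1 <;> group

lemma UCov.disc {U : Set ℂ} {π : ℍ → ℂ} (h : UCov U π) : Disc (DkG π) := by
  intro w
  obtain ⟨V, hV, hw, h1⟩ := h.inj w
  refine ⟨V, hV.mem_nhds hw, fun γ hγ hm => h.free hγ (h1 hm hw (hγ w))⟩


open Classical in
noncomputable def slp (q : ℂ → ℂ) (p : ℍ × ℍ) : ℂ :=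
  if p.1 = p.2 then deriv q p.2 else (q p.1 - q p.2) / ((p.1 : ℂ) - p.2)

lemma slp_cont {q : ℂ → ℂ} (hd : DifferentiableOn ℂ q {z | 0 < z.im}) (v : ℍ) : ContinuousAt (slp q) (v, v) := by
  have hv : {z : ℂ | 0 < z.im} ∈ 𝓝 (v : ℂ) := isOpen_im_pos.mem_nhds v.2
  have h1 : HasStrictDerivAt q (deriv q v) v := (hd.analyticAt hv).hasStrictDerivAt
  have h2 : ContinuousAt (deriv q) v := ((hd.deriv isOpen_im_pos).differentiableAt hv).continuousAt
  have hc : Continuous fun p : ℍ × ℍ => ((p.1 : ℂ), (p.2 : ℂ)) := by fun_prop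
  rw [ContinuousAt, Metric.tendsto_nhds]
  intro ε hε
  have h3 := (hc.tendsto (v, v)).eventually (h1.hasStrictFDerivAt.isLittleO.def (c := ε / 2) (by positivity))
  have h4 : ∀ᶠ p : ℍ × ℍ in 𝓝 (v, v), dist (deriv q p.2) (deriv q v) < ε := by
    have : ContinuousAt (fun p : ℍ × ℍ => deriv q p.2) (v, v) :=
      ContinuousAt.comp (f := fun p : ℍ × ℍ => (p.2 : ℂ)) (g := deriv q) h2 (by fun_prop)
    exact Metric.tendsto_nhds.1 this ε hε
  filter_upwards [h3, h4] with p h3 h4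
  have e0 : slp q (v, v) = deriv q v := by simp [slp]
  rw [e0]
  by_cases hp : p.1 = p.2
  · rw [slp, if_pos hp]; exact h4
  · rw [slp, if_neg hp, dist_eq_norm]
    have hne : (p.1 : ℂ) - p.2 ≠ 0 := sub_ne_zero.2 (fun h => hp (UpperHalfPlane.ext h))
    have hpos := norm_pos_iff.2 hne
    have e1 : (q p.1 - q p.2) / ((p.1 : ℂ) - p.2) - deriv q v = (q p.1 - q p.2 - deriv q v * ((p.1 : ℂ) - p.2)) / ((p.1 : ℂ) - p.2) := by
      field_simp
    rw [e1, norm_div, div_lt_iff₀ hpos]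
    have h5 : ‖q p.1 - q p.2 - deriv q v * ((p.1 : ℂ) - p.2)‖ ≤ ε / 2 * ‖(p.1 : ℂ) - p.2‖ := by
      simpa [mul_comm] using h3
    nlinarith

lemma ann_F {q : ℂ → ℂ} (hqd : DifferentiableOn ℂ q {z | 0 < z.im}) (hq0 : ∀ w : ℍ, deriv q w ≠ 0)
    {e : ℍ → ℂ} (he : Chart e) {T : SL(2, ℝ)} (hT : ∀ w : ℍ, q (T • w : ℍ) = q w) (heT : ∀ w, e (T • w) = e w + 1)
    (hfib : ∀ w w' : ℍ, q w = q w' → ∃ n : ℤ, e w = e w' + n) :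
    ∃ Θ : ℍ × ℍ → ℂ, Continuous Θ ∧ (∃ n : ℤ, ∀ w w' : ℍ, Θ (T • w, w') = Θ (w, w') + n * (2 * Real.pi * Complex.I)) ∧
      ∀ w w' : ℍ, Complex.exp (Θ (w, w')) * (Complex.exp (2 * Real.pi * Complex.I * e w) - Complex.exp (2 * Real.pi * Complex.I * e w'))
        = q w - q w' := by
  classical
  obtain ⟨e', h1, h2⟩ := he.der
  set E : ℂ → ℂ := fun z => Complex.exp (2 * Real.pi * Complex.I * e' z) with hE
  have hEd : ∀ w : ℍ, ∃ d : ℂ, d ≠ 0 ∧ HasStrictDerivAt E d w := by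
    intro w
    obtain ⟨d, hd, h3⟩ := h2 w
    exact ⟨_, mul_ne_zero (Complex.exp_ne_zero _) (mul_ne_zero two_pi_I_ne hd), (h3.const_mul _).cexp⟩
  have hEdiff : DifferentiableOn ℂ E {z | 0 < z.im} := by
    intro z hz
    obtain ⟨d, hd, h3⟩ := hEd ⟨z, hz⟩
    exact h3.hasDerivAt.differentiableAt.differentiableWithinAt
  have hE0 : ∀ w : ℍ, deriv E w ≠ 0 := by
    intro w
    obtain ⟨d, hd, h3⟩ := hEd w
    rw [h3.hasDerivAt.deriv]; exact hd
  have hEe : ∀ w : ℍ, E w = Complex.exp (2 * Real.pi * Complex.I * e w) := fun w => by simp only [hE, h1]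
  have hEi : ∀ w w' : ℍ, E w = E w' ↔ ∃ n : ℤ, e w = e w' + n := by
    intro w w'
    rw [hEe, hEe, Complex.exp_eq_exp_iff_exists_int]
    constructor
    · rintro ⟨n, hn⟩
      refine ⟨n, mul_left_cancel₀ two_pi_I_ne ?_⟩
      rw [hn]; ring
    · rintro ⟨n, hn⟩
      exact ⟨n, by rw [hn]; ring⟩
  have hET : ∀ w : ℍ, E (T • w : ℍ) = E w := fun w => (hEi _ _).2 ⟨1, by rw [heT]; simp⟩
  have hET' : ∀ (n : ℤ) (w : ℍ), E (T ^ n • w : ℍ) = E w := fun n w => (hEi _ _).2 ⟨n, by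
    rw [shift_zpow (e := e) (T := T) (t := 1) (by simpa using heT)]; simp⟩
  have hqT' : ∀ (n : ℤ) (w : ℍ), q (T ^ n • w : ℍ) = q w := fun n w =>
    (DkG (fun w : ℍ => q w)).zpow_mem (x := T) hT n w
  have hEc : Continuous fun w : ℍ => E w := by
    simp only [hEe]
    exact Complex.continuous_exp.comp (continuous_const.mul he.cont)
  have hqc : Continuous fun w : ℍ => q w := by
    rw [continuous_iff_continuousAt]
    intro w
    exact ContinuousAt.comp (f := fun w : ℍ => (w : ℂ)) (g := q) (hqd.differentiableAt (isOpen_im_pos.mem_nhds w.2)).continuousAt (by fun_prop)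
  set F : ℍ × ℍ → ℂ := fun p => if E p.1 = E p.2 then deriv q p.2 / deriv E p.2 else (q p.1 - q p.2) / (E p.1 - E p.2) with hF
  have hF0 : ∀ p, F p ≠ 0 := by
    intro p
    by_cases hp : E p.1 = E p.2
    · simp only [hF, if_pos hp]; exact div_ne_zero (hq0 _) (hE0 _)
    · simp only [hF, if_neg hp]
      refine div_ne_zero (sub_ne_zero.2 fun h => hp ((hEi _ _).2 (hfib _ _ h))) (sub_ne_zero.2 hp)
  have hFT : ∀ (n : ℤ) (w w' : ℍ), F (T ^ n • w, w') = F (w, w') := by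
    intro n w w'
    simp only [hF, hET', hqT']
  have hdiag : ∀ v : ℍ, ContinuousAt F (v, v) := by
    intro v
    have c1 := slp_cont hqd v
    have c2 := slp_cont hEdiff v
    have c0 : slp E (v, v) ≠ 0 := by simpa [slp] using hE0 v
    refine (c1.div c2 c0).congr ?_
    filter_upwards [c2.eventually_ne c0] with p hp
    by_cases hpe : p.1 = p.2
    · simp [hF, slp, hpe]
    · have hne : (p.1 : ℂ) - p.2 ≠ 0 := sub_ne_zero.2 (fun h => hpe (UpperHalfPlane.ext h))
      simp only [slp, if_neg hpe] at hp
      have hEne : E p.1 ≠ E p.2 := by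
        intro h; apply hp; rw [h]; simp
      simp only [hF, slp, if_neg hpe, if_neg hEne, Pi.div_apply]
      rw [div_div_div_cancel_right₀ hne]
  have hFc : Continuous F := by
    rw [continuous_iff_continuousAt]
    rintro ⟨w0, w0'⟩
    by_cases h0 : E w0 = E w0'
    · obtain ⟨n, hn⟩ := (hEi _ _).1 h0
      have hw : T ^ (-n) • w0 = w0' := by
        apply he.inj
        rw [shift_zpow (e := e) (T := T) (t := 1) (by simpa using heT), hn]; push_cast; ring
      have : F = F ∘ (fun p : ℍ × ℍ => (T ^ (-n) • p.1, p.2)) := by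
        funext p; exact (hFT (-n) p.1 p.2).symm
      rw [this]
      apply ContinuousAt.comp
      · show ContinuousAt F (T ^ (-n) • w0, w0')
        rw [hw]; exact hdiag _
      · exact (((continuous_const_smul (T ^ (-n))).comp continuous_fst).prodMk continuous_snd).continuousAt
    · have c1 : ContinuousAt (fun p : ℍ × ℍ => E p.1 - E p.2) (w0, w0') := ((hEc.comp continuous_fst).sub (hEc.comp continuous_snd)).continuousAt
      have c2 : ContinuousAt (fun p : ℍ × ℍ => q p.1 - q p.2) (w0, w0') := ((hqc.comp continuous_fst).sub (hqc.comp continuous_snd)).continuousAt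
      have c0 : (fun p : ℍ × ℍ => E p.1 - E p.2) (w0, w0') ≠ 0 := sub_ne_zero.2 h0
      refine (c2.div c1 c0).congr ?_
      filter_upwards [c1.eventually_ne c0] with p hp
      simp only [hF, if_neg (sub_ne_zero.1 hp), Pi.div_apply]
  obtain ⟨Θ, hΘ, hΘF⟩ := exists_clog F hFc hF0
  refine ⟨Θ, hΘ, ?_, ?_⟩
  · obtain ⟨n, hn⟩ := clog_diff_const (s := (Set.univ : Set (ℍ × ℍ))) isPreconnected_univ (fun p => Θ (T • p.1, p.2)) Θ
      (hΘ.comp (((continuous_const_smul T).comp continuous_fst).prodMk continuous_snd)).continuousOn hΘ.continuousOn (fun p _ => by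
        rw [hΘF, hΘF]; simpa using hFT 1 p.1 p.2)
    exact ⟨n, fun w w' => hn (w, w') trivial⟩
  · intro w w'
    rw [hΘF, ← hEe, ← hEe]
    by_cases h : E w = E w'
    · obtain ⟨n, hn⟩ := (hEi _ _).1 h
      have hw : T ^ (n) • w' = w := by
        apply he.inj
        rw [shift_zpow (e := e) (T := T) (t := 1) (by simpa using heT), hn]; push_cast; ring
      rw [h, ← hw, hqT']; simp
    · simp only [hF, if_neg h]
      rw [div_mul_cancel₀ _ (sub_ne_zero.2 h)]

lemma ann_side {q : ℂ → ℂ} (hqc : Continuous fun w : ℍ => q w) (hqo : IsOpenMap fun w : ℍ => q w) (hq1 : ∀ w : ℍ, ‖q w‖ < 1) {T : SL(2, ℝ)}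
    (hT : ∀ w : ℍ, q (T • w : ℍ) = q w) {s : ℍ → ℝ} (hs : Continuous s)
    (hsq : ∀ w w' : ℍ, q w = q w' → s w = s w') (hlow : ∀ w : ℍ, ∃ v, s v < s w) {n : ℤ} (hn : n ≠ 0)
    (hl : ∀ w' : ℍ, ∃ l : ℍ → ℂ, ContinuousOn l {w | s w' < s w} ∧ (∀ w, s w' < s w → Complex.exp (l w) = q w - q w') ∧
      ∀ w, s w' < s w → l (T • w) = l w + n * (2 * Real.pi * Complex.I)) :
    ∃ x : ℂ, ‖x‖ < 1 ∧ (∀ w : ℍ, q w ≠ x) ∧ x ∈ closure (Set.range fun w : ℍ => q w) ∧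
      ∀ l : ℍ → ℂ, Continuous l → (∀ w, Complex.exp (l w) = q w - x) → l (T • UpperHalfPlane.I) ≠ l UpperHalfPlane.I := by
  set w1 := UpperHalfPlane.I
  obtain ⟨γ⟩ := PathConnectedSpace.joined w1 (T • w1)
  have hCc : IsCompact (Set.range γ) := isCompact_range γ.continuous
  obtain ⟨c0, hc0, hmin⟩ := hCc.exists_isMinOn ⟨_, Set.mem_range_self 0⟩ hs.continuousOn
  have hmin' : ∀ c ∈ Set.range γ, s c0 ≤ s c := fun c hc => hmin hc
  set V : Set ℍ := {w' | s w' < s c0} with hV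
  set K := closure ((fun w : ℍ => q w) '' V) with hK
  have hKc : IsCompact K := by
    refine (isCompact_closedBall (0:ℂ) 1).of_isClosed_subset isClosed_closure (closure_minimal ?_ isClosed_closedBall)
    rintro _ ⟨w, -, rfl⟩
    simpa using (hq1 w).le
  have hnot : ∃ x ∈ K, ∀ w : ℍ, q w ≠ x := by
    by_contra hcon
    push Not at hcon
    obtain ⟨v0, hv0⟩ := hlow c0
    have hVne : Nonempty V := ⟨⟨v0, hv0⟩⟩
    obtain ⟨v, hv⟩ := hKc.elim_directed_cover (fun v : V => (fun w : ℍ => q w) '' {w | s v < s w})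
      (fun v => hqo _ (isOpen_lt continuous_const hs)) (by
        intro x hx
        obtain ⟨w, hw⟩ := hcon x hx
        obtain ⟨v, hv⟩ := hlow w
        rcases lt_or_ge (s w) (s c0) with h | h
        · exact Set.mem_iUnion.2 ⟨⟨v, hv.trans h⟩, w, hv, hw⟩
        · exact Set.mem_iUnion.2 ⟨⟨v0, hv0⟩, w, lt_of_lt_of_le hv0 h, hw⟩) (by
        intro a b
        rcases le_total (s a) (s b) with h | h
        · exact ⟨a, subset_rfl, Set.image_mono fun w hw => lt_of_le_of_lt h hw⟩
        · exact ⟨b, Set.image_mono fun w hw => lt_of_le_of_lt h hw, subset_rfl⟩)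
    obtain ⟨w, hw, hwv⟩ := hv (subset_closure ⟨v.1, v.2, rfl⟩)
    have := hsq _ _ hwv
    rw [Set.mem_ofPred_eq, this] at hw
    exact lt_irrefl _ hw
  obtain ⟨x, hxK, hx⟩ := hnot
  have key : ∀ l : ℍ → ℂ, Continuous l → (∀ w, Complex.exp (l w) = q w - x) → l (T • w1) ≠ l w1 := by
    intro l hlc hle heq
    have hpos : ∀ w : ℍ, 0 < ‖q w - x‖ := fun w => norm_pos_iff.2 (sub_ne_zero.2 (hx w))
    obtain ⟨c1, hc1, hmin1⟩ := hCc.exists_isMinOn ⟨_, Set.mem_range_self 0⟩ (f := fun w : ℍ => ‖q w - x‖)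
      (hqc.sub continuous_const).norm.continuousOn
    have hmin1' : ∀ c ∈ Set.range γ, ‖q c1 - x‖ ≤ ‖q c - x‖ := fun c hc => hmin1 hc
    obtain ⟨_, ⟨w', hw', rfl⟩, hd⟩ := Metric.mem_closure_iff.1 hxK _ (hpos c1)
    obtain ⟨m, hm, hme, hmT⟩ := hl w'
    have hC : Set.range γ ⊆ {w | s w' < s w} := fun c hc => lt_of_lt_of_le hw' (hmin' c hc)
    have hsl : ∀ c ∈ Set.range γ, 1 + (x - q w') / (q c - x) ∈ Complex.slitPlane := by
      intro c hc
      apply Complex.mem_slitPlane_of_norm_lt_one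
      rw [norm_div, div_lt_one (hpos c)]
      rw [dist_eq_norm] at hd
      exact lt_of_lt_of_le hd (hmin1' c hc)
    obtain ⟨k, hk⟩ := clog_diff_const (s := Set.range γ) (isPreconnected_range γ.continuous) m
      (fun c => l c + Complex.log (1 + (x - q w') / (q c - x))) (hm.mono hC)
      (hlc.continuousOn.add (ContinuousOn.clog (continuousOn_const.add (continuousOn_const.div (hqc.sub continuous_const).continuousOn
        (fun c _ => sub_ne_zero.2 (hx c)))) hsl)) (fun c hc => by
        rw [hme c (hC hc), Complex.exp_add, hle, Complex.exp_log (Complex.slitPlane_ne_zero (hsl c hc))]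
        have := sub_ne_zero.2 (hx c)
        field_simp
        ring)
    have m1 : w1 ∈ Set.range γ := ⟨0, by simp⟩
    have m2 : T • w1 ∈ Set.range γ := ⟨1, by simp⟩
    have k1 := hk _ m1
    have k2 := hk _ m2
    rw [hT, heq, hmT w1 (hC m1), k1] at k2
    apply hn
    apply int_two_pi_inj
    push_cast
    linear_combination k2
  refine ⟨x, ?_, hx, closure_mono (Set.image_subset_range _ _) hxK, key⟩
  by_contra hx1
  push Not at hx1
  have hx0 : x ≠ 0 := by
    rintro rfl; simp at hx1; linarith
  have hsl : ∀ w : ℍ, 1 - q w / x ∈ Complex.slitPlane := by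
    intro w
    rw [sub_eq_add_neg]
    apply Complex.mem_slitPlane_of_norm_lt_one
    rw [norm_neg, norm_div, div_lt_one (by linarith)]
    exact lt_of_lt_of_le (hq1 w) hx1
  refine key (fun w => Complex.log (1 - q w / x) + Complex.log (-x))
    ((Continuous.clog (continuous_const.sub (hqc.div_const x)) hsl).add continuous_const) (fun w => ?_) ?_
  · rw [Complex.exp_add, Complex.exp_log (Complex.slitPlane_ne_zero (hsl w)), Complex.exp_log (neg_ne_zero.2 hx0)]
    field_simp
    ring
  · simp only [hT]

lemma annulus {U : Set ℂ} {q : ℂ → ℂ} {π : ℍ → ℂ} (hq : Cov (psi '' U) q) (hπ : UCov U π) (hqπ : ∀ w : ℍ, psi (π w) = q w)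
    {e : ℍ → ℂ} (he : Chart e) {T : SL(2, ℝ)} (hT : T ∈ DkG π) (heT : ∀ w, e (T • w) = e w + 1)
    (hΓ : ∀ γ ∈ DkG π, ∃ n : ℤ, ∀ w, e (γ • w) = e w + n) :
    ∃ y : ℂ, y ∉ U ∧ y ∈ closure U ∧ ∀ l : ℍ → ℂ, Continuous l → (∀ w, Complex.exp (l w) = π w - y) → ¬ Chi l T 0 := by
  have hqT : ∀ w : ℍ, q (T • w : ℍ) = q w := fun w => by rw [← hqπ, hT, hqπ]
  have hfib : ∀ w w' : ℍ, q w = q w' → ∃ n : ℤ, e w = e w' + n := by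
    intro w w' h
    rw [← hqπ, ← hqπ] at h
    obtain ⟨g, hg, hg'⟩ := hπ.deck (psi_inj h).symm
    obtain ⟨n, hn⟩ := hΓ g hg'
    exact ⟨n, by rw [← hg, hn]⟩
  have hqc : Continuous fun w : ℍ => q w := by
    simp only [← hqπ]; exact psi_cont.comp hπ.cont
  have hqo : IsOpenMap fun w : ℍ => q w := by
    simp only [← hqπ]; exact psi_openEmb.isOpenMap.comp hπ.opm
  have hq1 : ∀ w : ℍ, ‖q w‖ < 1 := fun w => by
    have := psi_mem (π w)
    rw [hqπ] at this; simpa using this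
  suffices h : ∃ x : ℂ, ‖x‖ < 1 ∧ (∀ w : ℍ, q w ≠ x) ∧ x ∈ closure (Set.range fun w : ℍ => q w) ∧
      ∀ l : ℍ → ℂ, Continuous l → (∀ w, Complex.exp (l w) = q w - x) → l (T • UpperHalfPlane.I) ≠ l UpperHalfPlane.I by
    obtain ⟨x, hx1, hx2, hx3, hx4⟩ := h
    obtain ⟨y, hy⟩ := Homeomorph.unitBall.surjective (⟨x, by simpa using hx1⟩ : ball (0:ℂ) 1)
    have hyx : psi y = x := congrArg Subtype.val hy
    obtain ⟨M, hM, hM'⟩ := psi_log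
    have hyU : y ∉ U := by
      intro h
      obtain ⟨w, hw⟩ := hπ.surj y h
      exact hx2 w (by rw [← hqπ, hw, hyx])
    have hne : ∀ w, π w ≠ y := fun w h => hyU (h ▸ hπ.maps w)
    refine ⟨y, hyU, ?_, fun l hl hle hchi => ?_⟩
    · rw [psi_openEmb.isInducing.closure_eq_preimage_closure_image, Set.mem_preimage, hyx]
      refine closure_mono ?_ hx3
      rintro _ ⟨w, rfl⟩
      exact ⟨π w, hπ.maps w, hqπ w⟩
    · refine hx4 (fun w => M (π w, y) + l w) (Continuous.add ?_ hl) (fun w => ?_) ?_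
      · rw [← continuousOn_univ]
        exact hM.comp (hπ.cont.prodMk continuous_const).continuousOn (fun w _ => hne w)
      · rw [Complex.exp_add, hle, hM' _ _ (hne w), hqπ, hyx]
      · show M (π (T • UpperHalfPlane.I), y) + l (T • UpperHalfPlane.I) = _
        rw [hT, hchi]; simp
  obtain ⟨Θ, hΘ, ⟨n, hn⟩, hΘe⟩ := ann_F hq.diff hq.dne he hqT heT hfib
  have hlow : ∀ w : ℍ, ∀ t : ℝ, t ≠ 0 → ∃ v, ∃ r > 0, (e v).im = (e w).im + r * t := by
    intro w t ht
    have h1 := he.image_nhds (w := w) univ_mem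
    have h2 : Tendsto (fun r : ℝ => e w + r * t * Complex.I) (𝓝[>] 0) (𝓝 (e w)) := by
      have : Continuous fun r : ℝ => e w + r * t * Complex.I := by fun_prop
      have := this.tendsto 0
      simp only [Complex.ofReal_zero, zero_mul, add_zero] at this
      exact this.mono_left nhdsWithin_le_nhds
    obtain ⟨r, ⟨v, -, hv⟩, hr⟩ := ((h2.eventually h1).and self_mem_nhdsWithin).exists
    exact ⟨v, r, hr, by rw [hv]; simp⟩
  have hEn : ∀ w : ℍ, ‖Complex.exp (2 * Real.pi * Complex.I * e w)‖ = Real.exp (- (2 * Real.pi * (e w).im)) := by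
    intro w; rw [Complex.norm_exp]; simp
  have hEc : Continuous fun w : ℍ => Complex.exp (2 * Real.pi * Complex.I * e w) := Complex.continuous_exp.comp (continuous_const.mul he.cont)
  have hET : ∀ w : ℍ, Complex.exp (2 * Real.pi * Complex.I * e (T • w)) = Complex.exp (2 * Real.pi * Complex.I * e w) := fun w => by
    rw [heT, mul_add, mul_one, Complex.exp_add, Complex.exp_two_pi_mul_I, mul_one]
  have hslit : ∀ a b : ℍ, (e a).im < (e b).im →
      1 - Complex.exp (2 * Real.pi * Complex.I * e b) / Complex.exp (2 * Real.pi * Complex.I * e a) ∈ Complex.slitPlane := by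
    intro a b h
    rw [sub_eq_add_neg]
    apply Complex.mem_slitPlane_of_norm_lt_one
    rw [norm_neg, norm_div, hEn, hEn, ← Real.exp_sub, Real.exp_lt_one_iff]
    have := Real.pi_pos
    nlinarith
  have himq : ∀ w w' : ℍ, q w = q w' → (e w).im = (e w').im := by
    intro w w' h
    obtain ⟨n, hn⟩ := hfib w w' h
    rw [hn]; simp
  have hΘw : ∀ w', Continuous fun w => Θ (w, w') := fun w' => hΘ.comp (continuous_id.prodMk continuous_const)
  by_cases hn0 : n = 0
  · refine ann_side hqc hqo hq1 hqT (s := fun w => - (e w).im) (Complex.continuous_im.comp he.cont).neg (fun w w' h => by rw [himq w w' h])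
      (fun w => ?_) (n := n + 1) (by omega) (fun w' => ?_)
    · obtain ⟨v, r, hr, hv⟩ := hlow w 1 one_ne_zero
      exact ⟨v, by simp only [hv]; linarith⟩
    · refine ⟨fun w => Θ (w, w') + 2 * Real.pi * Complex.I * e w +
        Complex.log (1 - Complex.exp (2 * Real.pi * Complex.I * e w') / Complex.exp (2 * Real.pi * Complex.I * e w)), ?_, ?_, ?_⟩
      · refine ((hΘw w').add (continuous_const.mul he.cont)).continuousOn.add (ContinuousOn.clog ?_ ?_)
        · exact (continuous_const.sub (continuous_const.div hEc (fun w => Complex.exp_ne_zero _))).continuousOn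
        · intro w hw
          exact hslit w w' (by simpa using hw)
      · intro w hw
        rw [Complex.exp_add, Complex.exp_add, Complex.exp_log (Complex.slitPlane_ne_zero (hslit w w' (by simpa using hw))), ← hΘe]
        have := Complex.exp_ne_zero (2 * Real.pi * Complex.I * e w)
        field_simp
      · intro w hw
        simp only [hET, hn]
        rw [heT]
        push_cast; ring
  · refine ann_side hqc hqo hq1 hqT (s := fun w => (e w).im) (Complex.continuous_im.comp he.cont) himq
      (fun w => ?_) hn0 (fun w' => ?_)
    · obtain ⟨v, r, hr, hv⟩ := hlow w (-1) (by norm_num)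
      exact ⟨v, by simp only [hv]; linarith⟩
    · refine ⟨fun w => Θ (w, w') + Complex.log (- Complex.exp (2 * Real.pi * Complex.I * e w')) +
        Complex.log (1 - Complex.exp (2 * Real.pi * Complex.I * e w) / Complex.exp (2 * Real.pi * Complex.I * e w')), ?_, ?_, ?_⟩
      · refine ((hΘw w').add continuous_const).continuousOn.add (ContinuousOn.clog ?_ ?_)
        · exact (continuous_const.sub (hEc.div_const _)).continuousOn
        · intro w hw
          exact hslit w' w hw
      · intro w hw
        have h0 := Complex.exp_ne_zero (2 * Real.pi * Complex.I * e w')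
        rw [Complex.exp_add, Complex.exp_add, Complex.exp_log (Complex.slitPlane_ne_zero (hslit w' w hw)), ← hΘe,
          Complex.exp_log (neg_ne_zero.2 h0)]
        field_simp
        ring
      · intro w hw
        simp only [hET, hn]
        ring


structure RR (g : ℂ ≃ₜ ℂ) (L : ℂ × ℂ → ℂ) (m : ℕ → ℕ) : Prop where
  log : IsLog (fun z : ℂ => z) g L
  mt : Tendsto m atTop atTop
  rc : CC (fun k => (g^[m k]))
  lc : ∀ x y, x ≠ y → Tendsto (fun k => LS g L (m k) (x, y)) atTop (𝓝 0)

lemma exists_iter_homeo {X : Type*} [TopologicalSpace X] (g : X ≃ₜ X) (n : ℕ) : ∃ h : X ≃ₜ X, ⇑h = g^[n] := by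
  induction n with
  | zero => exact ⟨Homeomorph.refl X, rfl⟩
  | succ n ih =>
    obtain ⟨h, hh⟩ := ih
    refine ⟨g.trans h, ?_⟩
    funext x
    simp [hh]

lemma iter_pi {π : ℍ → ℂ} {H : ℍ → ℍ} {h : ℂ → ℂ} (hH : ∀ w, π (H w) = h (π w)) (j : ℕ) (w : ℍ) : π (H^[j] w) = h^[j] (π w) := by
  induction j with
  | zero => rfl
  | succ j ih => rw [Function.iterate_succ_apply', hH, ih, Function.iterate_succ_apply']

lemma iter_fix {X : Type*} {h : X → X} {y : X} (hy : h y = y) (j : ℕ) : h^[j] y = y := Function.iterate_fixed hy j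

lemma iter_log {π : ℍ → ℂ} {H : ℍ → ℍ} {h : ℂ → ℂ} {y : ℂ} {l : ℍ → ℂ} {M : ℂ × ℂ → ℂ} (hH : ∀ w, π (H w) = h (π w)) (hy : h y = y)
    (hl : ∀ w, l (H w) = l w + M (π w, y)) (j : ℕ) (w : ℍ) : l (H^[j] w) = l w + LS h M j (π w, y) := by
  induction j with
  | zero => simp [LS]
  | succ j ih =>
    rw [Function.iterate_succ_apply', hl, ih, LS_succ, iter_pi hH, iter_fix hy, add_assoc]

lemma Cm.symm {a b : SL(2, ℝ)} (h : Cm a b) : Cm b a := fun u => (h u).symm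

lemma iter_comm {H : ℍ → ℍ} {γ : SL(2, ℝ)} (h : ∀ w, H (γ • w) = γ • H w) (j : ℕ) (w : ℍ) : H^[j] (γ • w) = γ • H^[j] w := by
  induction j with
  | zero => rfl
  | succ j ih => rw [Function.iterate_succ_apply', ih, h, Function.iterate_succ_apply']

lemma comp_inv {X : Set ℂ} {x0 : ℂ} (h : ℂ ≃ₜ ℂ) (hX : ∀ z, h z ∈ X ↔ z ∈ X) (hx0 : x0 ∉ X)
    (h0 : h x0 ∈ connectedComponentIn Xᶜ x0) (z : ℂ) :
    h z ∈ connectedComponentIn Xᶜ x0 ↔ z ∈ connectedComponentIn Xᶜ x0 := by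
  have hsub := connectedComponentIn_subset Xᶜ x0
  constructor
  · intro hz
    have h1 : IsPreconnected (h.symm '' connectedComponentIn Xᶜ x0) :=
      isPreconnected_connectedComponentIn.image _ h.symm.continuous.continuousOn
    refine h1.subset_connectedComponentIn (F := Xᶜ) ⟨h x0, h0, by simp⟩ ?_ ⟨h z, hz, by simp⟩
    rintro _ ⟨u, hu, rfl⟩ hu'
    apply hsub hu
    rw [← hX] at hu'; simpa using hu'
  · intro hz
    have h1 : IsPreconnected (h '' connectedComponentIn Xᶜ x0) :=
      isPreconnected_connectedComponentIn.image _ h.continuous.continuousOn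
    rw [connectedComponentIn_eq h0]
    refine h1.subset_connectedComponentIn (F := Xᶜ) ⟨x0, mem_connectedComponentIn hx0, rfl⟩ ?_ ⟨z, hz, rfl⟩
    rintro _ ⟨u, hu, rfl⟩ hu'
    exact hsub hu ((hX u).1 hu')

theorem step5 {g : ℂ ≃ₜ ℂ} {L : ℂ × ℂ → ℂ} {m : ℕ → ℕ} (hR : RR g L m)
    (hper : ∀ n, 1 ≤ n → ∀ x, g^[n] x = x → g x = x) (x0 : ℂ) : g x0 = x0 := by
  by_contra hx0
  set X : Set ℂ := {x | g x = x} with hX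
  have hXc : IsClosed X := isClosed_eq g.continuous continuous_id
  have hXo : IsOpen Xᶜ := hXc.isOpen_compl
  set U := connectedComponentIn Xᶜ x0 with hU
  have hx0' : x0 ∈ Xᶜ := hx0
  have hx0U : x0 ∈ U := mem_connectedComponentIn hx0'
  have hUo : IsOpen U := hXo.connectedComponentIn
  have hUc : IsConnected U := ⟨⟨x0, hx0U⟩, isPreconnected_connectedComponentIn⟩
  have hUX : ∀ z ∈ U, g z ≠ z := fun z hz => connectedComponentIn_subset _ _ hz
  have hfr : ∀ y ∈ closure U, y ∉ U → g y = y := by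
    intro y hy hyU
    by_contra hne
    have hyX : y ∈ Xᶜ := hne
    obtain ⟨z, hz1, hz2⟩ := _root_.mem_closure_iff.1 hy _ (hXo.connectedComponentIn (x := y)) (mem_connectedComponentIn hyX)
    have e1 := connectedComponentIn_eq hz1
    have e2 := connectedComponentIn_eq hz2
    apply hyU
    rw [hU, e2, ← e1]
    exact mem_connectedComponentIn hyX
  have hgX : ∀ z, g z ∈ X ↔ z ∈ X := fun z => ⟨fun h => g.injective h, fun h => congrArg g h⟩
  choose gp hgp using fun n => exists_iter_homeo g n
  have hgpX : ∀ n z, gp n z ∈ X ↔ z ∈ X := by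
    intro n z
    rw [hgp]
    induction n with
    | zero => rfl
    | succ n ih => rw [Function.iterate_succ_apply', hgX, ih]
  have hne : ∃ q π, Cov (psi '' U) q ∧ UCov U π ∧ ∀ w : ℍ, psi (π w) = q w := by
    first
    | exact exists_ucov hUo hUc.isPreconnected ⟨x0, hx0U⟩
    | exact exists_ucov hUo hUc ⟨x0, hx0U⟩
  obtain ⟨q, π, hq, hπ, hqπ⟩ := hne
  have hrc : CC (fun k => gp (m k)) := by
    have := hR.rc
    simpa only [hgp] using this
  have hUinv : ∀ᶠ k in atTop, ∀ z, gp (m k) z ∈ U ↔ z ∈ U := by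
    have h1 := (hrc.at (tendsto_const_nhds (x := x0))).eventually (hUo.mem_nhds hx0U)
    filter_upwards [h1] with k hk
    exact comp_inv (gp (m k)) (hgpX _) hx0 hk
  obtain ⟨H, hH, hcc⟩ := hπ.near hrc hUinv
  have hmpos : ∀ᶠ k in atTop, 1 ≤ m k := hR.mt.eventually (eventually_ge_atTop 1)
  -- deck transformations
  have hS : ∀ k0 l, (∀ w, π (H k0 w) = gp (m k0) (π w)) → (∀ w, π (H l w) = gp (m l) (π w)) →
      ∃ S ∈ DkG π, ∀ w, (H k0)^[m l] w = S • (H l)^[m k0] w := by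
    intro k0 l h0 h1
    have hpi : ∀ w, π ((H l)^[m k0] w) = π ((H k0)^[m l] w) := by
      intro w
      rw [iter_pi h0, iter_pi h1, hgp, hgp, ← Function.iterate_mul, ← Function.iterate_mul, mul_comm]
    obtain ⟨S, hS1, hS2⟩ := hπ.deck (hpi UpperHalfPlane.I)
    refine ⟨S, hS2, fun w => ?_⟩
    refine hπ.uniq (F := fun w => (H k0)^[m l] w) (G := fun w => S • (H l)^[m k0] w) ((H k0).continuous.iterate _)
      (((H l).continuous.iterate _).const_smul S) (fun w => ?_) (a0 := UpperHalfPlane.I) hS1.symm w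
    rw [hS2, hpi]
  have hSc : ∀ k0 l S γ, (∀ w, (H k0)^[m l] w = S • (H l)^[m k0] w) → (∀ w, H k0 (γ • w) = γ • H k0 w) →
      (∀ w, H l (γ • w) = γ • H l w) → Cm S γ := by
    intro k0 l S γ h h0 h1 u
    obtain ⟨v, hv⟩ := ((H l).surjective.iterate (m k0)) u
    have e1 := h (γ • v)
    rw [iter_comm h0, iter_comm h1, h v, hv] at e1
    exact e1.symm
  suffices hmain : ∀ᶠ k0 in atTop, ∀ᶠ l in atTop, ∀ S ∈ DkG π, (∀ w, (H k0)^[m l] w = S • (H l)^[m k0] w) → Triv S by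
    obtain ⟨k0, h1, h2, h3⟩ := (hmain.and (hH.and hmpos)).exists
    have hOP : OP (fun w : ℍ => (w : ℂ)) (H k0) := by
      have hl : OP (fun z : ℂ => z) (gp (m k0)) := by
        rw [hgp]; exact ⟨_, hR.log.iterate g.continuous g.injective _⟩
      exact hπ.lift_OP hl (gp (m k0)).continuous (gp (m k0)).injective h2
    have hff : ∀ x, H k0 x ≠ x := by
      intro x hx
      have := h2 x
      rw [hx, hgp] at this
      exact hUX _ (hπ.maps x) (hper _ h3 _ this.symm)
    obtain ⟨V, hV, hVk⟩ := brouwerH hOP hff UpperHalfPlane.I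
    have ht := (hcc.iter (m k0) UpperHalfPlane.I).eventually hV
    obtain ⟨l, h4, h5, h6, h7⟩ := (h1.and (hH.and (hmpos.and ht))).exists
    obtain ⟨S, hS1, hS2⟩ := hS k0 l h2 h5
    refine hVk (m l) h6 ?_
    rw [hS2, h4 S hS1 hS2]
    exact h7
  by_cases hcomm : ∃ T1 ∈ DkG π, ∃ T2 ∈ DkG π, ¬ Cm T1 T2
  · obtain ⟨T1, hT1, T2, hT2, hc⟩ := hcomm
    have c1 := hπ.near_comm hH hcc hT1
    have c2 := hπ.near_comm hH hcc hT2
    filter_upwards [c1, c2] with k0 a1 a2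
    filter_upwards [c1, c2] with l b1 b2 S hS1 hS2
    by_contra hnt
    exact hc (cm_trans (hπ.disc.nofix hS1 hnt) (hSc k0 l S T1 hS2 a1 b1).symm (hSc k0 l S T2 hS2 a2 b2).symm)
  push Not at hcomm
  by_cases htr : ∀ γ ∈ DkG π, Triv γ
  · exact Eventually.of_forall fun k0 => Eventually.of_forall fun l S hS1 _ => htr S hS1
  push Not at htr
  obtain ⟨T0, hT0, hT0n⟩ := htr
  obtain ⟨e, T, hT, he, heT, heΓ⟩ := exists_gen hπ.disc hT0 hT0n (fun T hT => hcomm T hT T0 hT0)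
  obtain ⟨y, hyU, hycl, hy⟩ := annulus hq hπ hqπ he hT heT heΓ
  have hTn : ¬ Triv T := by
    intro h
    have := heT UpperHalfPlane.I
    rw [h] at this
    simp at this
  obtain ⟨l, hl, hle⟩ := hπ.exists_log hyU
  have hgy := hfr y hycl hyU
  have hgpy : ∀ n, g^[n] y = y := fun n => iter_fix hgy n
  obtain ⟨t, ht⟩ := UCov.exists_chi hl hle hT
  have ht0 : t ≠ 0 := by rintro rfl; exact hy l hl hle ht
  have hH' : ∀ᶠ k in atTop, ∀ w, π (H k w) = g^[m k] (π w) := by simpa only [hgp] using hH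
  have hnl := hπ.near_log hyU hl hle (g := fun k => g^[m k]) (M := fun k => LS g L (m k))
    (fun k => hR.log.iterate g.continuous g.injective _) (Eventually.of_forall fun k => hgpy _) hH' hcc (fun x hx => hR.lc x y hx)
  filter_upwards [hnl, hH'] with k0 a1 a2
  filter_upwards [hnl, hH'] with k b1 b2 S hS1 hS2
  have hchi : Chi l S 0 := by
    intro u
    obtain ⟨v, hv⟩ := ((H k).surjective.iterate (m k0)) u
    have e1 := congrArg l (hS2 v)
    rw [iter_log a2 (hgpy _) a1, hv, ← LS_mul] at e1
    have e2 := iter_log b2 (hgpy _) b1 (m k0) v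
    rw [hv, ← LS_mul, mul_comm] at e2
    rw [← e1, e2]; simp
  obtain ⟨k', j, hk', hkj, hj⟩ := lemC_chi hπ.disc hT hS1 hTn (hcomm S hS1 T hT)
  apply hj
  have := hkj l 0 t hchi ht
  rw [mul_zero] at this
  exact (mul_eq_zero.1 this.symm).resolve_right ht0


lemma smul_log (A : SL(2, ℝ)) : OP (fun w : ℍ => (w : ℂ)) (fun w => A • w) := by
  have hd : (A 0 0 : ℂ) * A 1 1 - A 0 1 * A 1 0 = 1 := by exact_mod_cast sl_det A
  obtain ⟨l, hl, hle⟩ := exists_clog (fun w : ℍ => (A 1 0 : ℂ) * w + A 1 1) (by fun_prop) (fun w => sl_den A w.2)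
  refine ⟨fun p => - (l p.1 + l p.2), ?_, fun x y hxy => ?_⟩
  · exact ((hl.comp continuous_fst).add (hl.comp continuous_snd)).neg.continuousOn
  · have h1 := sl_den A x.2
    have h2 := sl_den A y.2
    change (A 1 0 : ℂ) * (x : ℂ) + A 1 1 ≠ 0 at h1
    change (A 1 0 : ℂ) * (y : ℂ) + A 1 1 ≠ 0 at h2
    simp only
    rw [sl_coe, sl_coe, Complex.exp_neg, Complex.exp_add, hle, hle, div_sub_div _ _ h1 h2, inv_mul_eq_div]
    congr 1
    linear_combination (-(x - y : ℂ)) * hd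

lemma conj_OP {G' : ℍ ≃ₜ ℍ} (h : OP (fun w : ℍ => (w : ℂ)) G') (A : SL(2, ℝ)) : OP (fun w : ℍ => (w : ℂ)) (fun w => A • G' (A⁻¹ • w)) := by
  obtain ⟨L, hL⟩ := h
  obtain ⟨M, hM⟩ := smul_log A
  obtain ⟨M', hM'⟩ := smul_log A⁻¹
  have h1 := hL.comp hM' (continuous_const_smul _) (MulAction.injective _)
  have h2 := hM.comp h1 (G'.continuous.comp (continuous_const_smul _)) (G'.injective.comp (MulAction.injective _))
  exact ⟨_, h2⟩

lemma bdd_periodic {f : ℝ → ℂ} (hf : Continuous f) (hp : ∀ t, f (t + 1) = f t) : ∃ C, ∀ t, ‖f t‖ ≤ C := by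
  have h1 : Function.Periodic f 1 := hp
  have := h1.isBounded_of_continuous one_ne_zero hf
  obtain ⟨C, hC⟩ := this.exists_norm_le
  exact ⟨C, fun t => hC _ ⟨t, rfl⟩⟩

lemma ray_inf {N : SL(2, ℝ)} (hN : Nf N) {Y : ℝ → ℍ} (hY : Continuous Y) (h : ∀ t, Y (t + 1) = N • Y t) :
    Tendsto (fun t => ‖(Y t : ℂ)‖) atTop atTop := by
  rcases hN with ⟨b, hb, hN⟩ | ⟨c, hc, hN⟩
  · obtain ⟨C, hC⟩ := bdd_periodic (f := fun t => (Y t : ℂ) - b * t) (by fun_prop) (fun t => by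
      rw [h, hN]; push_cast; ring)
    have h1 : Tendsto (fun t : ℝ => |b| * t - C) atTop atTop :=
      tendsto_atTop_add_const_right _ _ (tendsto_id.const_mul_atTop (abs_pos.2 hb))
    refine tendsto_atTop_mono' _ ?_ h1
    filter_upwards [eventually_ge_atTop 0] with t ht
    have h2 := norm_sub_norm_le ((b : ℂ) * t) (Y t : ℂ)
    have h3 := hC t
    rw [norm_sub_rev] at h3
    have h4 : ‖(b : ℂ) * t‖ = |b| * t := by simp [abs_of_nonneg ht]
    linarith
  · have hlc := Real.log_pos hc
    have hpos : ∀ t, 0 < ‖(Y t : ℂ)‖ := fun t => norm_pos_iff.2 (Y t).ne_zero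
    obtain ⟨C, hC⟩ := bdd_periodic (f := fun t => ((Real.log ‖(Y t : ℂ)‖ - t * Real.log c : ℝ) : ℂ)) (by
        apply Complex.continuous_ofReal.comp
        refine Continuous.sub (Continuous.log (by fun_prop) (fun t => (hpos t).ne')) (by fun_prop)) (fun t => by
      rw [h, hN, norm_mul, Complex.norm_real, Real.norm_of_nonneg (by linarith), Real.log_mul (by linarith) (hpos t).ne']
      congr 1; ring)
    have h1 : Tendsto (fun t : ℝ => t * Real.log c - C) atTop atTop :=
      tendsto_atTop_add_const_right _ _ (tendsto_id.atTop_mul_const hlc)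
    have h2 : Tendsto (fun t => Real.log ‖(Y t : ℂ)‖) atTop atTop := by
      refine tendsto_atTop_mono (fun t => ?_) h1
      have := hC t
      rw [Complex.norm_real, Real.norm_eq_abs] at this
      have := (abs_le.1 this).1
      linarith
    have h3 := Real.tendsto_exp_atTop.comp h2
    refine h3.congr fun t => ?_
    simp [Real.exp_log (hpos t)]

lemma ray_lim {S B : SL(2, ℝ)} (hN : Nf (B * S * B⁻¹)) (hB : B⁻¹ 1 0 ≠ 0) {X : ℝ → ℍ} (hX : Continuous X) (h : ∀ t, X (t + 1) = S • X t) :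
    Tendsto (fun t => (X t : ℂ)) atTop (𝓝 ((B⁻¹ 0 0 / B⁻¹ 1 0 : ℝ) : ℂ)) := by
  have h1 := ray_inf hN (Y := fun t => B • X t) (hX.const_smul B) (fun t => by
    rw [h]; simp [mul_smul])
  set D := B⁻¹ with hD
  have hd : (D 0 0 : ℂ) * D 1 1 - D 0 1 * D 1 0 = 1 := by exact_mod_cast sl_det D
  have hC : (D 1 0 : ℂ) ≠ 0 := by exact_mod_cast hB
  have e : ∀ t, (X t : ℂ) = (D 0 0 / D 1 0 : ℝ) - (D 1 0 : ℂ)⁻¹ * ((D 1 0 : ℂ) * ((B • X t : ℍ) : ℂ) + D 1 1)⁻¹ := by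
    intro t
    have h2 : X t = D • (B • X t) := by rw [hD, inv_smul_smul]
    have h3 := sl_den D (B • X t).2
    change (D 1 0 : ℂ) * ((B • X t : ℍ) : ℂ) + D 1 1 ≠ 0 at h3
    conv_lhs => rw [h2, sl_coe]
    push_cast
    rw [← mul_inv, div_eq_iff h3, sub_mul, mul_inv, mul_assoc, inv_mul_cancel₀ h3]
    rw [div_mul_eq_mul_div, mul_one, ← one_div, ← sub_div, eq_div_iff hC]
    linear_combination -hd
  have h4 : Tendsto (fun t => ((D 1 0 : ℂ) * ((B • X t : ℍ) : ℂ) + D 1 1)⁻¹) atTop (𝓝 0) := by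
    apply tendsto_inv₀_cobounded.comp
    rw [← tendsto_norm_atTop_iff_cobounded]
    have h5 : Tendsto (fun t => ‖(D 1 0 : ℂ)‖ * ‖((B • X t : ℍ) : ℂ)‖ - ‖(D 1 1 : ℂ)‖) atTop atTop :=
      tendsto_atTop_add_const_right _ _ (h1.const_mul_atTop (norm_pos_iff.2 hC))
    refine tendsto_atTop_mono (fun t => ?_) h5
    rw [← norm_mul]
    have := norm_sub_norm_le ((D 1 0 : ℂ) * ((B • X t : ℍ) : ℂ)) (-(D 1 1 : ℂ))
    rwa [norm_neg, sub_neg_eq_add] at this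
  have h6 := (h4.const_mul (D 1 0 : ℂ)⁻¹).const_sub ((D 0 0 / D 1 0 : ℝ) : ℂ)
  rw [mul_zero, sub_zero] at h6
  exact h6.congr fun t => (e t).symm

lemma Aff.mul {a b : SL(2, ℝ)} (ha : Aff a) (hb : Aff b) : Aff (a * b) := by
  obtain ⟨α, β, h1, h2⟩ := ha
  obtain ⟨α', β', h1', h2'⟩ := hb
  refine ⟨α * α', α * β' + β, by positivity, fun w => ?_⟩
  rw [mul_smul, h2, h2']; push_cast; ring

lemma Aff.inv {a : SL(2, ℝ)} (ha : Aff a) : Aff a⁻¹ := by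
  obtain ⟨α, β, h1, h2⟩ := ha
  have hα : (α : ℂ) ≠ 0 := by exact_mod_cast h1.ne'
  refine ⟨α⁻¹, - (α⁻¹ * β), inv_pos.2 h1, fun w => ?_⟩
  have := h2 (a⁻¹ • w)
  rw [smul_inv_smul] at this
  rw [this]; push_cast; field_simp; ring

lemma Nf.aff {a : SL(2, ℝ)} (ha : Nf a) : Aff a := by
  rcases ha with ⟨b, hb, h⟩ | ⟨c, hc, h⟩
  · exact ⟨1, b, one_pos, fun w => by rw [h]; simp⟩
  · exact ⟨c, 0, by linarith, fun w => by rw [h]; simp⟩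

lemma same_end {B B' S' : SL(2, ℝ)} (h' : Nf (B' * S' * B'⁻¹)) (hB : B⁻¹ 1 0 ≠ 0) (hB' : B'⁻¹ 1 0 ≠ 0)
    (he : B⁻¹ 0 0 / B⁻¹ 1 0 = B'⁻¹ 0 0 / B'⁻¹ 1 0) : Aff (B * S' * B⁻¹) := by
  obtain ⟨b1, b2, b3, b4⟩ := sl_inv B
  have h0 : (B * B'⁻¹) 1 0 = 0 := by
    rw [sl_mul]
    rw [div_eq_div_iff hB hB', b1, b3] at he
    linarith
  have h1 := aff_of_zero h0
  have := (h1.mul h'.aff).mul h1.inv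
  convert this using 1
  group

lemma not_aff {B S : SL(2, ℝ)} (h : Nf (B * S * B⁻¹)) (hS : ¬ Aff S) : B⁻¹ 1 0 ≠ 0 := by
  intro h0
  apply hS
  have h1 := aff_of_zero h0
  have := (h1.mul h.aff).mul h1.inv
  convert this using 1
  group

/-- comparing the logarithm of a homeomorphism of the half plane with principal logarithms -/
lemma ord_reg {G : ℍ → ℍ} (hGc : Continuous G) {L : ℍ × ℍ → ℂ} (hL : IsLog (fun w : ℍ => (w : ℂ)) G L) {p : ℍ} {n : ℤ}
    {r : ℝ → ℍ} (hr : Continuous r) {a a' : ℝ} (ha : Tendsto (fun t => (r t : ℂ)) atTop (𝓝 a)) (ha' : Tendsto (fun t => (G (r t) : ℂ)) atTop (𝓝 a'))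
    (hp : ∀ᶠ t in atTop, (p : ℂ) - r t ∈ Complex.slitPlane ∧ L (p, r t) = Complex.log (G p - G (r t)) - Complex.log (p - r t) + n * (2 * Real.pi * Complex.I))
    (x : ℍ) : ∀ᶠ t in atTop, 0 < ((x : ℂ) - r t).im ∧ 0 < ((G x : ℂ) - G (r t)).im ∧
      L (x, r t) = Complex.log (G x - G (r t)) - Complex.log (x - r t) + n * (2 * Real.pi * Complex.I) := by
  obtain ⟨γ⟩ := PathConnectedSpace.joined p x
  have hCc : IsCompact (Set.range γ) := isCompact_range γ.continuous
  have hmin : ∀ f : ℍ → ℝ, Continuous f → (∀ w, 0 < f w) → ∃ δ > 0, ∀ c ∈ Set.range γ, δ ≤ f c := by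
    intro f hf hf0
    obtain ⟨c0, hc0, hm⟩ := hCc.exists_isMinOn ⟨_, Set.mem_range_self 0⟩ hf.continuousOn
    exact ⟨f c0, hf0 c0, fun c hc => hm hc⟩
  obtain ⟨δ, hδ, h1⟩ := hmin (fun w => w.im) UpperHalfPlane.continuous_im (fun w => w.2)
  obtain ⟨δ', hδ', h2⟩ := hmin (fun w => (G w).im) (UpperHalfPlane.continuous_im.comp hGc) (fun w => (G w).2)
  have i1 : ∀ᶠ t in atTop, (r t).im < δ := by
    have := (Complex.continuous_im.tendsto _).comp ha
    simp only [Complex.ofReal_im] at this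
    exact this.eventually (eventually_lt_nhds hδ)
  have i2 : ∀ᶠ t in atTop, (G (r t)).im < δ' := by
    have := (Complex.continuous_im.tendsto _).comp ha'
    simp only [Complex.ofReal_im] at this
    exact this.eventually (eventually_lt_nhds hδ')
  filter_upwards [i1, i2, hp] with t j1 j2 hpt
  have k1 : ∀ c ∈ Set.range γ, 0 < ((c : ℂ) - r t).im := fun c hc => by
    have := h1 c hc
    show 0 < c.im - (r t).im
    linarith
  have k2 : ∀ c ∈ Set.range γ, 0 < ((G c : ℂ) - G (r t)).im := fun c hc => by
    have := h2 c hc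
    show 0 < (G c).im - (G (r t)).im
    linarith
  have m1 : p ∈ Set.range γ := ⟨0, by simp⟩
  have m2 : x ∈ Set.range γ := ⟨1, by simp⟩
  refine ⟨k1 x m2, k2 x m2, ?_⟩
  have hne : ∀ c ∈ Set.range γ, c ≠ r t := by
    rintro c hc rfl
    have := k1 _ hc
    simp at this
  obtain ⟨n', hn'⟩ := clog_diff_const (s := Set.range γ) (isPreconnected_range γ.continuous) (fun c => L (c, r t))
    (fun c => Complex.log (G c - G (r t)) - Complex.log (c - r t))
    (hL.1.comp (continuous_id.prodMk continuous_const).continuousOn (fun c hc => hne c hc))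
    (ContinuousOn.sub (ContinuousOn.clog (by fun_prop) (fun c hc => Or.inr (k2 c hc).ne'))
      (ContinuousOn.clog (by fun_prop) (fun c hc => Or.inr (k1 c hc).ne'))) (fun c hc => by
        have z1 : (c : ℂ) - r t ≠ 0 := fun h => by have := k1 c hc; rw [h] at this; simp at this
        have z2 : (G c : ℂ) - G (r t) ≠ 0 := fun h => by have := k2 c hc; rw [h] at this; simp at this
        rw [Complex.exp_sub, Complex.exp_log z1, Complex.exp_log z2, eq_div_iff z1]
        exact hL.2 _ _ (hne c hc))
  have e1 := hn' p m1
  have e2 := hn' x m2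
  rw [hpt.2] at e1
  have : n = n' := int_two_pi_inj (by linear_combination e1)
  rw [e2, this]

lemma ord {G : ℍ → ℍ} (hGc : Continuous G) (hGi : Function.Injective G) {L : ℍ × ℍ → ℂ} (hL : IsLog (fun w : ℍ => (w : ℂ)) G L)
    (hp : ∀ C : ℝ, ∃ p : ℍ, ∀ z : ℂ, ‖z‖ ≤ C → (p : ℂ) - z ∈ Complex.slitPlane ∧ (G p : ℂ) - z ∈ Complex.slitPlane)
    {r ρ : ℝ → ℍ} (hr : Continuous r) (hρ : Continuous ρ) {a b a' b' : ℝ}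
    (ha : Tendsto (fun t => (r t : ℂ)) atTop (𝓝 a)) (hb : Tendsto (fun t => (ρ t : ℂ)) atTop (𝓝 b))
    (ha' : Tendsto (fun t => (G (r t) : ℂ)) atTop (𝓝 a')) (hb' : Tendsto (fun t => (G (ρ t) : ℂ)) atTop (𝓝 b'))
    (hab : a < b) (hab' : a' ≠ b') : a' < b' := by
  by_contra hcon
  have hlt : b' < a' := lt_of_le_of_ne (not_lt.1 hcon) hab'.symm
  have hnear : ∀ {f : ℝ → ℍ} {c : ℝ}, Tendsto (fun t => (f t : ℂ)) atTop (𝓝 c) → ∀ ε > 0, ∀ᶠ t in atTop, ‖(f t : ℂ) - c‖ < ε := by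
    intro f c hf ε hε
    have := Metric.tendsto_nhds.1 hf ε hε
    simpa only [dist_eq_norm] using this
  set ε := min 1 (min ((b - a) / 2) ((a' - b') / 2)) with hε
  have hε0 : 0 < ε := lt_min one_pos (lt_min (by linarith) (by linarith))
  have e1 : ε ≤ 1 := min_le_left _ _
  have e2 : ε ≤ (b - a) / 2 := (min_le_right _ _).trans (min_le_left _ _)
  have e3 : ε ≤ (a' - b') / 2 := (min_le_right _ _).trans (min_le_right _ _)
  have hq : Tendsto (fun q : ℝ × ℝ => ((G (r q.1) : ℂ) - G (ρ q.2)) / ((r q.1 : ℂ) - ρ q.2)) (atTop ×ˢ atTop) (𝓝 (((a' : ℂ) - b') / (a - b))) := by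
    refine ((ha'.comp tendsto_fst).sub (hb'.comp tendsto_snd)).div ((ha.comp tendsto_fst).sub (hb.comp tendsto_snd)) ?_
    have : a - b ≠ 0 := by intro h; linarith
    exact_mod_cast this
  have hq' : ∀ᶠ q : ℝ × ℝ in atTop ×ˢ atTop, (((G (r q.1) : ℂ) - G (ρ q.2)) / ((r q.1 : ℂ) - ρ q.2)).re < 0 := by
    have h1 := (Complex.continuous_re.tendsto _).comp hq
    refine h1.eventually (eventually_lt_nhds ?_)
    have : ((a' : ℂ) - b') / (a - b) = (((a' - b') / (a - b) : ℝ) : ℂ) := by push_cast; rfl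
    rw [this, Complex.ofReal_re]
    exact div_neg_of_pos_of_neg (by linarith) (by linarith)
  obtain ⟨M0, hM0⟩ := Filter.eventually_atTop.1 (by rw [← prod_atTop_atTop_eq]; exact hq' : ∀ᶠ q : ℝ × ℝ in atTop, _)
  obtain ⟨M1, hM1⟩ := Filter.eventually_atTop.1 ((hnear ha ε hε0).and ((hnear hb ε hε0).and ((hnear (f := fun t => G (r t)) ha' ε hε0).and (hnear (f := fun t => G (ρ t)) hb' ε hε0))))
  set M := max (max M0.1 M0.2) M1
  have hMq : ∀ s t, M ≤ s → M ≤ t → (((G (r s) : ℂ) - G (ρ t)) / ((r s : ℂ) - ρ t)).re < 0 := fun s t hs ht =>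
    hM0 (s, t) ⟨((le_max_left _ _).trans (le_max_left _ _)).trans hs, ((le_max_right _ _).trans (le_max_left _ _)).trans ht⟩
  have hMn : ∀ t, M ≤ t → _ := fun t ht => hM1 t ((le_max_right _ _).trans ht)
  have re1 : ∀ s t, M ≤ s → M ≤ t → ((r s : ℂ) - ρ t).re < 0 := by
    intro s t hs ht
    have h1 := (Complex.abs_re_le_norm _).trans_lt (hMn s hs).1
    have h2 := (Complex.abs_re_le_norm _).trans_lt (hMn t ht).2.1
    rw [Complex.sub_re, Complex.ofReal_re] at h1 h2
    rw [Complex.sub_re]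
    have := (abs_lt.1 h1).2
    have := (abs_lt.1 h2).1
    linarith
  have re2 : ∀ s t, M ≤ s → M ≤ t → 0 < ((G (r s) : ℂ) - G (ρ t)).re := by
    intro s t hs ht
    have h1 := (Complex.abs_re_le_norm _).trans_lt (hMn s hs).2.2.1
    have h2 := (Complex.abs_re_le_norm _).trans_lt (hMn t ht).2.2.2
    rw [Complex.sub_re, Complex.ofReal_re] at h1 h2
    rw [Complex.sub_re]
    have := (abs_lt.1 h1).1
    have := (abs_lt.1 h2).2
    linarith
  -- the connected set
  obtain ⟨γ⟩ := PathConnectedSpace.joined (r M) (ρ M)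
  set D : Set ℍ := (r '' Set.Ici M ∪ Set.range γ) ∪ ρ '' Set.Ici M with hD
  have hDc : IsPreconnected D := by
    refine IsPreconnected.union (ρ M) (Or.inr ⟨1, by simp⟩) ⟨M, Set.self_mem_Ici, rfl⟩ ?_ (isPreconnected_Ici.image _ hρ.continuousOn)
    exact IsPreconnected.union (r M) ⟨M, Set.self_mem_Ici, rfl⟩ ⟨0, by simp⟩ (isPreconnected_Ici.image _ hr.continuousOn)
      (isPreconnected_range γ.continuous)
  have hbd : ∃ C : ℝ, ∀ y ∈ D, ‖(y : ℂ)‖ ≤ C ∧ ‖(G y : ℂ)‖ ≤ C := by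
    obtain ⟨C1, hC1⟩ := (isCompact_range γ.continuous).bddAbove_image (f := fun y : ℍ => ‖(y : ℂ)‖) (by fun_prop)
    obtain ⟨C2, hC2⟩ := (isCompact_range γ.continuous).bddAbove_image (f := fun y : ℍ => ‖(G y : ℂ)‖) (by fun_prop)
    have tri : ∀ (z : ℂ) (c : ℝ), ‖z - c‖ < ε → ‖z‖ ≤ 1 + |c| := by
      intro z c h
      have := norm_add_le (z - c) (c : ℂ)
      rw [sub_add_cancel, Complex.norm_real, Real.norm_eq_abs] at this
      linarith
    refine ⟨1 + |a| + |b| + |a'| + |b'| + |C1| + |C2|, ?_⟩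
    have n1 := abs_nonneg a
    have n2 := abs_nonneg b
    have n3 := abs_nonneg a'
    have n4 := abs_nonneg b'
    have n5 := abs_nonneg C1
    have n6 := abs_nonneg C2
    rintro y ((⟨t, ht, rfl⟩ | hy) | ⟨t, ht, rfl⟩)
    · have h1 := tri _ _ (hMn t ht).1
      have h2 := tri _ _ (hMn t ht).2.2.1
      constructor <;> linarith
    · have h1 : ‖(y : ℂ)‖ ≤ C1 := hC1 ⟨y, hy, rfl⟩
      have h2 : ‖(G y : ℂ)‖ ≤ C2 := hC2 ⟨y, hy, rfl⟩
      have := le_abs_self C1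
      have := le_abs_self C2
      constructor <;> linarith
    · have h1 := tri _ _ (hMn t ht).2.1
      have h2 := tri _ _ (hMn t ht).2.2.2
      constructor <;> linarith
  obtain ⟨C, hC⟩ := hbd
  obtain ⟨p, hpC⟩ := hp C
  have s1 : ∀ y ∈ D, (p : ℂ) - y ∈ Complex.slitPlane := fun y hy => (hpC _ (hC y hy).1).1
  have s2 : ∀ y ∈ D, (G p : ℂ) - G y ∈ Complex.slitPlane := fun y hy => (hpC _ (hC y hy).2).2
  have hne : ∀ y ∈ D, p ≠ y := by
    rintro y hy rfl
    have := s1 _ hy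
    simp at this
  obtain ⟨n, hn⟩ := clog_diff_const hDc (fun y => L (p, y))
    (fun y => Complex.log (G p - G y) - Complex.log (p - y))
    (hL.1.comp (continuous_const.prodMk continuous_id).continuousOn (fun c hc => hne c hc))
    (ContinuousOn.sub (ContinuousOn.clog (by fun_prop) s2)
      (ContinuousOn.clog (by fun_prop) s1)) (fun c hc => by
        have z1 := Complex.slitPlane_ne_zero (s1 c hc)
        have z2 := Complex.slitPlane_ne_zero (s2 c hc)
        rw [Complex.exp_sub, Complex.exp_log z1, Complex.exp_log z2, eq_div_iff z1]
        exact hL.2 _ _ (hne c hc))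
  have g1 := ord_reg hGc hL hr ha ha' (p := p) (n := n) (by
    filter_upwards [eventually_ge_atTop M] with t ht
    have : r t ∈ D := Or.inl (Or.inl ⟨t, ht, rfl⟩)
    exact ⟨s1 _ this, hn _ this⟩) (ρ M)
  have g2 := ord_reg hGc hL hρ hb hb' (p := p) (n := n) (by
    filter_upwards [eventually_ge_atTop M] with t ht
    have : ρ t ∈ D := Or.inr ⟨t, ht, rfl⟩
    exact ⟨s1 _ this, hn _ this⟩) (r M)
  obtain ⟨s, hs, i1, i2, i3⟩ := ((eventually_ge_atTop M).and g1).exists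
  obtain ⟨t, ht, j1, j2, j3⟩ := ((eventually_ge_atTop M).and g2).exists
  have hne2 : ∀ s t, M ≤ s → M ≤ t → r s ≠ ρ t := by
    intro s t hs ht h
    have := re1 s t hs ht
    rw [h] at this; simp at this
  rw [hL.symm eH (fun _ _ h => UpperHalfPlane.ext h) (hne2 s M hs le_rfl).symm] at i3
  have k1 := re1 s M hs le_rfl
  have k2 := re2 s M hs le_rfl
  have l1 := re1 M t le_rfl ht
  have l2 := re2 M t le_rfl ht
  -- imaginary parts
  have I1 : 2 * Real.pi * n < (L (r s, ρ M)).im := by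
    rw [i3]
    have a1 : Real.pi / 2 < ((G (ρ M) : ℂ) - G (r s)).arg := by
      rw [← not_le, Complex.arg_le_pi_div_two_iff]
      push Not
      refine ⟨?_, i2.le⟩
      simp only [Complex.sub_re] at k2 ⊢; linarith
    have a2 : ((ρ M : ℂ) - r s).arg ≤ Real.pi / 2 := by
      rw [Complex.arg_le_pi_div_two_iff]
      left
      simp only [Complex.sub_re] at k1 ⊢; linarith
    simp [Complex.log_im]
    linarith
  have I2 : (L (r M, ρ t)).im < 2 * Real.pi * n := by
    rw [j3]
    have a1 : Real.pi / 2 < ((r M : ℂ) - ρ t).arg := by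
      rw [← not_le, Complex.arg_le_pi_div_two_iff]
      push Not
      exact ⟨l1, j1.le⟩
    have a2 : ((G (r M) : ℂ) - G (ρ t)).arg ≤ Real.pi / 2 := by
      rw [Complex.arg_le_pi_div_two_iff]
      exact Or.inl l2.le
    simp [Complex.log_im]
    linarith
  have hQ : IsPreconnected (Set.Ici M ×ˢ Set.Ici M) := isPreconnected_Ici.prod isPreconnected_Ici
  have hcont : ContinuousOn (fun q : ℝ × ℝ => (L (r q.1, ρ q.2)).im) (Set.Ici M ×ˢ Set.Ici M) := by
    refine Complex.continuous_im.comp_continuousOn (hL.1.comp (by fun_prop) ?_)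
    rintro ⟨s, t⟩ ⟨hs, ht⟩
    exact hne2 s t hs ht
  obtain ⟨⟨u, v⟩, ⟨hu, hv⟩, huv⟩ := hQ.intermediate_value (a := (M, t)) (b := (s, M)) ⟨Set.self_mem_Ici, ht⟩ ⟨hs, Set.self_mem_Ici⟩ hcont ⟨I2.le, I1.le⟩
  change (L (r u, ρ v)).im = _ at huv
  have hx := hL.2 _ _ (hne2 u v hu hv)
  have hy := hMq u v hu hv
  have hz : (r u : ℂ) - ρ v ≠ 0 := fun h => by have := re1 u v hu hv; rw [h] at this; simp at this
  rw [← hx, mul_div_cancel_right₀ _ hz, Complex.exp_re, huv] at hy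
  rw [show 2 * Real.pi * (n : ℝ) = n * (2 * Real.pi) by ring, Real.cos_int_mul_two_pi, mul_one] at hy
  exact absurd (Real.exp_pos _) (not_lt.2 hy.le)


lemma conj_deck {U : Set ℂ} {π : ℍ → ℂ} (h : UCov U π) {g : ℂ → ℂ} {G' : ℍ ≃ₜ ℍ} (hG : ∀ w, π (G' w) = g (π w)) {S : SL(2, ℝ)}
    (hS : S ∈ DkG π) : ∃ S' ∈ DkG π, ∀ w, G' (S • w) = S' • G' w := by
  have hS1 : Dk π S := hS
  have e : ∀ w, π (G' (S • w)) = π (G' w) := fun w => by rw [hG, hG, hS1]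
  obtain ⟨S', h1, h2⟩ := h.deck (e UpperHalfPlane.I).symm
  refine ⟨S', h2, fun w => ?_⟩
  exact h.uniq (F := fun w => G' (S • w)) (G := fun w => S' • G' w) (G'.continuous.comp (continuous_const_smul _))
    (G'.continuous.const_smul S') (fun w => by rw [e, h2]) (a0 := UpperHalfPlane.I) h1.symm w

lemma Chi.eq {l : ℍ → ℂ} {γ : SL(2, ℝ)} {n n' : ℤ} (h : Chi l γ n) (h' : Chi l γ n') : n = n' := by
  have h1 := h UpperHalfPlane.I
  have h2 := h' UpperHalfPlane.I
  exact int_two_pi_inj (by linear_combination h2 - h1)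

lemma far_pt {N : SL(2, ℝ)} (hN : Nf N) {G : ℍ → ℍ} (hc : ∀ w, G (N • w) = N • G w) (C : ℝ) :
    ∃ p : ℍ, ∀ z : ℂ, ‖z‖ ≤ C → (p : ℂ) - z ∈ Complex.slitPlane ∧ (G p : ℂ) - z ∈ Complex.slitPlane := by
  have hc' : ∀ w, G (N⁻¹ • w) = N⁻¹ • G w := fun w => by
    rw [eq_inv_smul_iff, ← hc, smul_inv_smul]
  have key : ∀ P : SL(2, ℝ), (∀ w, G (P • w) = P • G w) → (∃ b : ℝ, 0 < b ∧ ∀ w : ℍ, ((P • w : ℍ) : ℂ) = w + b) →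
      ∃ p : ℍ, ∀ z : ℂ, ‖z‖ ≤ C → (p : ℂ) - z ∈ Complex.slitPlane ∧ (G p : ℂ) - z ∈ Complex.slitPlane := by
    rintro P hP ⟨b, hb, h⟩
    have hk : ∀ (k : ℕ) (w : ℍ), (((fun w : ℍ => P • w)^[k] w : ℍ) : ℂ) = w + k * b := by
      intro k w
      induction k with
      | zero => simp
      | succ k ih => rw [Function.iterate_succ_apply']; show ((P • _ : ℍ) : ℂ) = _; rw [h, ih]; push_cast; ring
    have hG : ∀ (k : ℕ) (w : ℍ), G ((fun w : ℍ => P • w)^[k] w) = (fun w : ℍ => P • w)^[k] (G w) := by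
      intro k w
      induction k with
      | zero => rfl
      | succ k ih => rw [Function.iterate_succ_apply', Function.iterate_succ_apply', ← ih]; exact hP _
    obtain ⟨k, hk1⟩ := exists_nat_gt ((C + |(UpperHalfPlane.I : ℂ).re| + |(G UpperHalfPlane.I : ℂ).re|) / b)
    rw [div_lt_iff₀ hb] at hk1
    refine ⟨(fun w : ℍ => P • w)^[k] UpperHalfPlane.I, fun z hz => ?_⟩
    rw [hG, hk, hk]
    have h1 := (le_abs_self _).trans (Complex.abs_re_le_norm z)
    have h2 := neg_abs_le (UpperHalfPlane.I : ℂ).re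
    have h3 := neg_abs_le (G UpperHalfPlane.I : ℂ).re
    have h4 := abs_nonneg (UpperHalfPlane.I : ℂ).re
    have h5 := abs_nonneg (G UpperHalfPlane.I : ℂ).re
    have e : ((k : ℂ) * b).re = k * b := by
      rw [show (k : ℂ) * b = ((k * b : ℝ) : ℂ) by push_cast; rfl, Complex.ofReal_re]
    constructor <;> left <;> rw [Complex.sub_re, Complex.add_re, e] <;> linarith
  rcases hN with ⟨b, hb, h⟩ | ⟨c, hc1, h⟩
  · rcases lt_or_gt_of_ne hb with hb | hb
    · refine key N⁻¹ hc' ⟨-b, by linarith, fun w => ?_⟩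
      have := h (N⁻¹ • w)
      rw [smul_inv_smul] at this
      rw [this]; push_cast; ring
    · exact key N hc ⟨b, hb, h⟩
  · have hk : ∀ (k : ℕ) (w : ℍ), (((fun w : ℍ => N • w)^[k] w : ℍ) : ℂ) = ((c ^ k : ℝ) : ℂ) * w := by
      intro k w
      induction k with
      | zero => simp
      | succ k ih => rw [Function.iterate_succ_apply']; show ((N • _ : ℍ) : ℂ) = _; rw [h, ih]; push_cast; ring
    have hG : ∀ (k : ℕ) (w : ℍ), G ((fun w : ℍ => N • w)^[k] w) = (fun w : ℍ => N • w)^[k] (G w) := by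
      intro k w
      induction k with
      | zero => rfl
      | succ k ih => rw [Function.iterate_succ_apply', Function.iterate_succ_apply', ← ih]; exact hc _
    have hlim : ∀ w : ℍ, ∀ᶠ k : ℕ in atTop, C < c ^ k * w.im := fun w =>
      ((tendsto_pow_atTop_atTop_of_one_lt hc1).atTop_mul_const w.2).eventually (eventually_gt_atTop C)
    obtain ⟨k, hk1, hk2⟩ := ((hlim UpperHalfPlane.I).and (hlim (G UpperHalfPlane.I))).exists
    refine ⟨(fun w : ℍ => N • w)^[k] UpperHalfPlane.I, fun z hz => ?_⟩
    have h1 := (le_abs_self _).trans (Complex.abs_im_le_norm z)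
    rw [hG, hk, hk]
    constructor <;> right <;> rw [Complex.sub_im, Complex.im_ofReal_mul]
    · change _ * UpperHalfPlane.I.im - _ ≠ 0
      intro h; linarith
    · change _ * (G UpperHalfPlane.I).im - _ ≠ 0
      intro h; linarith

theorem step4_core {U : Set ℂ} {π : ℍ → ℂ} (h : UCov U π) {g : ℂ ≃ₜ ℂ} {L : ℂ × ℂ → ℂ} (hL : IsLog (fun z : ℂ => z) g L)
    (hgU : ∀ z, g z ∈ U ↔ z ∈ U) {y : ℕ → ℂ} (hyU : ∀ i, y i ∉ U) (hgy : ∀ i, g (y i) = y (i + 1)) (hyn : ∀ i, y i ≠ y (i + 1))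
    {G' : ℍ ≃ₜ ℍ} (hG : ∀ w, π (G' w) = g (π w)) {T : SL(2, ℝ)} (hT : T ∈ DkG π) (hGT : ∀ w, G' (T • w) = T • G' w)
    {l : ℂ → ℍ → ℂ} (hl : ∀ z, z ∉ U → Continuous (l z)) (hle : ∀ z, z ∉ U → ∀ w, Complex.exp (l z w) = π w - z)
    (hTc : ∀ z, z ∉ U → Chi (l z) T (-1)) {S : SL(2, ℝ)} (hS : S ∈ DkG π) (hS1 : Chi (l (y 0)) S 1)
    (hS0 : ∀ z, z ∉ U → z ≠ y 0 → Chi (l z) S 0) {r : ℝ → ℍ} (hr : Continuous r) (hrS : ∀ t, r (t + 1) = S • r t)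
    {m : ℕ} (hm : 1 ≤ m) (hGm : ∀ w, G'^[m] (S • w) = S • G'^[m] w) : False := by
  have hD := h.disc
  -- the sequence of conjugates
  have hstep : ∀ s : {S : SL(2, ℝ) // S ∈ DkG π}, ∃ s' : {S : SL(2, ℝ) // S ∈ DkG π}, ∀ w, G' (s.1 • w) = s'.1 • G' w := by
    rintro ⟨s, hs⟩
    obtain ⟨s', h1, h2⟩ := conj_deck h hG hs
    exact ⟨⟨s', h1⟩, h2⟩
  choose nx hnx using hstep
  set Sq : ℕ → {S : SL(2, ℝ) // S ∈ DkG π} := fun i => nx^[i] ⟨S, hS⟩ with hSq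
  have hSs : ∀ i w, G' ((Sq i).1 • w) = (Sq (i + 1)).1 • G' w := by
    intro i w
    rw [hnx, hSq]
    simp only [Function.iterate_succ_apply']
  have hSi : ∀ i w, G'^[i] (S • w) = (Sq i).1 • G'^[i] w := by
    intro i w
    induction i with
    | zero => rfl
    | succ i ih => rw [Function.iterate_succ_apply', ih, hSs, Function.iterate_succ_apply']
  have hchi : ∀ i, Chi (l (y i)) (Sq i).1 1 ∧ ∀ z, z ∉ U → z ≠ y i → Chi (l z) (Sq i).1 0 := by
    have tr : ∀ i z n, z ∉ U → Chi (l z) (Sq i).1 n → Chi (l (g z)) (Sq (i + 1)).1 n := by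
      intro i z n hz hc w
      have hgz : g z ∉ U := fun hh => hz ((hgU z).1 hh)
      obtain ⟨c, hcc⟩ := h.log_lift hz (hl z hz) (hle z hz) (hl _ hgz) (hle _ hgz) hL rfl G'.continuous hG
      obtain ⟨v, rfl⟩ := G'.surjective w
      have hd : Dk π (Sq i).1 := (Sq i).2
      rw [← hSs, hcc, hcc, hc, hd]; ring
    intro i
    induction i with
    | zero => exact ⟨hS1, hS0⟩
    | succ i ih =>
      constructor
      · rw [← hgy]; exact tr i _ _ (hyU i) ih.1
      · intro z hz hzy
        obtain ⟨z', rfl⟩ := g.surjective z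
        have hz' : z' ∉ U := fun hh => hz ((hgU z').2 hh)
        exact tr i _ _ hz' (ih.2 z' hz' (fun e => hzy (by rw [e, hgy])))
  have hne : ∀ i, ¬ Triv (Sq i).1 := by
    intro i ht
    have := (hchi i).1.triv ht
    omega
  have hTn : ¬ Triv T := by
    intro ht
    have := (hTc _ (hyU 0)).triv ht
    omega
  obtain ⟨A, hA⟩ := exists_nf (hD.nofix hT hTn)
  have hnaff : ∀ i, ¬ Aff (A * (Sq i).1 * A⁻¹) := by
    intro i ha
    have hc := share_conj hD hT (Sq i).2 hA ha
    obtain ⟨k, j, hk, hkj, -⟩ := lemC_chi hD hT (Sq i).2 hTn hc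
    have e1 := hkj _ _ _ (hchi i).1 (hTc _ (hyU i))
    have e2 := hkj _ _ _ ((hchi i).2 _ (hyU (i + 1)) (hyn i).symm) (hTc _ (hyU (i + 1)))
    omega
  have hB : ∀ i, ∃ B : SL(2, ℝ), Nf (B * (A * (Sq i).1 * A⁻¹) * B⁻¹) := by
    intro i
    refine exists_nf (fun w hw => ?_)
    rw [mul_smul, mul_smul] at hw
    exact hD.nofix (Sq i).2 (hne i) (A⁻¹ • w) (by rw [eq_inv_smul_iff]; exact hw)
  choose B hB using hB
  have hB0 : ∀ i, (B i)⁻¹ 1 0 ≠ 0 := fun i => not_aff (hB i) (hnaff i)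
  set a : ℕ → ℝ := fun i => (B i)⁻¹ 0 0 / (B i)⁻¹ 1 0 with ha
  set ρ : ℕ → ℝ → ℍ := fun i t => A • G'^[i] (r t) with hρ
  have hρc : ∀ i, Continuous (ρ i) := fun i => ((G'.continuous.iterate i).comp hr).const_smul A
  have hlim : ∀ i, Tendsto (fun t => (ρ i t : ℂ)) atTop (𝓝 (a i)) := by
    intro i
    refine ray_lim (hB i) (hB0 i) (hρc i) (fun t => ?_)
    simp only [hρ]
    rw [hrS, hSi]; simp [mul_smul]
  have ham : a m = a 0 := by
    have h1 := ray_lim (hB 0) (hB0 0) (hρc m) (fun t => by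
      simp only [hρ]
      rw [hrS, hGm]; simp [mul_smul, hSq])
    exact_mod_cast tendsto_nhds_unique (hlim m) h1
  have han : ∀ i, a i ≠ a (i + 1) := by
    intro i he
    have h1 := same_end (hB (i + 1)) (hB0 i) (hB0 (i + 1)) he
    have hc := share_conj hD (A := B i * A) (Sq i).2 (Sq (i + 1)).2 (by convert hB i using 1; group) (by convert h1 using 1; group)
    obtain ⟨k, j, hk, hkj, -⟩ := lemC_chi hD (Sq i).2 (Sq (i + 1)).2 (hne i) hc
    have e1 := hkj _ _ _ (hchi (i + 1)).1 ((hchi i).2 _ (hyU (i + 1)) (hyn i).symm)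
    omega
  have hOP := conj_OP (h.lift_OP ⟨L, hL⟩ g.continuous g.injective hG) A
  obtain ⟨M, hM⟩ := hOP
  set G : ℍ → ℍ := fun w => A • G' (A⁻¹ • w) with hGdef
  have hGc : Continuous G := (G'.continuous.comp (continuous_const_smul _)).const_smul A
  have hGi : Function.Injective G := (MulAction.injective A).comp (G'.injective.comp (MulAction.injective _))
  have hGρ : ∀ i t, G (ρ i t) = ρ (i + 1) t := by
    intro i t
    simp only [hGdef, hρ]
    rw [inv_smul_smul, Function.iterate_succ_apply']
  have hp := far_pt hA (G := G) (fun w => by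
    simp only [hGdef]
    have : A⁻¹ • (A * T * A⁻¹) • w = T • A⁻¹ • w := by simp [mul_smul]
    rw [this, hGT]; simp [mul_smul])
  have hlim' : ∀ i, Tendsto (fun t => (G (ρ i t) : ℂ)) atTop (𝓝 (a (i + 1))) := by
    intro i
    simp only [hGρ]; exact hlim (i + 1)
  have up : ∀ i, a i < a (i + 1) → a (i + 1) < a (i + 1 + 1) := fun i hi =>
    ord hGc hGi hM hp (hρc i) (hρc (i + 1)) (hlim i) (hlim (i + 1)) (hlim' i) (hlim' (i + 1)) hi (han (i + 1))
  have dn : ∀ i, a (i + 1) < a i → a (i + 1 + 1) < a (i + 1) := fun i hi =>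
    ord hGc hGi hM hp (hρc (i + 1)) (hρc i) (hlim (i + 1)) (hlim i) (hlim' (i + 1)) (hlim' i) hi (han (i + 1)).symm
  rcases lt_or_gt_of_ne (han 0) with h0 | h0
  · have : ∀ i, a i < a (i + 1) := fun i => by
      induction i with
      | zero => exact h0
      | succ i ih => exact up i ih
    have := strictMono_nat_of_lt_succ this (show 0 < m by omega)
    rw [ham] at this; exact lt_irrefl _ this
  · have : ∀ i, a (i + 1) < a i := fun i => by
      induction i with
      | zero => exact h0
      | succ i ih => exact dn i ih
    have := strictAnti_nat_of_succ_lt this (show 0 < m by omega)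
    rw [ham] at this; exact lt_irrefl _ this


lemma homeo_cobounded (g : ℂ ≃ₜ ℂ) : Tendsto g (Bornology.cobounded ℂ) (Bornology.cobounded ℂ) := by
  rw [Metric.cobounded_eq_cocompact]
  exact g.isClosedEmbedding.tendsto_cocompact

lemma div_cobounded (c : ℂ) {α : Type*} {F : Filter α} {f : α → ℂ} (hf : Tendsto f F (Bornology.cobounded ℂ)) :
    Tendsto (fun a => c / f a) F (𝓝 0) := by
  have := (tendsto_inv₀_cobounded.comp hf).const_mul c
  simpa [div_eq_mul_inv] using this

lemma sub_cobounded (c : ℂ) {α : Type*} {F : Filter α} {f : α → ℂ} (hf : Tendsto f F (Bornology.cobounded ℂ)) :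
    Tendsto (fun a => f a - c) F (Bornology.cobounded ℂ) := by
  rw [← tendsto_norm_atTop_iff_cobounded] at hf ⊢
  refine tendsto_atTop_mono (fun a => ?_) (tendsto_atTop_add_const_right _ (-‖c‖) hf)
  have := norm_sub_norm_le (f a) c
  linarith

lemma slit_one_sub {z : ℂ} (hz : ‖z‖ < 1) : 1 - z ∈ Complex.slitPlane := by
  left
  have := (le_abs_self _).trans (Complex.abs_re_le_norm z)
  simp; linarith

lemma log_zero {α : Type*} {F : Filter α} {f : α → ℂ} (hf : Tendsto f F (𝓝 0)) :
    Tendsto (fun a => Complex.log (1 - f a)) F (𝓝 0) := by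
  have h1 : Tendsto (fun a => 1 - f a) F (𝓝 1) := by simpa using tendsto_const_nhds.sub hf
  have := h1.clog (by simp)
  simpa using this

lemma L_inf {g : ℂ ≃ₜ ℂ} {L : ℂ × ℂ → ℂ} (hL : IsLog (fun z : ℂ => z) g L) (y : ℂ) :
    Tendsto (fun z => L (z, y) - L (z, 0)) (Bornology.cobounded ℂ) (𝓝 0) := by
  have hid : Tendsto (fun z : ℂ => z) (Bornology.cobounded ℂ) (Bornology.cobounded ℂ) := tendsto_id
  have t1 : Tendsto (fun z => Complex.log (1 - (g y - g 0) / (g z - g 0)) - Complex.log (1 - y / z)) (Bornology.cobounded ℂ) (𝓝 0) := by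
    have := (log_zero (div_cobounded (g y - g 0) (sub_cobounded (g 0) (homeo_cobounded g)))).sub (log_zero (div_cobounded y hid))
    simpa using this
  refine t1.congr' ?_
  have hcomp : IsCompact (segment ℝ (0:ℂ) y) := by
    rw [segment_eq_image]
    exact isCompact_Icc.image (by fun_prop)
  obtain ⟨C1, hC1⟩ := hcomp.bddAbove_image (f := fun z => ‖z‖) (by fun_prop)
  obtain ⟨C2, hC2⟩ := hcomp.bddAbove_image (f := fun z => ‖g z - g 0‖) (by fun_prop)
  have e1 := (tendsto_norm_atTop_iff_cobounded.2 hid).eventually (eventually_gt_atTop C1)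
  have e2 := (tendsto_norm_atTop_iff_cobounded.2 (sub_cobounded (g 0) (homeo_cobounded g))).eventually (eventually_gt_atTop C2)
  filter_upwards [e1, e2] with z hz1 hz2
  have h0 : (0:ℂ) ∈ segment ℝ (0:ℂ) y := left_mem_segment _ _ _
  have hy : y ∈ segment ℝ (0:ℂ) y := right_mem_segment _ _ _
  have b1 : ∀ v ∈ segment ℝ (0:ℂ) y, ‖v‖ < ‖z‖ := fun v hv => (hC1 ⟨v, hv, rfl⟩).trans_lt hz1
  have b2 : ∀ v ∈ segment ℝ (0:ℂ) y, ‖g v - g 0‖ < ‖g z - g 0‖ := fun v hv => (hC2 ⟨v, hv, rfl⟩).trans_lt hz2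
  have z1 : z ≠ 0 := norm_pos_iff.1 ((norm_nonneg _).trans_lt (b1 _ h0))
  have z2 : g z - g 0 ≠ 0 := norm_pos_iff.1 ((norm_nonneg _).trans_lt (b2 _ h0))
  have n1 : ∀ v ∈ segment ℝ (0:ℂ) y, ‖v / z‖ < 1 := fun v hv => by
    rw [norm_div, div_lt_one (norm_pos_iff.2 z1)]; exact b1 v hv
  have n2 : ∀ v ∈ segment ℝ (0:ℂ) y, ‖(g v - g 0) / (g z - g 0)‖ < 1 := fun v hv => by
    rw [norm_div, div_lt_one (norm_pos_iff.2 z2)]; exact b2 v hv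
  have hne : ∀ v ∈ segment ℝ (0:ℂ) y, z ≠ v := by
    rintro v hv rfl; exact lt_irrefl _ (b1 _ hv)
  obtain ⟨n, hn⟩ := clog_diff_const (convex_segment (𝕜 := ℝ) (0:ℂ) y).isPreconnected (fun v => L (z, v))
    (fun v => Complex.log (1 - (g v - g 0) / (g z - g 0)) - Complex.log (1 - v / z) + L (z, 0))
    (hL.1.comp (continuous_const.prodMk continuous_id).continuousOn (fun c hc => hne c hc))
    (((ContinuousOn.clog (by fun_prop) (fun v hv => slit_one_sub (n2 v hv))).sub
      (ContinuousOn.clog (by fun_prop) (fun v hv => slit_one_sub (n1 v hv)))).add continuousOn_const)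
    (fun v hv => by
      have s1 := Complex.slitPlane_ne_zero (slit_one_sub (n1 v hv))
      have s2 := Complex.slitPlane_ne_zero (slit_one_sub (n2 v hv))
      rw [Complex.exp_add, Complex.exp_sub, Complex.exp_log s1, Complex.exp_log s2]
      have i1 := hL.2 _ _ (hne v hv)
      have i0 := hL.2 _ _ (hne 0 h0)
      have z3 : z - v ≠ 0 := sub_ne_zero.2 (hne v hv)
      have j1 : Complex.exp (L (z, v)) = (g z - g v) / (z - v) := by rw [eq_div_iff z3]; exact i1
      have j0 : Complex.exp (L (z, 0)) = (g z - g 0) / z := by rw [eq_div_iff z1]; simpa using i0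
      rw [j1, j0]
      field_simp
      ring)
  have k0 := hn 0 h0
  have k1 := hn y hy
  have : n = 0 := by
    have : (n : ℂ) * (2 * Real.pi * Complex.I) = ((0:ℤ) : ℂ) * (2 * Real.pi * Complex.I) := by
      simp at k0 ⊢; simpa using k0
    exact int_two_pi_inj this
  rw [k1, this]; simp

section
variable {U : Set ℂ} {π : ℍ → ℂ}

lemma loop_lift (h : UCov U π) {p : ℍ → ℂ} (hp : Continuous p) (hpU : ∀ u, p u ∈ U)
    (hper : ∀ u : ℍ, p ((2 * Real.pi : ℝ) +ᵥ u) = p u) : ∃ E : ℍ → ℍ, Continuous E ∧ (∀ u, π (E u) = p u) ∧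
      ∃ S ∈ DkG π, ∀ u : ℍ, E ((2 * Real.pi : ℝ) +ᵥ u) = S • E u := by
  obtain ⟨w, hw⟩ := h.surj _ (hpU UpperHalfPlane.I)
  obtain ⟨E, hE, -, hpE⟩ := h.lift p hp hpU UpperHalfPlane.I w hw
  have hv : Continuous (fun u : ℍ => (2 * Real.pi : ℝ) +ᵥ u) := by
    rw [UpperHalfPlane.isEmbedding_coe.continuous_iff]
    show Continuous fun u : ℍ => (((2 * Real.pi : ℝ) +ᵥ u : ℍ) : ℂ)
    simp only [UpperHalfPlane.coe_vadd]
    fun_prop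
  obtain ⟨S, hS1, hS2⟩ := h.deck (w := E UpperHalfPlane.I) (w' := E ((2 * Real.pi : ℝ) +ᵥ UpperHalfPlane.I)) (by rw [hpE, hpE, hper])
  refine ⟨E, hE, hpE, S, hS2, fun u => ?_⟩
  exact h.uniq (F := fun u : ℍ => E ((2 * Real.pi : ℝ) +ᵥ u)) (G := fun u => S • E u) (hE.comp hv) (hE.const_smul S)
    (fun u => by rw [hS2, hpE, hpE, hper]) (a0 := UpperHalfPlane.I) hS1.symm u

lemma loop_chi {z : ℂ} {E : ℍ → ℍ} (hE : Continuous E) {S : SL(2, ℝ)} (hS : S ∈ DkG π)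
    (hES : ∀ u : ℍ, E ((2 * Real.pi : ℝ) +ᵥ u) = S • E u) {l : ℍ → ℂ} (hl : Continuous l) (hle : ∀ w, Complex.exp (l w) = π w - z)
    {lam : ℍ → ℂ} (hlam : Continuous lam) (hlame : ∀ u, Complex.exp (lam u) = π (E u) - z) {n : ℤ}
    (hn : ∀ u : ℍ, lam ((2 * Real.pi : ℝ) +ᵥ u) = lam u + n * (2 * Real.pi * Complex.I)) : Chi l S n := by
  obtain ⟨c, hc⟩ := clog_diff_const (isPreconnected_univ (α := ℍ)) (fun u => l (E u)) lam (hl.comp hE).continuousOn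
    hlam.continuousOn (fun u _ => by rw [hle, hlame])
  obtain ⟨n', hn'⟩ := UCov.exists_chi hl hle (γ := S) hS
  have h1 := hn' (E UpperHalfPlane.I)
  have h2 := hc UpperHalfPlane.I (Set.mem_univ _)
  have h3 := hc ((2 * Real.pi : ℝ) +ᵥ UpperHalfPlane.I) (Set.mem_univ _)
  have h4 := hn UpperHalfPlane.I
  rw [hES] at h3
  have : n' = n := int_two_pi_inj (by linear_combination h3 - h1 + h4 - h2)
  rw [← this]; exact hn'

/-- loop around a puncture -/
lemma punct_loop (h : UCov U π) {y0 : ℂ} {ε : ℝ} (hε : 0 < ε) (hU : ∀ z, z ∉ U → z ≠ y0 → ε ≤ ‖z - y0‖)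
    (hy0 : y0 ∉ U) {l : ℂ → ℍ → ℂ} (hl : ∀ z, z ∉ U → Continuous (l z)) (hle : ∀ z, z ∉ U → ∀ w, Complex.exp (l z w) = π w - z) :
    ∃ S ∈ DkG π, Chi (l y0) S 1 ∧ (∀ z, z ∉ U → z ≠ y0 → Chi (l z) S 0) ∧ ∃ r : ℝ → ℍ, Continuous r ∧ ∀ t, r (t + 1) = S • r t := by
  have hper : ∀ u : ℍ, Complex.exp (Complex.I * (((2 * Real.pi : ℝ) +ᵥ u : ℍ) : ℂ)) = Complex.exp (Complex.I * u) := by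
    intro u
    rw [UpperHalfPlane.coe_vadd, mul_add, Complex.exp_add]
    have : Complex.exp (Complex.I * ((2 * Real.pi : ℝ) : ℂ)) = 1 := by
      rw [mul_comm]; push_cast; exact Complex.exp_two_pi_mul_I
    rw [this, one_mul]
  have hlt : ∀ u : ℍ, ‖Complex.exp (Complex.I * u)‖ < 1 := by
    intro u
    rw [Complex.norm_exp]
    have : (Complex.I * (u : ℂ)).re = - u.im := by simp
    rw [this, Real.exp_lt_one_iff]
    have := u.2
    linarith [show 0 < u.im from u.2]
  have hεc : (ε : ℂ) ≠ 0 := by exact_mod_cast hε.ne'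
  have hp : ∀ u : ℍ, y0 + ε * Complex.exp (Complex.I * u) ∈ U := by
    intro u
    by_contra hn
    have := hU _ hn (by simp [hεc])
    rw [add_sub_cancel_left, norm_mul, Complex.norm_real, Real.norm_eq_abs, abs_of_pos hε] at this
    nlinarith [hlt u]
  obtain ⟨E, hE, hpE, S, hS, hES⟩ := loop_lift h (p := fun u : ℍ => y0 + ε * Complex.exp (Complex.I * u)) (by fun_prop) hp
    (fun u => by show y0 + ε * Complex.exp (Complex.I * (((2 * Real.pi : ℝ) +ᵥ u : ℍ) : ℂ)) = _; rw [hper])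
  refine ⟨S, hS, ?_, ?_, fun t => E ((2 * Real.pi * t : ℝ) +ᵥ UpperHalfPlane.I), ?_, ?_⟩
  · refine loop_chi hE hS hES (hl y0 hy0) (hle y0 hy0) (lam := fun u : ℍ => (Real.log ε : ℂ) + Complex.I * u) (by fun_prop) ?_ ?_
    · intro u
      rw [hpE, Complex.exp_add, ← Complex.ofReal_exp, Real.exp_log hε]; ring
    · intro u
      rw [UpperHalfPlane.coe_vadd]; push_cast; ring
  · intro z hz hzy
    have h0 : y0 - z ≠ 0 := sub_ne_zero.2 hzy.symm
    have hlt2 : ∀ u : ℍ, ‖-(ε / (y0 - z) * Complex.exp (Complex.I * u))‖ < 1 := by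
      intro u
      rw [norm_neg, norm_mul, norm_div, Complex.norm_real, Real.norm_eq_abs, abs_of_pos hε]
      have h1 : ε / ‖y0 - z‖ ≤ 1 := by
        rw [div_le_one (norm_pos_iff.2 h0), norm_sub_rev]; exact hU z hz hzy
      have h2 : 0 ≤ ε / ‖y0 - z‖ := by positivity
      nlinarith [hlt u, norm_nonneg (Complex.exp (Complex.I * u))]
    refine loop_chi hE hS hES (hl z hz) (hle z hz) (lam := fun u : ℍ => Complex.log (y0 - z) + Complex.log (1 - -(ε / (y0 - z) * Complex.exp (Complex.I * u)))) ?_ ?_ ?_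
    · exact continuous_const.add (Continuous.clog (by fun_prop) (fun u => slit_one_sub (hlt2 u)))
    · intro u
      rw [hpE, Complex.exp_add, Complex.exp_log h0, Complex.exp_log (Complex.slitPlane_ne_zero (slit_one_sub (hlt2 u)))]
      field_simp; ring
    · intro u
      rw [hper]; simp
  · refine hE.comp ?_
    rw [UpperHalfPlane.isEmbedding_coe.continuous_iff]
    show Continuous fun t : ℝ => (((2 * Real.pi * t : ℝ) +ᵥ UpperHalfPlane.I : ℍ) : ℂ)
    simp only [UpperHalfPlane.coe_vadd]
    fun_prop
  · intro t
    rw [← hES, vadd_vadd]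
    congr 2; ring_nf
end


lemma inf_lift {U : Set ℂ} {π : ℍ → ℂ} (h : UCov U π) {g : ℂ ≃ₜ ℂ} {L : ℂ × ℂ → ℂ} (hL : IsLog (fun z : ℂ => z) g L)
    (hgU : ∀ z, g z ∈ U ↔ z ∈ U) {R : ℝ} (hR : 0 < R) (hU : ∀ z, z ∉ U → ‖z‖ < R) :
    ∃ T ∈ DkG π, ∃ G' : ℍ ≃ₜ ℍ, (∀ w, π (G' w) = g (π w)) ∧ (∀ w, G' (T • w) = T • G' w) ∧ ∃ l : ℂ → ℍ → ℂ,
      (∀ z, z ∉ U → Continuous (l z)) ∧ (∀ z, z ∉ U → ∀ w, Complex.exp (l z w) = π w - z) ∧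
      (∀ z, z ∉ U → Chi (l z) T (-1)) ∧ ∀ z, z ∉ U → ∀ w, l (g z) (G' w) = l z w + L (π w, z) := by
  have hRc : (R : ℂ) ≠ 0 := by exact_mod_cast hR.ne'
  set p : ℍ → ℂ := fun u => R * Complex.exp (-(Complex.I * u)) with hpdef
  have hpc : Continuous p := by simp only [hpdef]; fun_prop
  have hpn : ∀ u : ℍ, ‖p u‖ = R * Real.exp u.im := by
    intro u
    simp only [hpdef]
    rw [norm_mul, Complex.norm_real, Real.norm_eq_abs, abs_of_pos hR, Complex.norm_exp]
    simp
  have hpR : ∀ u : ℍ, R < ‖p u‖ := fun u => by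
    rw [hpn]
    have := Real.add_one_lt_exp (x := u.im) (ne_of_gt u.2)
    have : 0 < u.im := u.2
    nlinarith
  have hpU : ∀ u, p u ∈ U := fun u => by
    by_contra hn
    exact lt_asymm (hU _ hn) (hpR u)
  have hp0 : ∀ u, p u ≠ 0 := fun u => norm_pos_iff.1 (hR.trans (hpR u))
  have hper : ∀ u : ℍ, p ((2 * Real.pi : ℝ) +ᵥ u) = p u := by
    intro u
    simp only [hpdef]
    rw [UpperHalfPlane.coe_vadd, mul_add, neg_add, Complex.exp_add]
    have : Complex.exp (-(Complex.I * ((2 * Real.pi : ℝ) : ℂ))) = 1 := by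
      rw [mul_comm, Complex.exp_neg]; push_cast; rw [Complex.exp_two_pi_mul_I]; simp
    rw [this, one_mul]
  obtain ⟨E, hE, hpE, T, hT, hET⟩ := loop_lift h hpc hpU hper
  -- normalised logarithms
  have hlt : ∀ z, z ∉ U → ∀ u, ‖z / p u‖ < 1 := fun z hz u => by
    rw [norm_div, div_lt_one (norm_pos_iff.2 (hp0 u))]
    exact (hU z hz).trans (hpR u)
  set lam : ℂ → ℍ → ℂ := fun z u => (Real.log R : ℂ) - Complex.I * u + Complex.log (1 - z / p u) with hlam
  have hlamc : ∀ z, z ∉ U → Continuous (lam z) := fun z hz => by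
    simp only [hlam]
    exact Continuous.add (by fun_prop) (Continuous.clog (continuous_const.sub (continuous_const.div hpc hp0)) (fun u => slit_one_sub (hlt z hz u)))
  have hexpR : Complex.exp (Real.log R : ℂ) = R := by rw [← Complex.ofReal_exp, Real.exp_log hR]
  have hlame : ∀ z, z ∉ U → ∀ u, Complex.exp (lam z u) = p u - z := fun z hz u => by
    simp only [hlam]
    rw [Complex.exp_add, Complex.exp_log (Complex.slitPlane_ne_zero (slit_one_sub (hlt z hz u))), sub_eq_add_neg, Complex.exp_add, hexpR]
    change p u * (1 - z / p u) = _
    have := hp0 u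
    field_simp
  have hl : ∀ z, ∃ l : ℍ → ℂ, z ∉ U → Continuous l ∧ (∀ w, Complex.exp (l w) = π w - z) ∧ ∀ u, l (E u) = lam z u := by
    intro z
    by_cases hz : z ∈ U
    · exact ⟨fun _ => 0, fun h => absurd hz h⟩
    obtain ⟨l, hl, hle⟩ := h.exists_log hz
    obtain ⟨c, hc⟩ := clog_diff_const (isPreconnected_univ (α := ℍ)) (fun u => l (E u)) (lam z) (hl.comp hE).continuousOn
      (hlamc z hz).continuousOn (fun u _ => by rw [hle, hlame z hz, hpE])
    refine ⟨fun w => l w - c * (2 * Real.pi * Complex.I), fun _ => ⟨hl.sub continuous_const, fun w => ?_, fun u => ?_⟩⟩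
    · rw [Complex.exp_sub, hle, Complex.exp_int_mul_two_pi_mul_I, div_one]
    · have := hc u (Set.mem_univ _)
      show l (E u) - _ = _
      linear_combination this
  choose l hl using hl
  -- the lift
  have hgc := homeo_cobounded g
  have ev1 := (tendsto_norm_atTop_iff_cobounded.2 hgc).eventually (eventually_gt_atTop R)
  have ev2 := (tendsto_norm_atTop_iff_cobounded.2 (sub_cobounded (g 0) hgc)).eventually (eventually_gt_atTop ‖g 0‖)
  obtain ⟨C, hC⟩ : ∃ C : ℝ, ∀ z : ℂ, C < ‖z‖ → R < ‖g z‖ ∧ ‖g 0‖ < ‖g z - g 0‖ := by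
    have := ev1.and ev2
    rw [← comap_norm_atTop, eventually_comap] at this
    obtain ⟨C, hC⟩ := eventually_atTop.1 this
    exact ⟨C, fun z hz => hC _ hz.le z rfl⟩
  obtain ⟨t, ht0, htC⟩ : ∃ t : ℝ, 0 < t ∧ C < R * Real.exp t :=
    ((eventually_gt_atTop (0:ℝ)).and ((Real.tendsto_exp_atTop.const_mul_atTop hR).eventually (eventually_gt_atTop C))).exists
  set up : ℍ → ℍ := fun u => ⟨u + Complex.I * t, by
    have : 0 < u.im := u.2
    simp; linarith⟩ with hup
  have hupi : ∀ u, (up u).im = u.im + t := fun u => by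
    show ((u : ℂ) + Complex.I * t).im = _
    simp
  have hupc : Continuous up := by
    rw [UpperHalfPlane.isEmbedding_coe.continuous_iff]
    show Continuous fun u : ℍ => (u : ℂ) + Complex.I * t
    fun_prop
  have hupv : ∀ u : ℍ, up ((2 * Real.pi : ℝ) +ᵥ u) = (2 * Real.pi : ℝ) +ᵥ up u := fun u => by
    apply UpperHalfPlane.ext
    show (((2 * Real.pi : ℝ) +ᵥ u : ℍ) : ℂ) + Complex.I * t = (((2 * Real.pi : ℝ) +ᵥ up u : ℍ) : ℂ)
    rw [UpperHalfPlane.coe_vadd, UpperHalfPlane.coe_vadd]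
    show _ = _ + ((u : ℂ) + Complex.I * t)
    ring
  set Z : ℍ → ℂ := fun u => p (up u) with hZ
  have hZc : Continuous Z := hpc.comp hupc
  have hZ0 : ∀ u, Z u ≠ 0 := fun u => hp0 _
  have hZC : ∀ u, C < ‖Z u‖ := fun u => by
    simp only [hZ]
    rw [hpn, hupi]
    have : Real.exp t ≤ Real.exp (u.im + t) := Real.exp_le_exp.2 (by linarith [show 0 < u.im from u.2])
    nlinarith
  have hgZ : ∀ u, R < ‖g (Z u)‖ := fun u => (hC _ (hZC u)).1
  have hgZ0 : ∀ u, ‖g 0‖ < ‖g (Z u) - g 0‖ := fun u => (hC _ (hZC u)).2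
  have hgZn : ∀ u, g (Z u) - g 0 ≠ 0 := fun u => norm_pos_iff.1 ((norm_nonneg _).trans_lt (hgZ0 u))
  have hgn : ∀ u, ‖-(g 0) / (g (Z u) - g 0)‖ < 1 := fun u => by
    rw [norm_div, norm_neg, div_lt_one (norm_pos_iff.2 (hgZn u))]
    exact hgZ0 u
  set K : ℍ → ℂ := fun u => (up u : ℂ) + Complex.I * (L (Z u, 0) + Complex.log (1 - -(g 0) / (g (Z u) - g 0))) with hK
  have hKc : Continuous K := by
    simp only [hK]
    have c1 : Continuous fun u => L (Z u, 0) := by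
      rw [← continuousOn_univ]
      exact hL.1.comp (hZc.prodMk continuous_const).continuousOn (fun u _ => hZ0 u)
    have c2 : Continuous fun u => Complex.log (1 - -(g 0) / (g (Z u) - g 0)) :=
      Continuous.clog (continuous_const.sub (continuous_const.div ((g.continuous.comp hZc).sub continuous_const) hgZn))
        (fun u => slit_one_sub (hgn u))
    exact (UpperHalfPlane.continuous_coe.comp hupc).add (continuous_const.mul (c1.add c2))
  have hKe : ∀ u, R * Complex.exp (-(Complex.I * K u)) = g (Z u) := by
    intro u
    have e1 : -(Complex.I * K u) = -(Complex.I * (up u : ℂ)) + (L (Z u, 0) + Complex.log (1 - -(g 0) / (g (Z u) - g 0))) := by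
      simp only [hK]
      linear_combination -(L (Z u, 0) + Complex.log (1 - -(g 0) / (g (Z u) - g 0))) * Complex.I_mul_I
    rw [e1, Complex.exp_add, Complex.exp_add, Complex.exp_log (Complex.slitPlane_ne_zero (slit_one_sub (hgn u)))]
    have e2 := hL.2 _ _ (hZ0 u)
    have e3 : (R : ℂ) * Complex.exp (-(Complex.I * (up u : ℂ))) = Z u := rfl
    have := hgZn u
    rw [← mul_assoc, e3, ← mul_assoc]
    have e4 : Z u * Complex.exp (L (Z u, 0)) = g (Z u) - g 0 := by rw [← e2]; ring
    rw [e4]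
    field_simp
    ring
  have hKim : ∀ u, 0 < (K u).im := by
    intro u
    have e := hgZ u
    rw [← hKe, norm_mul, Complex.norm_real, Real.norm_eq_abs, abs_of_pos hR, Complex.norm_exp] at e
    have e2 : (-(Complex.I * K u)).re = (K u).im := by simp
    rw [e2] at e
    have : 1 < Real.exp (K u).im := by
      by_contra hn
      push Not at hn
      nlinarith
    exact Real.one_lt_exp_iff.1 this
  set KH : ℍ → ℍ := fun u => ⟨K u, hKim u⟩ with hKH
  have hKHc : Continuous KH := by
    rw [UpperHalfPlane.isEmbedding_coe.continuous_iff]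
    exact hKc
  have hKHp : ∀ u, p (KH u) = g (Z u) := hKe
  have hZper : ∀ u : ℍ, Z ((2 * Real.pi : ℝ) +ᵥ u) = Z u := fun u => by
    simp only [hZ]
    rw [hupv, hper]
  have hKHv : ∀ u : ℍ, KH ((2 * Real.pi : ℝ) +ᵥ u) = (2 * Real.pi : ℝ) +ᵥ KH u := fun u => by
    apply UpperHalfPlane.ext
    rw [UpperHalfPlane.coe_vadd]
    show K _ = _ + K u
    simp only [hK]
    rw [hZper, hupv, UpperHalfPlane.coe_vadd]
    ring
  obtain ⟨G', hG1, hG⟩ := h.lift_homeo g hgU (w0 := E (up UpperHalfPlane.I)) (w1 := E (KH UpperHalfPlane.I)) (by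
    rw [hpE, hpE, hKHp])
  have hGE : ∀ u, G' (E (up u)) = E (KH u) := fun u =>
    h.uniq (F := fun u => G' (E (up u))) (G := fun u => E (KH u)) (G'.continuous.comp (hE.comp hupc)) (hE.comp hKHc)
      (fun u => by rw [hG, hpE, hpE, hKHp]) hG1 u
  have hTd : Dk π T := hT
  have hGT : ∀ w, G' (T • w) = T • G' w := fun w =>
    h.uniq (F := fun w => G' (T • w)) (G := fun w => T • G' w) (G'.continuous.comp (continuous_const_smul _))
      (G'.continuous.const_smul T) (fun w => by rw [hG, hTd, hTd, hG]) (a0 := E (up UpperHalfPlane.I)) (by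
        show G' (T • E (up UpperHalfPlane.I)) = T • G' (E (up UpperHalfPlane.I))
        rw [← hET, ← hupv, hGE, hKHv, hET, hGE]) w
  refine ⟨T, hT, G', hG, hGT, l, fun z hz => (hl z hz).1, fun z hz => (hl z hz).2.1, fun z hz => ?_, fun z hz => ?_⟩
  · refine loop_chi hE hT hET (hl z hz).1 (hl z hz).2.1 (hlamc z hz) (fun u => by rw [hlame z hz, hpE]) (fun u => ?_)
    simp only [hlam]
    rw [hper, UpperHalfPlane.coe_vadd]; push_cast; ring
  · have hgz : g z ∉ U := fun hh => hz ((hgU z).1 hh)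
    obtain ⟨n, hn⟩ := h.log_lift hz (hl z hz).1 (hl z hz).2.1 (hl _ hgz).1 (hl _ hgz).2.1 hL rfl G'.continuous hG
    suffices hn0 : n = 0 by
      intro w
      rw [hn, hn0]; simp
    have eq : ∀ u, (n : ℂ) * (2 * Real.pi * Complex.I) = -(L (Z u, z) - L (Z u, 0)) + Complex.log (1 - -(g 0) / (g (Z u) - g 0))
        + Complex.log (1 - g z / g (Z u)) - Complex.log (1 - z / Z u) := by
      intro u
      have h1 := hn (E (up u))
      rw [hGE, (hl _ hgz).2.2, (hl z hz).2.2, hpE] at h1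
      simp only [hlam] at h1
      rw [hKHp] at h1
      have h2 : ((KH u : ℍ) : ℂ) = K u := rfl
      rw [h2] at h1
      simp only [hK] at h1
      change _ = (Real.log R : ℂ) - Complex.I * (up u : ℂ) + Complex.log (1 - z / Z u) + L (Z u, z) + _ at h1
      linear_combination -h1 - (L (Z u, 0) + Complex.log (1 - -(g 0) / (g (Z u) - g 0))) * Complex.I_mul_I
    set v : ℕ → ℍ := fun k => ⟨Complex.I * (k + 1), by simp; positivity⟩ with hv
    have hvi : ∀ k, (v k).im = k + 1 := fun k => by
      show (Complex.I * ((k : ℂ) + 1)).im = _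
      simp
    have tZ : Tendsto (fun k => Z (v k)) atTop (Bornology.cobounded ℂ) := by
      rw [← tendsto_norm_atTop_iff_cobounded]
      have : Tendsto (fun k : ℕ => R * Real.exp ((k : ℝ) + 1 + t)) atTop atTop := by
        refine Tendsto.const_mul_atTop hR (Real.tendsto_exp_atTop.comp ?_)
        exact tendsto_atTop_add_const_right _ _ (tendsto_atTop_add_const_right _ _ tendsto_natCast_atTop_atTop)
      refine this.congr fun k => ?_
      simp only [hZ]
      rw [hpn, hupi, hvi]
    have t1 := ((L_inf hL z).comp tZ).neg
    have t2 := log_zero (div_cobounded (-(g 0)) (sub_cobounded (g 0) (hgc.comp tZ)))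
    have t3 := log_zero (div_cobounded (g z) (hgc.comp tZ))
    have t4 := log_zero (div_cobounded z tZ)
    have t5 := ((t1.add t2).add t3).sub t4
    have t6 : Tendsto (fun _ : ℕ => (n : ℂ) * (2 * Real.pi * Complex.I)) atTop (𝓝 (-0 + 0 + 0 - 0)) :=
      t5.congr (fun k => (eq (v k)).symm)
    have t7 := tendsto_nhds_unique tendsto_const_nhds t6
    apply int_two_pi_inj
    rw [t7]; simp

lemma iter_log' {π : ℍ → ℂ} {H : ℍ → ℍ} {g : ℂ → ℂ} {U : Set ℂ} {l : ℂ → ℍ → ℂ} {L : ℂ × ℂ → ℂ} (hH : ∀ w, π (H w) = g (π w))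
    (hgU : ∀ z, z ∉ U → g z ∉ U) (hl : ∀ z, z ∉ U → ∀ w, l (g z) (H w) = l z w + L (π w, z)) (j : ℕ) (z : ℂ) (hz : z ∉ U) (w : ℍ) :
    g^[j] z ∉ U ∧ l (g^[j] z) (H^[j] w) = l z w + LS g L j (π w, z) := by
  induction j with
  | zero => simpa [LS] using hz
  | succ j ih =>
    refine ⟨by rw [Function.iterate_succ_apply']; exact hgU _ ih.1, ?_⟩
    rw [Function.iterate_succ_apply', Function.iterate_succ_apply', hl _ ih.1, ih.2, LS_succ, iter_pi hH, add_assoc]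

theorem step4 {g : ℂ ≃ₜ ℂ} {L : ℂ × ℂ → ℂ} {m : ℕ → ℕ} (hR : RR g L m) (n : ℕ) (hn : 1 ≤ n) (y0 : ℂ) (hy0 : g^[n] y0 = y0) :
    g y0 = y0 := by
  by_contra hne
  set y : ℕ → ℂ := fun i => g^[i] y0 with hy
  have hgy : ∀ i, g (y i) = y (i + 1) := fun i => by simp only [hy, Function.iterate_succ_apply']
  have hyn : ∀ i, y i ≠ y (i + 1) := fun i he => by
    simp only [hy] at he
    rw [Function.iterate_succ_apply] at he
    exact hne (g.injective.iterate i he).symm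
  set Y : Set ℂ := Set.range y with hY
  have hYf : Y.Finite := by
    refine ((Set.finite_lt_nat n).image y).subset ?_
    rintro _ ⟨i, rfl⟩
    refine ⟨i % n, Nat.mod_lt _ (by omega), ?_⟩
    simp only [hy]
    conv_rhs => rw [← Nat.mod_add_div i n, Function.iterate_add_apply, Function.iterate_mul, Function.iterate_fixed hy0]
  have hgY : ∀ z, g z ∈ Y ↔ z ∈ Y := by
    intro z
    constructor
    · rintro ⟨i, hi⟩
      rcases i with _ | i
      · refine ⟨n - 1, g.injective ?_⟩
        rw [hgy, ← hi, Nat.sub_add_cancel hn]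
        exact hy0
      · exact ⟨i, g.injective (by rw [hgy, hi])⟩
    · rintro ⟨i, rfl⟩
      exact ⟨i + 1, (hgy i).symm⟩
  set U : Set ℂ := Yᶜ with hUd
  have hUo : IsOpen U := hYf.isClosed.isOpen_compl
  have hUc : IsConnected U := (hYf.countable.isPathConnected_compl_of_one_lt_rank (by
    rw [Complex.rank_real_complex]; exact Nat.one_lt_ofNat)).isConnected
  have hgU : ∀ z, g z ∈ U ↔ z ∈ U := fun z => not_congr (hgY z)
  have hyU : ∀ i, y i ∉ U := fun i hh => hh ⟨i, rfl⟩
  have hex : ∃ q π, Cov (psi '' U) q ∧ UCov U π ∧ ∀ w : ℍ, psi (π w) = q w := by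
    first
    | exact exists_ucov hUo hUc.isPreconnected hUc.nonempty
    | exact exists_ucov hUo hUc hUc.nonempty
  obtain ⟨q, π, -, h, -⟩ := hex
  obtain ⟨R, hR1⟩ := hYf.isBounded.exists_norm_le
  have hUR : ∀ z, z ∉ U → ‖z‖ < |R| + 1 := fun z hz => by
    have := hR1 z (not_not.1 hz)
    linarith [le_abs_self R]
  obtain ⟨T, hT, G', hG, hGT, l, hl, hle, hTc, hGl⟩ := inf_lift h hR.log hgU (R := |R| + 1) (by positivity) hUR
  obtain ⟨ε, hε, hεY⟩ : ∃ ε > 0, ∀ z, z ∉ U → z ≠ y 0 → ε ≤ ‖z - y 0‖ := by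
    have : IsClosed (Y \ {y 0}) := (hYf.subset Set.sdiff_subset).isClosed
    obtain ⟨ε, hε, hb⟩ := Metric.isOpen_iff.1 this.isOpen_compl (y 0) (by simp)
    refine ⟨ε, hε, fun z hz hzy => ?_⟩
    by_contra hlt
    push Not at hlt
    exact hb (by rwa [mem_ball, dist_eq_norm]) ⟨not_not.1 hz, hzy⟩
  obtain ⟨S, hS, hS1, hS0, r, hr, hrS⟩ := punct_loop h hε hεY (hyU 0) hl hle
  have hTn : ¬ Triv T := by
    intro ht
    have := (hTc _ (hyU 0)).triv ht
    omega
  choose gp hgp using fun n => exists_iter_homeo g n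
  have hrc : CC (fun k => gp (m k)) := by
    have := hR.rc
    simpa only [hgp] using this
  have hUinv : ∀ k, ∀ z, gp (m k) z ∈ U ↔ z ∈ U := by
    intro k z
    rw [hgp]
    induction m k with
    | zero => rfl
    | succ n ih => rw [Function.iterate_succ_apply', hgU, ih]
  obtain ⟨H, hH, hcc⟩ := h.near hrc (Eventually.of_forall hUinv)
  have hmpos : ∀ᶠ k in atTop, 1 ≤ m k := hR.mt.eventually (eventually_ge_atTop 1)
  have hfix : ∀ᶠ k in atTop, gp (m k) (y 0) = y 0 := by
    have h1 := (hrc.at (tendsto_const_nhds (x := y 0))).eventually (Metric.ball_mem_nhds _ hε)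
    filter_upwards [h1] with k hk
    by_contra hn
    have := hεY _ (fun hh => hyU 0 ((hUinv k _).1 hh)) hn
    rw [dist_eq_norm] at hk
    linarith
  have c1 := h.near_comm (g := fun k => gp (m k)) hH hcc hT
  have c2 := h.near_comm (g := fun k => gp (m k)) hH hcc hS
  have c3 := h.near_log (hyU 0) (hl _ (hyU 0)) (hle _ (hyU 0)) (g := fun k => gp (m k)) (M := fun k => LS g L (m k))
    (fun k => by
      show IsLog _ (gp (m k)) _
      rw [hgp]; exact hR.log.iterate g.continuous g.injective _) hfix hH hcc (fun x hx => hR.lc x _ hx)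
  obtain ⟨k, hk1, hkH, hkm, hkT, hkS, hkl⟩ := (hfix.and (hH.and (hmpos.and (c1.and (c2.and c3))))).exists
  have hpi : ∀ w, π (H k w) = π (G'^[m k] w) := by
    intro w
    rw [hkH, iter_pi hG, hgp]
  obtain ⟨S0, hS01, hS02⟩ := h.deck (hpi UpperHalfPlane.I)
  have hS0e : ∀ w, G'^[m k] w = S0 • H k w := fun w =>
    h.uniq (F := fun w => G'^[m k] w) (G := fun w => S0 • H k w) (G'.continuous.iterate _)
      ((H k).continuous.const_smul S0) (fun w => by rw [hS02, hpi]) (a0 := UpperHalfPlane.I) hS01.symm w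
  have hcm : Cm S0 T := by
    intro u
    obtain ⟨v, rfl⟩ := (H k).surjective u
    rw [← hkT, ← hS0e, iter_comm hGT, hS0e]
  have hchi : Chi (l (y 0)) S0 0 := by
    intro u
    obtain ⟨v, rfl⟩ := (H k).surjective u
    rw [← hS0e, hkl]
    have := (iter_log' hG (fun z hz hh => hz ((hgU z).1 hh)) hGl (m k) (y 0) (hyU 0) v).2
    rw [← hgp, hk1] at this
    rw [this]; simp
  obtain ⟨a, j, ha, haj, hj⟩ := lemC_chi h.disc hT hS02 hTn hcm
  have e := haj _ _ _ hchi (hTc _ (hyU 0))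
  have htr := hj (by omega)
  have hGH : ∀ w, G'^[m k] w = H k w := fun w => by rw [hS0e, htr]
  exact step4_core h hR.log hgU hyU hgy hyn hG hT hGT hl hle hTc hS hS1 hS0 hr hrS hkm (fun w => by rw [hGH, hGH, hkS])


lemma CC.quot {h : ℕ → ℂ → ℂ} (hh : CC h) {K : Set (ℂ × ℂ)} (hK : IsCompact K) (hKO : K ⊆ OD ℂ) {V : Set ℂ} (hV : V ∈ 𝓝 (1:ℂ)) :
    ∀ᶠ k in atTop, ∀ p ∈ K, (h k p.1 - h k p.2) / (p.1 - p.2) ∈ V := by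
  suffices hP : ∀ p ∈ K, ∀ᶠ q : ℕ × (ℂ × ℂ) in atTop ×ˢ 𝓝 p, (h q.1 q.2.1 - h q.1 q.2.2) / (q.2.1 - q.2.2) ∈ V by
    simp only [← eventually_iSup, ← hK.prod_nhdsSet_eq_biSup] at hP
    exact hP.curry.mono fun _ h => h.self_of_nhdsSet
  intro p hp
  have hne : p.1 - p.2 ≠ 0 := sub_ne_zero.2 (hKO hp)
  have t1 : Tendsto (fun q : ℕ × (ℂ × ℂ) => h q.1 q.2.1) (atTop ×ˢ 𝓝 p) (𝓝 p.1) :=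
    (hh p.1).comp (tendsto_fst.prodMk ((continuous_fst.tendsto p).comp tendsto_snd))
  have t2 : Tendsto (fun q : ℕ × (ℂ × ℂ) => h q.1 q.2.2) (atTop ×ˢ 𝓝 p) (𝓝 p.2) :=
    (hh p.2).comp (tendsto_fst.prodMk ((continuous_snd.tendsto p).comp tendsto_snd))
  have t3 : Tendsto (fun q : ℕ × (ℂ × ℂ) => q.2.1 - q.2.2) (atTop ×ˢ 𝓝 p) (𝓝 (p.1 - p.2)) :=
    ((continuous_fst.sub continuous_snd).tendsto p).comp tendsto_snd
  have t4 := (t1.sub t2).div t3 hne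
  rw [div_self hne] at t4
  exact t4.eventually hV

lemma one_slit_nhds : Complex.slitPlane ∈ 𝓝 (1:ℂ) := Complex.isOpen_slitPlane.mem_nhds (by simp)

section
variable {φ : ℂ ≃ₜ ℂ} {M : ℂ × ℂ → ℂ}

lemma sq_log (hMc : ContinuousOn M (OD ℂ)) (hM : ∀ a b, a ≠ b → Complex.exp (M (a, b)) * (starRingEnd ℂ) (a - b) = φ a - φ b) :
    IsLog (fun z : ℂ => z) (φ.trans φ) (fun p => M (φ p.1, φ p.2) + (starRingEnd ℂ) (M p)) := by
  have hm : Set.MapsTo (fun p : ℂ × ℂ => (φ p.1, φ p.2)) (OD ℂ) (OD ℂ) := fun p hp h => hp (φ.injective h)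
  refine ⟨(hMc.comp (by fun_prop) hm).add (Complex.continuous_conj.comp_continuousOn hMc), fun x y hxy => ?_⟩
  have h1 := hM x y hxy
  have h2 := hM (φ x) (φ y) (fun h => hxy (φ.injective h))
  simp only [Homeomorph.trans_apply]
  rw [← h2, ← h1, map_mul, Complex.conj_conj, Complex.exp_add, ← Complex.exp_conj]
  ring

lemma iter_sq (j : ℕ) (z : ℂ) : (φ.trans φ)^[j] z = φ^[2 * j] z := by
  rw [Function.iterate_mul]
  rfl

lemma ev_even (hMc : ContinuousOn M (OD ℂ)) (hM : ∀ a b, a ≠ b → Complex.exp (M (a, b)) * (starRingEnd ℂ) (a - b) = φ a - φ b)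
    {n : ℕ → ℕ} (hc : CC (fun k => φ^[n k])) : ∀ᶠ k in atTop, Even (n k) := by
  set γ : ℝ → ℂ × ℂ := fun t => (Complex.exp (t * Complex.I), 0) with hγ
  have hγc : Continuous γ := by simp only [hγ]; fun_prop
  have hper : γ (2 * Real.pi) = γ 0 := by simp [hγ]
  have hγO : ∀ t, γ t ∈ OD ℂ := fun t => Complex.exp_ne_zero _
  have h1 := hc.quot (K := γ '' Set.Icc 0 (2 * Real.pi)) (isCompact_Icc.image hγc) (by rintro _ ⟨t, -, rfl⟩; exact hγO t) one_slit_nhds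
  filter_upwards [h1] with k hk
  by_contra hodd
  rw [Nat.not_even_iff_odd] at hodd
  obtain ⟨j, hj⟩ := hodd
  have hlog := (sq_log hMc hM).iterate (φ.trans φ).continuous (φ.trans φ).injective j
  set L := fun p : ℂ × ℂ => M (φ p.1, φ p.2) + (starRingEnd ℂ) (M p)
  set W : ℂ × ℂ → ℂ := fun p => LS (φ.trans φ) L j (φ p.1, φ p.2) + M p with hW
  have hm : Set.MapsTo (fun p : ℂ × ℂ => (φ p.1, φ p.2)) (OD ℂ) (OD ℂ) := fun p hp h => hp (φ.injective h)
  have hWc : ContinuousOn W (OD ℂ) := (hlog.1.comp (by fun_prop) hm).add hMc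
  have hWe : ∀ a b, a ≠ b → Complex.exp (W (a, b)) * (starRingEnd ℂ) (a - b) = φ^[n k] a - φ^[n k] b := by
    intro a b hab
    have e1 := hlog.2 (φ a) (φ b) (fun h => hab (φ.injective h))
    simp only [iter_sq] at e1
    rw [hj]
    show _ = φ^[2 * j] (φ a) - φ^[2 * j] (φ b)
    rw [← e1, ← hM a b hab, hW]
    simp only
    rw [Complex.exp_add]; ring
  obtain ⟨c, hcc⟩ := clog_diff_const (isPreconnected_Icc (a := (0:ℝ)) (b := 2 * Real.pi)) (fun t => W (γ t) - 2 * (t * Complex.I))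
    (fun t => Complex.log ((φ^[n k] (γ t).1 - φ^[n k] (γ t).2) / ((γ t).1 - (γ t).2)))
    ((hWc.comp_continuous hγc hγO).sub (by fun_prop)).continuousOn
    (ContinuousOn.clog (by
      have hit : Continuous φ^[n k] := φ.continuous.iterate _
      refine Continuous.continuousOn ?_
      refine Continuous.div ((hit.comp (continuous_fst.comp hγc)).sub (hit.comp (continuous_snd.comp hγc)))
        ((continuous_fst.comp hγc).sub (continuous_snd.comp hγc)) (fun t => sub_ne_zero.2 (hγO t))) (fun t ht => hk _ ⟨t, ht, rfl⟩))
    (fun t ht => by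
      have s := Complex.slitPlane_ne_zero (hk _ ⟨t, ht, rfl⟩)
      rw [Complex.exp_log s, ← hWe _ _ (hγO t)]
      simp only [hγ, sub_zero]
      rw [← Complex.exp_conj, eq_div_iff (Complex.exp_ne_zero _), ← Complex.exp_add, ← Complex.exp_add]
      congr 1
      simp
      ring)
  have hpi : (0:ℝ) ≤ 2 * Real.pi := by positivity
  have e0 := hcc 0 ⟨le_rfl, hpi⟩
  have e1 := hcc (2 * Real.pi) ⟨hpi, le_rfl⟩
  simp only [hper] at e1
  have : (2 * (((2 * Real.pi : ℝ) : ℂ) * Complex.I)) = 0 := by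
    have e2 : (2 * (((0 : ℝ) : ℂ) * Complex.I)) = 0 := by simp
    linear_combination e0 - e1 + e2
  simp [Real.pi_ne_zero] at this

lemma LS_conj (j : ℕ) (x y : ℂ) :
    LS (φ.trans φ) (fun p => M (φ p.1, φ p.2) + (starRingEnd ℂ) (M p)) j (φ x, φ y)
      - (starRingEnd ℂ) (LS (φ.trans φ) (fun p => M (φ p.1, φ p.2) + (starRingEnd ℂ) (M p)) j (x, y))
      = M ((φ.trans φ)^[j] x, (φ.trans φ)^[j] y) - M (x, y) := by
  have hcomm : ∀ j z, (φ.trans φ)^[j] (φ z) = φ ((φ.trans φ)^[j] z) := by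
    intro j z
    rw [iter_sq, iter_sq, ← Function.iterate_succ_apply, Function.iterate_succ_apply']
  induction j with
  | zero => simp [LS]
  | succ j ih =>
    rw [LS_succ, LS_succ, map_add]
    simp only [hcomm, map_add, Complex.conj_conj, Function.iterate_succ_apply', Homeomorph.trans_apply] at ih ⊢
    linear_combination ih

theorem plane_main (hMc : ContinuousOn M (OD ℂ)) (hM : ∀ a b, a ≠ b → Complex.exp (M (a, b)) * (starRingEnd ℂ) (a - b) = φ a - φ b)
    {n : ℕ → ℕ} (hn : Tendsto n atTop atTop) (hc : CC (fun k => φ^[n k])) (z : ℂ) : φ (φ z) = z := by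
  set L : ℂ × ℂ → ℂ := fun p => M (φ p.1, φ p.2) + (starRingEnd ℂ) (M p) with hL
  have hlog : IsLog (fun z : ℂ => z) (φ.trans φ) L := sq_log hMc hM
  have hev := ev_even hMc hM hc
  have hrc : CC (fun k => (φ.trans φ)^[n k / 2]) := by
    intro x
    refine (hc x).congr' ?_
    have : ∀ᶠ q : ℕ × ℂ in atTop ×ˢ 𝓝 x, Even (n q.1) := tendsto_fst.eventually hev
    filter_upwards [this] with q hq
    rw [iter_sq, Nat.two_mul_div_two_of_even hq]
  have hR : RR (φ.trans φ) L (fun k => n k / 2) := by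
    refine ⟨hlog, ?_, hrc, ?_⟩
    · exact (Nat.tendsto_div_const_atTop (by norm_num)).comp hn
    intro x y hxy
    have hO : (φ x, φ y) ∈ OD ℂ := fun h => hxy (φ.injective h)
    have hpc : IsPathConnected (OD ℂ) := OD_open.isConnected_iff_isPathConnected.1 ⟨⟨_, hO⟩, isPreconnected_OD_complex⟩
    obtain ⟨γ, hγ⟩ := hpc.joinedIn (x, y) hxy _ hO
    set Q : ℕ → ℂ × ℂ → ℂ := fun k p => ((φ.trans φ)^[n k / 2] p.1 - (φ.trans φ)^[n k / 2] p.2) / (p.1 - p.2) with hQ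
    have hq1 : ∀ p ∈ OD ℂ, Tendsto (fun k => Complex.log (Q k p)) atTop (𝓝 0) := by
      intro p hp
      have hne : p.1 - p.2 ≠ 0 := sub_ne_zero.2 hp
      have t := (((hrc.at (tendsto_const_nhds (x := p.1))).sub (hrc.at (tendsto_const_nhds (x := p.2)))).div_const (p.1 - p.2))
      rw [div_self hne] at t
      simpa using t.clog (by simp)
    have h1 := hrc.quot (K := Set.range γ) (isCompact_range γ.continuous) (by rintro _ ⟨t, rfl⟩; exact hγ t) one_slit_nhds
    have hck : ∀ k, ∃ c : ℤ, (∀ p ∈ Set.range γ, Q k p ∈ Complex.slitPlane) → ∀ p ∈ Set.range γ, LS (φ.trans φ) L (n k / 2) p = Complex.log (Q k p) + c * (2 * Real.pi * Complex.I) := by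
      intro k
      by_cases hk : ∀ p ∈ Set.range γ, Q k p ∈ Complex.slitPlane
      · have hl := hlog.iterate (φ.trans φ).continuous (φ.trans φ).injective (n k / 2)
        have hit : Continuous (φ.trans φ)^[n k / 2] := (φ.trans φ).continuous.iterate _
        have hsub : Set.range γ ⊆ OD ℂ := by rintro _ ⟨t, rfl⟩; exact hγ t
        obtain ⟨c, hcc⟩ := clog_diff_const (isPreconnected_range γ.continuous) (LS (φ.trans φ) L (n k / 2)) (fun p => Complex.log (Q k p))
          (hl.1.mono hsub) (ContinuousOn.clog (ContinuousOn.div (by fun_prop) (by fun_prop) (fun p hp => sub_ne_zero.2 (hsub hp))) hk)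
          (fun p hp => by
            rw [Complex.exp_log (Complex.slitPlane_ne_zero (hk p hp)), eq_div_iff (sub_ne_zero.2 (hsub hp))]
            exact hl.2 _ _ (hsub hp))
        exact ⟨c, fun _ => hcc⟩
      · exact ⟨0, fun h => absurd h hk⟩
    choose c hcc using hck
    have m1 : (x, y) ∈ Set.range γ := ⟨0, by simp⟩
    have m2 : (φ x, φ y) ∈ Set.range γ := ⟨1, by simp⟩
    have tM : Tendsto (fun k => M ((φ.trans φ)^[n k / 2] x, (φ.trans φ)^[n k / 2] y) - M (x, y)) atTop (𝓝 0) := by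
      have hcont : ContinuousAt M (x, y) := hMc.continuousAt (OD_open.mem_nhds hxy)
      have := hcont.tendsto.comp ((hrc.at (tendsto_const_nhds (x := x))).prodMk_nhds (hrc.at (tendsto_const_nhds (x := y))))
      simpa using this.sub_const (M (x, y))
    have tc : Tendsto (fun k => ((2 * c k : ℤ) : ℂ) * (2 * Real.pi * Complex.I)) atTop (𝓝 0) := by
      have t2 := (tM.sub (hq1 _ hO)).add ((Complex.continuous_conj.tendsto _).comp (hq1 _ (show ((x, y) : ℂ × ℂ) ∈ OD ℂ from hxy)))
      simp only [map_zero, sub_zero, add_zero] at t2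
      refine t2.congr' ?_
      filter_upwards [h1] with k hk
      have e1 := hcc k hk _ m1
      have e2 := hcc k hk _ m2
      have e3 := LS_conj (φ := φ) (M := M) (n k / 2) x y
      rw [← hL, e1, e2] at e3
      simp only [map_add, map_mul, Complex.conj_I, Complex.conj_ofReal, map_ofNat, map_intCast] at e3
      simp only [Function.comp]
      push_cast
      linear_combination -e3
    have hc0 : ∀ᶠ k in atTop, c k = 0 := by
      have := Metric.tendsto_nhds.1 tc 1 one_pos
      filter_upwards [this] with k hk
      rw [dist_zero_right] at hk
      by_contra hne
      have h1 : (1:ℝ) ≤ |(c k : ℝ)| := by exact_mod_cast Int.one_le_abs hne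
      simp at hk
      rw [abs_of_pos Real.pi_pos] at hk
      nlinarith [Real.pi_gt_three]
    refine (hq1 _ (show ((x, y) : ℂ × ℂ) ∈ OD ℂ from hxy)).congr' ?_
    filter_upwards [h1, hc0] with k hk hk0
    rw [hcc k hk _ m1, hk0]; simp
  exact step5 hR (step4 hR) z
end


lemma plane_deg (φ : ℂ ≃ₜ ℂ) : ∃ (d : ℤ) (M : ℂ × ℂ → ℂ), ContinuousOn M (OD ℂ) ∧
    ∀ a b, a ≠ b → Complex.exp (M (a, b)) * (a - b) ^ d = φ a - φ b := by
  set J : ℂ × ℂ → ℂ × ℂ := fun p => (p.1 + Complex.exp p.2, p.1) with hJ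
  have hJc : Continuous J := by fun_prop
  have hJm : ∀ p, J p ∈ OD ℂ := fun p h => Complex.exp_ne_zero p.2 (by simpa [hJ] using h)
  obtain ⟨lam, hlc, hl⟩ := exists_clog (fun p => φ (J p).1 - φ (J p).2)
    (by fun_prop) (fun p => sub_ne_zero.2 (fun h => hJm p (φ.injective h)))
  obtain ⟨d, hd⟩ := clog_diff_const (s := Set.univ) isPreconnected_univ
    (fun p : ℂ × ℂ => lam (p.1, p.2 + 2 * Real.pi * Complex.I)) lam (by fun_prop) hlc.continuousOn
    (fun p _ => by simp [hl, hJ, Complex.exp_periodic p.2])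
  set M : ℂ × ℂ → ℂ := fun p => lam p - d * p.2 with hMdef
  have hMc : Continuous M := by fun_prop
  have hper : ∀ y s s', Complex.exp s = Complex.exp s' → M (y, s) = M (y, s') := by
    have h1 : ∀ y s, M (y, s + 2 * Real.pi * Complex.I) = M (y, s) := by
      intro y s
      have := hd (y, s) trivial
      simp only [hMdef]
      linear_combination this
    intro y s s' h
    obtain ⟨n, hn⟩ := Complex.exp_eq_exp_iff_exists_int.1 h
    have hp : Function.Periodic (fun s => M (y, s)) (2 * Real.pi * Complex.I) := fun s => h1 y s
    have := hp.int_mul n s'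
    rw [hn]; exact this
  refine ⟨d, fun p => M (p.2, Complex.log (p.1 - p.2)), ?_, ?_⟩
  · intro p hp
    apply ContinuousAt.continuousWithinAt
    have hp' : p.1 - p.2 ≠ 0 := sub_ne_zero.2 hp
    by_cases hs : p.1 - p.2 ∈ Complex.slitPlane
    · have : ContinuousAt (fun p : ℂ × ℂ => Complex.log (p.1 - p.2)) p :=
        ContinuousAt.clog (by fun_prop) hs
      exact hMc.continuousAt.comp (continuousAt_snd.prodMk this)
    · have hs' : p.2 - p.1 ∈ Complex.slitPlane := by
        rcases Complex.mem_slitPlane_or_neg_mem_slitPlane hp' with h | h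
        · exact absurd h hs
        · simpa using h
      have : ContinuousAt (fun p : ℂ × ℂ => Complex.log (p.2 - p.1) + Real.pi * Complex.I) p :=
        ContinuousAt.add (ContinuousAt.clog (f := fun p : ℂ × ℂ => p.2 - p.1) (by fun_prop) hs') continuousAt_const
      have h2 : ContinuousAt (fun p : ℂ × ℂ => M (p.2, Complex.log (p.2 - p.1) + Real.pi * Complex.I)) p :=
        hMc.continuousAt.comp (continuousAt_snd.prodMk this)
      refine h2.congr ?_
      filter_upwards [OD_open.mem_nhds hp] with q hq
      have hq' : q.1 - q.2 ≠ 0 := sub_ne_zero.2 hq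
      have hq'' : q.2 - q.1 ≠ 0 := sub_ne_zero.2 (Ne.symm hq)
      apply hper
      rw [Complex.exp_add, Complex.exp_log hq', Complex.exp_log hq'', Complex.exp_pi_mul_I]
      ring
  · intro a b hab
    have hp' : a - b ≠ 0 := sub_ne_zero.2 hab
    have h3 := hl (b, Complex.log (a - b))
    simp only [hJ, Complex.exp_log hp', add_sub_cancel] at h3
    simp only [hMdef]
    rw [Complex.exp_sub, h3, Complex.exp_int_mul, Complex.exp_log hp', div_mul_cancel₀ _ (zpow_ne_zero _ hp')]

lemma plane_deg_pm {φ : ℂ ≃ₜ ℂ} {d d' : ℤ} {M M' : ℂ × ℂ → ℂ} (hMc : ContinuousOn M (OD ℂ))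
    (hM : ∀ a b, a ≠ b → Complex.exp (M (a, b)) * (a - b) ^ d = φ a - φ b)
    (hMc' : ContinuousOn M' (OD ℂ))
    (hM' : ∀ a b, a ≠ b → Complex.exp (M' (a, b)) * (a - b) ^ d' = φ.symm a - φ.symm b) : d * d' = 1 := by
  set γ : ℝ → ℂ × ℂ := fun t => (Complex.exp (t * Complex.I), 0) with hγ
  have hγc : Continuous γ := by simp only [hγ]; fun_prop
  have hper : γ (2 * Real.pi) = γ 0 := by simp [hγ]
  have hγO : ∀ t, γ t ∈ OD ℂ := fun t => Complex.exp_ne_zero _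
  have hm : Set.MapsTo (fun p : ℂ × ℂ => (φ p.1, φ p.2)) (OD ℂ) (OD ℂ) := fun p hp h => hp (φ.injective h)
  set W : ℂ × ℂ → ℂ := fun p => M' (φ p.1, φ p.2) + d' * M p with hW
  have hWc : ContinuousOn W (OD ℂ) := (hMc'.comp (by fun_prop) hm).add (continuousOn_const.mul hMc)
  have hWe : ∀ a b, a ≠ b → Complex.exp (W (a, b)) * (a - b) ^ (d * d') = a - b := by
    intro a b hab
    have h1 := hM a b hab
    have h2 := hM' (φ a) (φ b) (fun h => hab (φ.injective h))
    simp only [Homeomorph.symm_apply_apply] at h2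
    rw [← h1, mul_zpow, ← zpow_mul, ← Complex.exp_int_mul] at h2
    simp only [hW, Complex.exp_add]
    linear_combination h2
  obtain ⟨c, hcc⟩ := clog_diff_const (s := Set.univ) isPreconnected_univ
    (fun t : ℝ => W (γ t) + (d * d' : ℤ) * (t * Complex.I)) (fun t => t * Complex.I)
    ((hWc.comp_continuous hγc hγO).add (by fun_prop)).continuousOn
    (by fun_prop)
    (fun t _ => by
      have := hWe _ _ (hγO t)
      simp only [hγ, sub_zero] at this
      rw [Complex.exp_add, Complex.exp_int_mul]
      exact this)
  have e0 := hcc 0 trivial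
  have e1 := hcc (2 * Real.pi) trivial
  simp only [hper] at e1
  have e2 : (((d * d' : ℤ) : ℂ) - 1) * (2 * Real.pi * Complex.I) = 0 := by
    push_cast at e0 e1 ⊢
    linear_combination e1 - e0
  have e3 := (mul_eq_zero.1 e2).resolve_right Complex.two_pi_I_ne_zero
  have e4 : ((d * d' : ℤ) : ℂ) = ((1 : ℤ) : ℂ) := by push_cast at e3 ⊢; linear_combination e3
  exact_mod_cast e4

/-- either orientation preserving or reversing -/
lemma plane_dichotomy (φ : ℂ ≃ₜ ℂ) : ∃ M : ℂ × ℂ → ℂ, ContinuousOn M (OD ℂ) ∧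
    ((∀ a b, a ≠ b → Complex.exp (M (a, b)) * (a - b) = φ a - φ b) ∨
     (∀ a b, a ≠ b → Complex.exp (M (a, b)) * (starRingEnd ℂ) (a - b) = φ a - φ b)) := by
  obtain ⟨d, M, hMc, hM⟩ := plane_deg φ
  obtain ⟨d', M', hMc', hM'⟩ := plane_deg φ.symm
  have hdd := plane_deg_pm hMc hM hMc' hM'
  rcases Int.eq_one_or_neg_one_of_mul_eq_one hdd with rfl | rfl
  · exact ⟨M, hMc, Or.inl (fun a b hab => by simpa using hM a b hab)⟩
  · refine ⟨fun p => M p - 2 * (Real.log ‖p.1 - p.2‖ : ℝ), hMc.sub (continuousOn_const.mul ?_), Or.inr (fun a b hab => ?_)⟩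
    · refine Complex.continuous_ofReal.comp_continuousOn (ContinuousOn.log (by fun_prop) (fun p hp => norm_ne_zero_iff.2 (sub_ne_zero.2 hp)))
    · have hne : a - b ≠ 0 := sub_ne_zero.2 hab
      rw [← hM a b hab]
      have e : Complex.exp (2 * (Real.log ‖a - b‖ : ℝ)) = (starRingEnd ℂ) (a - b) * (a - b) := by
        rw [← Complex.normSq_eq_conj_mul_self, Complex.normSq_eq_norm_sq]
        rw [show (2 : ℂ) * (Real.log ‖a - b‖ : ℝ) = ((2 : ℕ) : ℂ) * (Real.log ‖a - b‖ : ℝ) by norm_num, Complex.exp_nat_mul, ← Complex.ofReal_exp, Real.exp_log (norm_pos_iff.2 hne)]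
        push_cast; rfl
      have hc : (starRingEnd ℂ) (a - b) ≠ 0 := (map_ne_zero _).2 hne
      simp only [Complex.exp_sub, e]
      rw [zpow_neg_one]
      field_simp


section
variable {φ : ℂ ≃ₜ ℂ} {M : ℂ × ℂ → ℂ}

noncomputable def GH (M : ℂ × ℂ → ℂ) (t : ℝ) (z : ℂ) : ℂ := z * Complex.exp (t * M (z, 0))

lemma exp_le_interp {t r : ℝ} (h0 : 0 ≤ t) (h1 : t ≤ 1) : Real.exp (t * r) ≤ 1 + Real.exp r := by
  have hr := Real.exp_pos r
  rcases le_total 0 r with h | h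
  · have : Real.exp (t * r) ≤ Real.exp r := Real.exp_le_exp.2 (by nlinarith)
    linarith
  · have : Real.exp (t * r) ≤ 1 := Real.exp_le_one_iff.2 (by nlinarith)
    linarith

lemma interp_le_exp {t r : ℝ} (h0 : 0 ≤ t) (h1 : t ≤ 1) : min 1 (Real.exp r) ≤ Real.exp (t * r) := by
  rcases le_total 0 r with h | h
  · exact (min_le_left _ _).trans (Real.one_le_exp (by positivity))
  · exact (min_le_right _ _).trans (Real.exp_le_exp.2 (by nlinarith))

lemma GH_norm (t : ℝ) (z : ℂ) : ‖GH M t z‖ = ‖z‖ * Real.exp (t * (M (z, 0)).re) := by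
  rw [GH, norm_mul, Complex.norm_exp]; simp

lemma GH_one (hM : ∀ a b, a ≠ b → Complex.exp (M (a, b)) * (a - b) = φ a - φ b) (z : ℂ) : GH M 1 z = φ z - φ 0 := by
  by_cases hz : z = 0
  · simp [hz, GH]
  · rw [← hM z 0 hz, GH]; simp [mul_comm]

lemma GH_norm_one (hM : ∀ a b, a ≠ b → Complex.exp (M (a, b)) * (a - b) = φ a - φ b) (z : ℂ) :
    ‖z‖ * Real.exp (M (z, 0)).re = ‖φ z - φ 0‖ := by
  rw [← GH_one hM, GH_norm]; simp

lemma GH_zero (z : ℂ) : GH M 0 z = z := by simp [GH]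

lemma GH_le (hM : ∀ a b, a ≠ b → Complex.exp (M (a, b)) * (a - b) = φ a - φ b) {t : ℝ} (h0 : 0 ≤ t) (h1 : t ≤ 1) (z : ℂ) :
    ‖GH M t z‖ ≤ ‖z‖ + ‖φ z - φ 0‖ := by
  rw [← GH_norm_one hM, GH_norm]
  nlinarith [mul_le_mul_of_nonneg_left (exp_le_interp (r := (M (z, 0)).re) h0 h1) (norm_nonneg z)]

lemma GH_ge (hM : ∀ a b, a ≠ b → Complex.exp (M (a, b)) * (a - b) = φ a - φ b) {t : ℝ} (h0 : 0 ≤ t) (h1 : t ≤ 1) (z : ℂ) :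
    min ‖z‖ ‖φ z - φ 0‖ ≤ ‖GH M t z‖ := by
  rw [← GH_norm_one hM, GH_norm]
  have := mul_le_mul_of_nonneg_left (interp_le_exp (r := (M (z, 0)).re) h0 h1) (norm_nonneg z)
  rwa [mul_min_of_nonneg _ _ (norm_nonneg z), mul_one] at this

lemma GH_cont (hMc : ContinuousOn M (OD ℂ)) (hM : ∀ a b, a ≠ b → Complex.exp (M (a, b)) * (a - b) = φ a - φ b) :
    Continuous (fun p : unitInterval × ℂ => GH M p.1 p.2) := by
  rw [continuous_iff_continuousAt]
  rintro ⟨t, z⟩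
  by_cases hz : z = 0
  · subst hz
    have e : GH M t 0 = 0 := by simp [GH]
    unfold ContinuousAt
    simp only [e]
    rw [tendsto_zero_iff_norm_tendsto_zero]
    have hb : Tendsto (fun p : unitInterval × ℂ => ‖p.2‖ + ‖φ p.2 - φ 0‖) (𝓝 (t, 0)) (𝓝 0) := by
      have : Continuous (fun p : unitInterval × ℂ => ‖p.2‖ + ‖φ p.2 - φ 0‖) := by fun_prop
      simpa using this.tendsto (t, 0)
    exact squeeze_zero (fun _ => norm_nonneg _) (fun p => GH_le hM p.1.2.1 p.1.2.2 p.2) hb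
  · have h1 : ContinuousAt M ((fun p : unitInterval × ℂ => (p.2, (0:ℂ))) (t, z)) := hMc.continuousAt (OD_open.mem_nhds hz)
    have h2 : ContinuousAt (fun p : unitInterval × ℂ => M (p.2, 0)) (t, z) :=
      ContinuousAt.comp (f := fun p : unitInterval × ℂ => (p.2, (0:ℂ))) h1 (by fun_prop)
    unfold GH
    fun_prop

noncomputable def HH (φ : ℂ ≃ₜ ℂ) (M : ℂ × ℂ → ℂ) (p : unitInterval × OnePoint ℂ) : OnePoint ℂ :=
  OnePoint.map (fun z => GH M p.1 z + (p.1 : ℝ) * φ 0) p.2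

lemma HH_cont (hMc : ContinuousOn M (OD ℂ)) (hM : ∀ a b, a ≠ b → Complex.exp (M (a, b)) * (a - b) = φ a - φ b) :
    Continuous (HH φ M) := by
  have hG := GH_cont hMc hM
  rw [continuous_iff_continuousAt]
  rintro ⟨t, w⟩
  induction w using OnePoint.rec with
  | coe z =>
    have ho : IsOpenEmbedding (Prod.map id (fun z : ℂ => (z : OnePoint ℂ)) : unitInterval × ℂ → unitInterval × OnePoint ℂ) :=
      IsOpenEmbedding.id.prodMap OnePoint.isOpenEmbedding_coe
    have : ContinuousAt (HH φ M ∘ Prod.map id (fun z : ℂ => (z : OnePoint ℂ))) (t, z) := by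
      have hc : Continuous (fun p : unitInterval × ℂ => ((GH M p.1 p.2 + ((p.1 : ℝ) : ℂ) * φ 0 : ℂ) : OnePoint ℂ)) :=
        OnePoint.continuous_coe.comp (hG.add (by fun_prop))
      exact hc.continuousAt
    exact ho.continuousAt_iff.1 this
  | infty =>
    show Tendsto (HH φ M) (𝓝 (t, OnePoint.infty)) (𝓝 OnePoint.infty)
    rw [nhds_prod_eq, OnePoint.nhds_infty_eq, prod_sup, tendsto_sup]
    constructor
    · rw [← OnePoint.nhds_infty_eq, prod_map_right, tendsto_map'_iff]
      have hc : Tendsto (fun p : unitInterval × ℂ => GH M p.1 p.2 + ((p.1 : ℝ) : ℂ) * φ 0) (𝓝 t ×ˢ Bornology.cobounded ℂ) (Bornology.cobounded ℂ) := by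
        rw [← tendsto_norm_atTop_iff_cobounded]
        have t1 : Tendsto (fun p : unitInterval × ℂ => ‖p.2‖) (𝓝 t ×ˢ Bornology.cobounded ℂ) atTop :=
          tendsto_norm_cobounded_atTop.comp tendsto_snd
        have t2 : Tendsto (fun p : unitInterval × ℂ => ‖φ p.2 - φ 0‖) (𝓝 t ×ˢ Bornology.cobounded ℂ) atTop :=
          (tendsto_norm_cobounded_atTop.comp (sub_cobounded (φ 0) (homeo_cobounded φ))).comp tendsto_snd
        have t3 : Tendsto (fun p : unitInterval × ℂ => min ‖p.2‖ ‖φ p.2 - φ 0‖) (𝓝 t ×ˢ Bornology.cobounded ℂ) atTop := by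
          rw [Filter.tendsto_atTop] at t1 t2 ⊢
          intro b
          filter_upwards [t1 b, t2 b] with p h1 h2 using le_min h1 h2
        refine tendsto_atTop_mono (fun p => ?_) (tendsto_atTop_add_const_right _ (-‖φ 0‖) t3)
        have g1 := GH_ge hM p.1.2.1 p.1.2.2 p.2
        have g2 := norm_sub_le (GH M p.1 p.2 + ((p.1 : ℝ) : ℂ) * φ 0) (((p.1 : ℝ) : ℂ) * φ 0)
        have g3 : ‖((p.1 : ℝ) : ℂ) * φ 0‖ ≤ ‖φ 0‖ := by
          rw [norm_mul, Complex.norm_real, Real.norm_of_nonneg p.1.2.1]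
          exact mul_le_of_le_one_left (norm_nonneg _) p.1.2.2
        rw [add_sub_cancel_right] at g2
        linarith
      have hco : coclosedCompact ℂ = Bornology.cobounded ℂ := by
        rw [coclosedCompact_eq_cocompact, Metric.cobounded_eq_cocompact]
      rw [hco]
      have hinf : Tendsto (fun z : ℂ => (z : OnePoint ℂ)) (Bornology.cobounded ℂ) (𝓝 OnePoint.infty) := by
        rw [← hco, OnePoint.nhds_infty_eq]; exact tendsto_map.mono_right le_sup_left
      exact hinf.comp hc
    · rw [prod_pure, tendsto_map'_iff]
      refine Tendsto.congr (f₁ := fun _ => OnePoint.infty) (fun s => rfl) ?_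
      rw [← OnePoint.nhds_infty_eq]
      exact tendsto_const_nhds
end

theorem sphere_main (f : (Metric.sphere (0 : EuclideanSpace ℝ (Fin 3)) 1) ≃ₜ (Metric.sphere (0 : EuclideanSpace ℝ (Fin 3)) 1))
    {n : ℕ → ℕ} (hn : Tendsto n atTop atTop)
    (hrec : ∀ ε > 0, ∀ᶠ k in atTop, ∀ x, dist (f^[n k] x) x < ε)
    (hor : ¬ ContinuousMap.Homotopic ⟨f, f.continuous⟩ (ContinuousMap.id _))
    (x0 : Metric.sphere (0 : EuclideanSpace ℝ (Fin 3)) 1) (hx0 : f x0 = x0) (x : Metric.sphere (0 : EuclideanSpace ℝ (Fin 3)) 1) :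
    f (f x) = x := by
  obtain ⟨Φ, hΦ⟩ : ∃ Φ : OnePoint ℂ ≃ₜ Metric.sphere (0 : EuclideanSpace ℝ (Fin 3)) 1, Φ OnePoint.infty = x0 := by
    have hv : ‖(x0 : EuclideanSpace ℝ (Fin 3))‖ = 1 := by simp
    have hv₀ : (x0 : EuclideanSpace ℝ (Fin 3)) ≠ 0 := fun contra => by simp [contra] at hv
    have : Fact (Module.finrank ℝ (EuclideanSpace ℝ (Fin 3)) = Module.finrank ℝ ℂ + 1) := ⟨by simp⟩
    have hV : Module.finrank ℝ ℂ = Module.finrank ℝ (Submodule.span ℝ {(x0 : EuclideanSpace ℝ (Fin 3))})ᗮ := (Submodule.finrank_orthogonal_span_singleton hv₀).symm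
    let e : ℂ ≃ₜ (Submodule.span ℝ {(x0 : EuclideanSpace ℝ (Fin 3))})ᗮ := (FiniteDimensional.nonempty_continuousLinearEquiv_of_finrank_eq hV).some.toHomeomorph
    exact ⟨e.onePointCongr.trans (onePointHyperplaneHomeoUnitSphere hv), rfl⟩
  set F : OnePoint ℂ ≃ₜ OnePoint ℂ := (Φ.trans f).trans Φ.symm with hF
  have hFi : F OnePoint.infty = OnePoint.infty := by
    show Φ.symm (f (Φ OnePoint.infty)) = OnePoint.infty
    rw [hΦ, hx0, ← hΦ]; simp
  have hFi' : F.symm OnePoint.infty = OnePoint.infty := by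
    rw [Homeomorph.symm_apply_eq, hFi]
  have key : ∀ (G : OnePoint ℂ ≃ₜ OnePoint ℂ), G OnePoint.infty = OnePoint.infty → ∃ g : ℂ → ℂ, Continuous g ∧ ∀ z : ℂ, ((g z : ℂ) : OnePoint ℂ) = G z := by
    intro G hG
    have : ∀ z : ℂ, ∃ w : ℂ, (w : OnePoint ℂ) = G z := by
      intro z
      refine OnePoint.ne_infty_iff_exists.1 (fun h => OnePoint.coe_ne_infty z (G.injective (h.trans hG.symm)))
    choose g hg using this
    refine ⟨g, ?_, hg⟩
    rw [OnePoint.isOpenEmbedding_coe.continuous_iff]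
    exact (G.continuous.comp OnePoint.continuous_coe).congr (fun z => (hg z).symm)
  obtain ⟨g, hgc, hg⟩ := key F hFi
  obtain ⟨g', hgc', hg'⟩ := key F.symm hFi'
  let φ : ℂ ≃ₜ ℂ :=
    { toFun := g, invFun := g', continuous_toFun := hgc, continuous_invFun := hgc'
      left_inv := fun z => OnePoint.coe_injective (by rw [hg', hg, Homeomorph.symm_apply_apply])
      right_inv := fun z => OnePoint.coe_injective (by rw [hg, hg', Homeomorph.apply_symm_apply]) }
  have hφ : ∀ z : ℂ, Φ ((φ z : ℂ) : OnePoint ℂ) = f (Φ z) := by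
    intro z
    show Φ ((g z : ℂ) : OnePoint ℂ) = f (Φ z)
    rw [hg]; simp [hF]
  obtain ⟨M, hMc, hM | hM⟩ := plane_dichotomy φ
  · exfalso
    apply hor
    have hH : ContinuousMap.Homotopic (ContinuousMap.id _) (⟨F, F.continuous⟩ : C(OnePoint ℂ, OnePoint ℂ)) := by
      refine ⟨⟨⟨HH φ M, HH_cont hMc hM⟩, ?_, ?_⟩⟩
      · intro w
        induction w using OnePoint.rec with
        | coe z => show ((_ : ℂ) : OnePoint ℂ) = (z : OnePoint ℂ); simp [GH_zero]
        | infty => rfl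
      · intro w
        induction w using OnePoint.rec with
        | coe z =>
          show ((_ : ℂ) : OnePoint ℂ) = F (z : OnePoint ℂ)
          rw [← hg]
          show ((_ : ℂ) : OnePoint ℂ) = ((φ z : ℂ) : OnePoint ℂ)
          have := GH_one hM z
          simp [this]
        | infty => exact hFi.symm
    have h2 := (((ContinuousMap.Homotopic.refl (⟨Φ, Φ.continuous⟩ : C(_, _))).comp hH).comp (ContinuousMap.Homotopic.refl (⟨Φ.symm, Φ.symm.continuous⟩ : C(_, _)))).symm
    convert h2 using 1
    · ext1 y; simp [hF]
    · ext1 y; simp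
  · have hit : ∀ (m : ℕ) (z : ℂ), Φ ((φ^[m] z : ℂ) : OnePoint ℂ) = f^[m] (Φ z) := by
      intro m
      induction m with
      | zero => intro z; rfl
      | succ m ih => intro z; rw [Function.iterate_succ_apply, ih, hφ, Function.iterate_succ_apply]
    have hemb : IsEmbedding (fun z : ℂ => Φ (z : OnePoint ℂ)) := Φ.isEmbedding.comp OnePoint.isOpenEmbedding_coe.isEmbedding
    have hc : CC (fun k => φ^[n k]) := by
      intro y
      rw [hemb.tendsto_nhds_iff]
      rw [Metric.tendsto_nhds]
      intro ε hε
      have e1 := (hrec (ε / 2) (half_pos hε))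
      have e2 := (Metric.tendsto_nhds.1 (hemb.continuous.tendsto y)) (ε / 2) (half_pos hε)
      filter_upwards [tendsto_fst.eventually e1, tendsto_snd.eventually e2] with q h1 h2
      simp only [Function.comp, hit]
      have := dist_triangle (f^[n q.1] (Φ q.2)) (Φ q.2) (Φ y)
      linarith [h1 (Φ q.2)]
    have hmain := plane_main hMc hM hn hc
    obtain ⟨w, rfl⟩ := Φ.surjective x
    induction w using OnePoint.rec with
    | coe z => rw [← hφ, ← hφ, hmain]
    | infty => rw [hΦ, hx0, hx0]

/-- A recurrent orientation-reversing homeomorphism of the 2-sphere with a fixed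
point is an involution. -/
theorem sphere_recurrent_reversing_involution (f : Sphere2 ≃ₜ Sphere2)
    (hrec : IsRecurrent (f : Sphere2 → Sphere2))
    (hor : ¬ SphereOrientationPreserving f)
    (hfix : ∃ x, f x = x) :
    ∀ x, f (f x) = x := by
  obtain ⟨n, hn, hr⟩ := hrec
  obtain ⟨x0, hx0⟩ := hfix
  exact sphere_main f hn hr hor x0 hx0
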